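/- Let m ≥ 2 be an integer, Δ > 1 and 0 < α < 1/m. Then there exists a constant C such that: for every real 2m×m matrix J with J^1 invertible such that A_j := Π_j J is Δ-regular for each j ∈ 𝒞, for every convex tree 𝒯 of dyadic cubes in ℝ^m, for every measurable c : (0,∞) → ℂ with |c| ≤ 1 almost everywhere, every u ∈ ℝ^{2m}, every 1 ≤ i ≤ m, and every tuple (F_j)_{j∈𝒞} of real-valued smooth compactly supported functions on ℝ^m, one has |Λ̃_𝒯((F_j)_{j∈𝒞})| ≤ C |Q_𝒯| ∏_{j∈𝒞} M_α(F_j)(A_j𝒯). -/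

import Mathlib

open MeasureTheory Matrix
open scoped ENNReal NNReal BigOperators

noncomputable section

namespace SBL

/-- The set of corners of the `m`-dimensional cube: functions `{1,…,m} → {0,1}`. -/
abbrev Corner (m : ℕ) := Fin m → Fin 2

/-- Index type for `ℝ^{2m}`: coordinates `x^0_i` (left) and `x^1_i` (right). -/
abbrev Idx (m : ℕ) := Fin m ⊕ Fin m

/-- The coordinate of `ℝ^{2m}` selected by the corner `j` at position `i`. -/
def sel {m : ℕ} (j : Corner m) (i : Fin m) : Idx m :=
  if j i = 0 then Sum.inl i else Sum.inr i

/-- The projection `Π_j : ℝ^{2m} → ℝ^m`, `Π_j x = (x_1^{j(1)},…,x_m^{j(m)})`. -/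
def proj {m : ℕ} (j : Corner m) (x : Idx m → ℝ) : Fin m → ℝ := fun i => x (sel j i)

/-- The projection `Π_j` as an `m × 2m` matrix. -/
def projM {m : ℕ} (j : Corner m) : Matrix (Fin m) (Idx m) ℝ :=
  Matrix.of fun i k => if k = sel j i then 1 else 0

/-- `A_j := Π_j J`, the `m × m` matrix obtained by applying `Π_j` to (the columns of) a
`2m × m` matrix `J`, i.e. selecting rows of `J` according to the corner `j`. -/
def Amat {m : ℕ} (J : Matrix (Idx m) (Fin m) ℝ) (j : Corner m) : Matrix (Fin m) (Fin m) ℝ :=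
  Matrix.of fun i k => J (sel j i) k

/-- Euclidean norm on a finite pi type. -/
def en {ι : Type*} [Fintype ι] (x : ι → ℝ) : ℝ := Real.sqrt (∑ i, (x i) ^ 2)

/-- Operator norm of a matrix with respect to the Euclidean norms. -/
def opNorm {ι κ : Type*} [Fintype ι] [Fintype κ] [DecidableEq κ] (A : Matrix ι κ ℝ) : ℝ :=
  ‖LinearMap.toContinuousLinearMap (Matrix.toEuclideanLin A)‖

/-- `Δ`-regularity of a square matrix: `max(‖A‖, |det A|⁻¹) ≤ Δ` (in particular `det A ≠ 0`). -/
def IsReg {m : ℕ} (Δ : ℝ) (A : Matrix (Fin m) (Fin m) ℝ) : Prop :=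
  opNorm A ≤ Δ ∧ A.det ≠ 0 ∧ |A.det|⁻¹ ≤ Δ

/-- A Calderón–Zygmund kernel of order `n` in `ℝ^m`, given by its multiplier `K̂` on
`ℝ^m ∖ {0}`: it is `n` times continuously differentiable there and satisfies the symbol
estimates `‖D^k K̂(η)‖ ≤ |η|^{-k}` for all `k ≤ n`. -/
def IsCZ {m : ℕ} (n : ℕ) (Khat : (Fin m → ℝ) → ℂ) : Prop :=
  ContDiffOn ℝ n Khat {0}ᶜ ∧
  ∀ k : ℕ, k ≤ n → ∀ η : Fin m → ℝ, η ≠ 0 →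
    ‖iteratedFDerivWithin ℝ k Khat {0}ᶜ η‖ ≤ (en η) ^ (-(k : ℝ))

/-- Fourier transform of a (nice) function on `ℝ^{2m}`. -/
def fourierT {m : ℕ} (φ : (Idx m → ℝ) → ℝ) (ξ : Idx m → ℝ) : ℂ :=
  ∫ x : Idx m → ℝ, Complex.exp (-2 * Real.pi * Complex.I * (∑ k, x k * ξ k)) * (φ x : ℂ)

/-- The principal value `p.v. ∫_{ℝ^{2m}} (∏_j F_j(Π_j x)) K(Πx) dx`, defined as
`∫_{ℝ^m} φ̂(−Π^T η) K̂(η) dη` with `φ = ∏_j F_j ∘ Π_j`. -/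
def pv {m : ℕ} (P : Matrix (Fin m) (Idx m) ℝ) (Khat : (Fin m → ℝ) → ℂ)
    (F : Corner m → (Fin m → ℝ) → ℝ) : ℂ :=
  ∫ η : Fin m → ℝ, fourierT (fun x => ∏ j, F j (proj j x)) (-(P.transpose.mulVec η)) * Khat η

/-- Upper `m×m` block `J^0` of a `2m×m` matrix. -/
def Jb0 {m : ℕ} (J : Matrix (Idx m) (Fin m) ℝ) : Matrix (Fin m) (Fin m) ℝ :=
  J.submatrix Sum.inl id

/-- Lower `m×m` block `J^1` of a `2m×m` matrix. -/
def Jb1 {m : ℕ} (J : Matrix (Idx m) (Fin m) ℝ) : Matrix (Fin m) (Fin m) ℝ :=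
  J.submatrix Sum.inr id

/-- `Π^J := (I, −J^0 (J^1)⁻¹)`. -/
def PiJ {m : ℕ} (J : Matrix (Idx m) (Fin m) ℝ) : Matrix (Fin m) (Idx m) ℝ :=
  Matrix.fromCols 1 (-(Jb0 J * (Jb1 J)⁻¹))

/-- The dyadic cube with parameters `Q = (k, n)`: `∏_i [2^k n_i, 2^k (n_i+1))`. -/
def dC {m : ℕ} (Q : ℤ × (Fin m → ℤ)) : Set (Fin m → ℝ) :=
  {x | ∀ i, (2:ℝ)^Q.1 * (Q.2 i : ℝ) ≤ x i ∧ x i < (2:ℝ)^Q.1 * ((Q.2 i : ℝ) + 1)}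

/-- `Q*`: the cube with the same center as `Q` and three times the side length. -/
def dCstar {m : ℕ} (Q : ℤ × (Fin m → ℤ)) : Set (Fin m → ℝ) :=
  {x | ∀ i, (2:ℝ)^Q.1 * ((Q.2 i : ℝ) - 1) ≤ x i ∧ x i < (2:ℝ)^Q.1 * ((Q.2 i : ℝ) + 2)}

/-- A (1/2-)sparse collection of dyadic cubes. -/
def IsSparse {m : ℕ} (S : Set (ℤ × (Fin m → ℤ))) : Prop :=
  ∀ Q ∈ S,
    (∑' Q' : {q : ℤ × (Fin m → ℤ) // q ∈ S ∧ dC q ⊆ dC Q}, volume (dC Q'.val)) ≤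
      2 * volume (dC Q)

/-- The average `[F]_S := (|S|⁻¹ ∫_S |F|^{2^{m-1}})^{2^{1-m}}`. -/
def avg {m : ℕ} (S : Set (Fin m → ℝ)) (F : (Fin m → ℝ) → ℝ) : ℝ :=
  (((volume S).toReal)⁻¹ * ∫ x in S, |F x| ^ (2^(m-1) : ℕ)) ^ ((2:ℝ) ^ ((1:ℤ) - (m:ℤ)))

/-- The closed axis-parallel box `∏_i [a_i, b_i]`. -/
def box {m : ℕ} (a b : Fin m → ℝ) : Set (Fin m → ℝ) := {x | ∀ i, a i ≤ x i ∧ x i ≤ b i}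

/-- Reciprocal eccentricity `ε_R = (min_i |I_i|)/(max_i |I_i|)` of the box `∏_i [a_i,b_i]`. -/
def ecc {m : ℕ} (a b : Fin m → ℝ) : ℝ := (⨅ i, (b i - a i)) / (⨆ i, (b i - a i))

/-- Modified strong maximal function evaluated on a set `S`:
`sup { (ε_R^α)^{2^{1-m}} [F]_R : R ∈ ℛ, S ⊆ R }` (as an extended real). -/
def Mal {m : ℕ} (α : ℝ) (F : (Fin m → ℝ) → ℝ) (S : Set (Fin m → ℝ)) : ℝ≥0∞ :=
  ⨆ (a : Fin m → ℝ) (b : Fin m → ℝ) (_ : ∀ i, a i < b i) (_ : S ⊆ box a b),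
    ENNReal.ofReal ((ecc a b ^ α) ^ ((2:ℝ) ^ ((1:ℤ) - (m:ℤ))) * avg (box a b) F)

/-- `M_α(F)(A𝒯) := sup_{Q ∈ 𝒯} M_α(F)(AQ)`. -/
def MalTree {m : ℕ} (α : ℝ) (F : (Fin m → ℝ) → ℝ) (A : Matrix (Fin m) (Fin m) ℝ)
    (T : Set (ℤ × (Fin m → ℤ))) : ℝ≥0∞ :=
  ⨆ Q ∈ T, Mal α F (A.mulVec '' dC Q)

/-- A convex tree of dyadic cubes with top cube `Qt`. -/
def ConvexTree {m : ℕ} (T : Set (ℤ × (Fin m → ℤ))) (Qt : ℤ × (Fin m → ℤ)) : Prop :=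
  Qt ∈ T ∧ (∀ Q ∈ T, dC Q ⊆ dC Qt) ∧
  ∀ Q ∈ T, ∀ Q' : ℤ × (Fin m → ℤ), dC Q ⊆ dC Q' → dC Q' ⊆ dC Qt → Q' ∈ T

/-- The Gaussian `g(x) = e^{−π|x|²}` on `ℝ^{2m}`. -/
def gss {m : ℕ} (x : Idx m → ℝ) : ℝ := Real.exp (-Real.pi * ∑ k, (x k) ^ 2)

/-- The mixed partial derivative `∂^0_i ∂^1_i g`. -/
def ddg {m : ℕ} (i : Fin m) (x : Idx m → ℝ) : ℝ :=
  fderiv ℝ (fun y : Idx m → ℝ => fderiv ℝ gss y (Pi.single (Sum.inl i) (1:ℝ))) x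
    (Pi.single (Sum.inr i) (1:ℝ))

/-- Isotropic `L¹` dilation on `ℝ^{2m}`: `φ_t(x) = t^{-2m} φ(t⁻¹ x)`. -/
def dil {m : ℕ} (t : ℝ) (φ : (Idx m → ℝ) → ℝ) (x : Idx m → ℝ) : ℝ :=
  (t ^ (2*m))⁻¹ * φ (t⁻¹ • x)

/-- Matrix dilation: `φ_D(x) = (det D)⁻¹ φ(D⁻¹ x)`. -/
def dilM {m : ℕ} (D : Matrix (Idx m) (Idx m) ℝ) (φ : (Idx m → ℝ) → ℝ) (x : Idx m → ℝ) : ℝ :=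
  (D.det)⁻¹ * φ (D⁻¹.mulVec x)

/-- The region `Ω_𝒯 = ∪_{Q∈𝒯} Q × (ℓ(Q)/2, ℓ(Q))` in the upper half space. -/
def Omega {m : ℕ} (T : Set (ℤ × (Fin m → ℤ))) : Set ((Fin m → ℝ) × ℝ) :=
  ⋃ Q ∈ T, (dC Q) ×ˢ Set.Ioo ((2:ℝ)^Q.1 / 2) ((2:ℝ)^Q.1)

/-- The localized form `Λ_𝒯((F_j)_j)`. -/
def LambdaT {m : ℕ} (J : Matrix (Idx m) (Fin m) ℝ) (T : Set (ℤ × (Fin m → ℤ)))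
    (c : ℝ → ℂ) (u : Idx m → ℝ) (i : Fin m) (F : Corner m → (Fin m → ℝ) → ℝ) : ℂ :=
  ∫ z in Omega T, c z.2 * Complex.ofReal ((1 + en u ^ (4*m))⁻¹ * (z.2)⁻¹ *
    ∫ x : Idx m → ℝ, (∏ j, F j (proj j x)) * dil z.2 (ddg i) (x - J.mulVec z.1 + z.2 • u))

/-- `T_k := ∪ {Q ∈ 𝒯 : ℓ(Q) = 2^k}`. -/
def Tkset {m : ℕ} (T : Set (ℤ × (Fin m → ℤ))) (k : ℤ) : Set (Fin m → ℝ) :=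
  ⋃ Q ∈ {q ∈ T | q.1 = k}, dC Q

/-- The form `Λ̃_𝒯((F_j)_j)` with localization in the `x` variables. -/
def LambdaTilde {m : ℕ} (J : Matrix (Idx m) (Fin m) ℝ) (T : Set (ℤ × (Fin m → ℤ)))
    (c : ℝ → ℂ) (u : Idx m → ℝ) (i : Fin m) (F : Corner m → (Fin m → ℝ) → ℝ) : ℂ :=
  ∑' k : ℤ, ∫ t in Set.Ioc ((2:ℝ)^(k-1)) ((2:ℝ)^k),
    c t * Complex.ofReal ((1 + en u ^ (4*m))⁻¹ * t⁻¹ *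
      ∫ p : Fin m → ℝ, ∫ x : Idx m → ℝ,
        (∏ j, Set.indicator ((Amat J j).mulVec '' Tkset T k) (F j) (proj j x)) *
          dil t (ddg i) (x - J.mulVec p + t • u))

/-- The form `Λ(𝒯,J,K)((F_j)_j)` from the induction proposition. -/
def LambdaK {m : ℕ} (J : Matrix (Idx m) (Fin m) ℝ) (T : Set (ℤ × (Fin m → ℤ)))
    (K : ℝ → (Idx m → ℝ) → ℂ) (F : Corner m → (Fin m → ℝ) → ℝ) : ℂ :=
  ∑' k : ℤ, ∫ x : Idx m → ℝ,
    Complex.ofReal (∏ j, Set.indicator ((Amat J j).mulVec '' Tkset T k) (F j) (proj j x)) *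
      ∫ t in Set.Ioc ((2:ℝ)^(k-1)) ((2:ℝ)^k), K t x * (t : ℂ)⁻¹

/-- The reflected corner `i∗j`, differing from `j` exactly at position `i`. -/
def istar {m : ℕ} (i : Fin m) (j : Corner m) : Corner m :=
  fun k => if k = i then 1 - j i else j k

/-- The diagonal matrix `Θ̃` with entry 0 at positions `i ≤ l` and 1 at positions `i > l`
(1-based), i.e. 0 for `i < l` and 1 otherwise in 0-based indexing. -/
def Th {m : ℕ} (l : ℕ) : Matrix (Fin m) (Fin m) ℝ :=
  Matrix.diagonal fun i => if (i : ℕ) < l then 0 else 1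

/-- The block diagonal matrix `Θ = diag(Θ̃, Θ̃)`. -/
def ThB {m : ℕ} (l : ℕ) : Matrix (Idx m) (Idx m) ℝ :=
  Matrix.diagonal (Sum.elim (fun i : Fin m => if (i:ℕ) < l then (0:ℝ) else 1)
    (fun i : Fin m => if (i:ℕ) < l then (0:ℝ) else 1))

end SBL

namespace SBL

/-- Polynomial factors of the derivatives of `e^{-πy²}`. -/
def hermP : ℕ → Polynomial ℝ
  | 0 => 1
  | a + 1 => Polynomial.derivative (hermP a) - Polynomial.C (2 * Real.pi) * Polynomial.X * hermP a

/-- The `a`-th derivative of the standard Gaussian `e^{-πy²}`. -/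
def hgs (a : ℕ) (y : ℝ) : ℝ := (hermP a).eval y * Real.exp (-Real.pi * y ^ 2)

/-- `L¹`-normalized dilation of `hgs a`. -/
def hg (a : ℕ) (r y : ℝ) : ℝ := r⁻¹ * hgs a (y / r)

/-- The `a`-th derivative of the dilated Gaussian `hg 0 r`. -/
def gd (a : ℕ) (r y : ℝ) : ℝ := (r ^ a)⁻¹ * hg a r y

lemma hgs_zero (y : ℝ) : hgs 0 y = Real.exp (-Real.pi * y ^ 2) := by simp [hgs, hermP]

lemma hasDerivAt_exp_sq (y : ℝ) : HasDerivAt (fun y : ℝ => Real.exp (-Real.pi * y ^ 2))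
    (Real.exp (-Real.pi * y ^ 2) * (-Real.pi * (2 * y))) y := by
  have h : HasDerivAt (fun y : ℝ => -Real.pi * y ^ 2) (-Real.pi * (2 * y)) y := by
    simpa using (hasDerivAt_pow 2 y).const_mul (-Real.pi)
  exact h.exp

lemma hasDerivAt_hgs (a : ℕ) (y : ℝ) : HasDerivAt (hgs a) (hgs (a + 1) y) y := by
  have h := ((hermP a).hasDerivAt y).mul (hasDerivAt_exp_sq y)
  refine h.congr_deriv ?_
  simp only [hgs, hermP, Polynomial.eval_sub, Polynomial.eval_mul, Polynomial.eval_C,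
    Polynomial.eval_X]
  ring

lemma hermP_derivative (a : ℕ) : Polynomial.derivative (hermP (a + 1)) =
    -(Polynomial.C (2 * Real.pi * (a + 1)) * hermP a) := by
  induction a with
  | zero => simp [hermP]
  | succ n ih =>
    rw [show hermP (n + 1 + 1) = Polynomial.derivative (hermP (n + 1)) -
      Polynomial.C (2 * Real.pi) * Polynomial.X * hermP (n + 1) from rfl]
    rw [Polynomial.derivative_sub, ih]
    simp only [Polynomial.derivative_mul, Polynomial.derivative_neg, Polynomial.derivative_C,
      Polynomial.derivative_X, ih]
    have : hermP (n + 1) = Polynomial.derivative (hermP n) -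
      Polynomial.C (2 * Real.pi) * Polynomial.X * hermP n := rfl
    have h2 : Polynomial.derivative (hermP n) = hermP (n + 1) +
      Polynomial.C (2 * Real.pi) * Polynomial.X * hermP n := by rw [this]; ring
    rw [h2]
    simp only [Nat.cast_add, Nat.cast_one, map_mul, map_add, map_one]
    ring

lemma hgs_add_two (a : ℕ) (y : ℝ) : hgs (a + 2) y =
    -(2 * Real.pi) * (y * hgs (a + 1) y + (a + 1) * hgs a y) := by
  have : hermP (a + 2) = Polynomial.derivative (hermP (a + 1)) -
      Polynomial.C (2 * Real.pi) * Polynomial.X * hermP (a + 1) := rfl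
  simp only [hgs, this, hermP_derivative, Polynomial.eval_sub, Polynomial.eval_mul,
    Polynomial.eval_C, Polynomial.eval_X, Polynomial.eval_neg]
  ring

lemma hasDerivAt_gd (a : ℕ) (r y : ℝ) : HasDerivAt (gd a r) (gd (a + 1) r y) y := by
  have h : HasDerivAt (fun y : ℝ => hgs a (y / r)) (hgs (a + 1) (y / r) * (1 / r)) y :=
    HasDerivAt.comp (h₂ := hgs a) y (hasDerivAt_hgs a (y / r)) ((hasDerivAt_id y).div_const r)
  refine ((h.const_mul r⁻¹).const_mul (r ^ a)⁻¹).congr_deriv ?_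
  simp only [gd, hg, pow_succ, mul_inv]
  ring

lemma hasDerivAt_gd_scale (a : ℕ) (y : ℝ) {r : ℝ} (hr : r ≠ 0) :
    HasDerivAt (fun r => gd a r y) (r / (2 * Real.pi) * gd (a + 2) r y) r := by
  have h : HasDerivAt (fun r : ℝ => hgs a (y / r)) (hgs (a + 1) (y / r) * (y * (-(r ^ 2)⁻¹))) r := by
    have := (hasDerivAt_inv hr).const_mul y
    simp only [div_eq_mul_inv]
    exact (hasDerivAt_hgs a (y * r⁻¹)).comp r this
  have h1 := (hasDerivAt_inv hr).mul h
  have h2 := ((hasDerivAt_pow a r).inv (pow_ne_zero a hr)).mul h1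
  refine h2.congr_deriv ?_
  simp only [gd, hg, hgs_add_two, Pi.inv_apply, Pi.mul_apply]
  have hpi := Real.pi_ne_zero
  cases a with
  | zero => field_simp; push_cast; ring
  | succ n => field_simp; push_cast; simp only [pow_succ]; field_simp; ring

lemma continuous_hgs (a : ℕ) : Continuous (hgs a) := by
  unfold hgs; fun_prop

lemma continuous_hg (a : ℕ) (r : ℝ) : Continuous (hg a r) := by
  unfold hg
  exact continuous_const.mul ((continuous_hgs a).comp (by fun_prop))

lemma measurable_hg (a : ℕ) : Measurable (fun z : ℝ × ℝ => hg a z.1 z.2) := by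
  unfold hg
  exact measurable_fst.inv.mul ((continuous_hgs a).measurable.comp (measurable_snd.div measurable_fst))

lemma measurable_gd (a : ℕ) : Measurable (fun z : ℝ × ℝ => gd a z.1 z.2) := by
  unfold gd
  exact ((measurable_fst.pow_const a).inv).mul (measurable_hg a)

lemma gd_zero (r y : ℝ) : gd 0 r y = hg 0 r y := by simp [gd]

lemma hg_zero_nonneg {r : ℝ} (hr : 0 ≤ r) (y : ℝ) : 0 ≤ hg 0 r y := by
  unfold hg; rw [hgs_zero]; positivity

/-- A polynomial is dominated by any Gaussian growth. -/
lemma poly_le_exp (P : Polynomial ℝ) {c : ℝ} (hc : 0 < c) :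
    ∃ C : ℝ, 0 < C ∧ ∀ y : ℝ, |P.eval y| ≤ C * Real.exp (c * y ^ 2) := by
  induction P using Polynomial.induction_on' with
  | add p q hp hq =>
    obtain ⟨C, hC, h⟩ := hp
    obtain ⟨D, hD, h'⟩ := hq
    refine ⟨C + D, by positivity, fun y => ?_⟩
    rw [Polynomial.eval_add, add_mul]
    exact (abs_add_le _ _).trans (add_le_add (h y) (h' y))
  | monomial n a =>
    refine ⟨|a| * (1 + n.factorial / c ^ n) + 1, by positivity, fun y => ?_⟩
    rw [Polynomial.eval_monomial, abs_mul, abs_pow]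
    have h1 : (1:ℝ) ≤ Real.exp (c * y ^ 2) := Real.one_le_exp (by positivity)
    have h2 : |y| ^ n ≤ (1 + n.factorial / c ^ n) * Real.exp (c * y ^ 2) := by
      have h3 := Real.pow_div_factorial_le_exp (c * y ^ 2) (by positivity) n
      have h4 : (y ^ 2) ^ n ≤ n.factorial / c ^ n * Real.exp (c * y ^ 2) := by
        rw [div_le_iff₀ (by positivity), mul_pow] at h3
        rw [div_mul_eq_mul_div, le_div_iff₀ (by positivity)]
        linarith
      have h5 : |y| ^ n ≤ 1 + (y ^ 2) ^ n := by
        rw [← sq_abs y, ← pow_mul, mul_comm, pow_mul]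
        nlinarith [sq_nonneg (|y| ^ n - 1), pow_nonneg (abs_nonneg y) n]
      rw [add_mul, one_mul]; linarith
    calc |a| * |y| ^ n ≤ |a| * ((1 + n.factorial / c ^ n) * Real.exp (c * y ^ 2)) := by gcongr
      _ ≤ _ := by rw [← mul_assoc, add_mul (|a| * _)]; linarith

lemma hgs_le (a : ℕ) : ∃ C : ℝ, 0 < C ∧ ∀ y : ℝ,
    |hgs a y| ≤ C * Real.exp (-(Real.pi / 4) * y ^ 2) := by
  obtain ⟨C, hC, h⟩ := poly_le_exp (hermP a) (c := 3 * Real.pi / 4) (by positivity)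
  refine ⟨C, hC, fun y => ?_⟩
  unfold hgs
  rw [abs_mul, Real.abs_exp]
  calc _ ≤ C * Real.exp (3 * Real.pi / 4 * y ^ 2) * Real.exp (-Real.pi * y ^ 2) := by
        gcongr; exact h y
    _ = _ := by rw [mul_assoc, ← Real.exp_add]; ring_nf

lemma hg_le (a : ℕ) : ∃ C : ℝ, 0 < C ∧ ∀ r : ℝ, 0 < r → ∀ y : ℝ,
    |hg a r y| ≤ C * hg 0 (2 * r) y := by
  obtain ⟨C, hC, h⟩ := hgs_le a
  refine ⟨2 * C, by positivity, fun r hr y => ?_⟩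
  unfold hg
  rw [abs_mul, abs_of_pos (inv_pos.mpr hr), hgs_zero]
  calc _ ≤ r⁻¹ * (C * Real.exp (-(Real.pi / 4) * (y / r) ^ 2)) := by gcongr; exact h _
    _ = _ := by
      rw [show -Real.pi * (y / (2 * r)) ^ 2 = -(Real.pi / 4) * (y / r) ^ 2 by ring]
      field_simp

/-- Uniform Gaussian domination on a compact range of scales. -/
lemma gd_le (a : ℕ) {ρ₀ ρ₁ : ℝ} (h0 : 0 < ρ₀) :
    ∃ C : ℝ, 0 < C ∧ ∀ r : ℝ, ρ₀ ≤ r → r ≤ ρ₁ → ∀ y : ℝ,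
    |gd a r y| ≤ C * Real.exp (-(Real.pi / 4 / ρ₁ ^ 2) * y ^ 2) := by
  obtain ⟨C, hC, h⟩ := hgs_le a
  refine ⟨(ρ₀ ^ a)⁻¹ * (ρ₀⁻¹ * C), by positivity, fun r hr hr1 y => ?_⟩
  have hr0 : 0 < r := h0.trans_le hr
  have hρ1 : 0 < ρ₁ := hr0.trans_le hr1
  unfold gd hg
  rw [abs_mul, abs_mul, abs_of_pos (inv_pos.mpr hr0), abs_of_pos (inv_pos.mpr (pow_pos hr0 a)),
    mul_assoc, mul_assoc]
  have : |hgs a (y / r)| ≤ C * Real.exp (-(Real.pi / 4 / ρ₁ ^ 2) * y ^ 2) := by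
    refine (h _).trans (mul_le_mul_of_nonneg_left (Real.exp_le_exp.mpr ?_) hC.le)
    rw [neg_mul, neg_mul, neg_le_neg_iff, div_pow, div_mul_eq_mul_div, mul_div_assoc]
    have : y ^ 2 / ρ₁ ^ 2 ≤ y ^ 2 / r ^ 2 := by gcongr
    exact mul_le_mul_of_nonneg_left this (by positivity)
  gcongr

lemma integrable_hgs_mul_pow (a : ℕ) (P : Polynomial ℝ) :
    Integrable (fun y => P.eval y * hgs a y) := by
  obtain ⟨C, hC, h⟩ := poly_le_exp (P * hermP a) (c := Real.pi / 2) (by positivity)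
  have hg : Integrable (fun y : ℝ => C * Real.exp (-(Real.pi / 2) * y ^ 2)) :=
    (integrable_exp_neg_mul_sq (by positivity)).const_mul C
  refine hg.mono' (P.continuous.mul (continuous_hgs a)).aestronglyMeasurable
    (Filter.Eventually.of_forall fun y => ?_)
  have := h y
  rw [Real.norm_eq_abs, hgs, ← mul_assoc, ← Polynomial.eval_mul, abs_mul, Real.abs_exp]
  calc _ ≤ C * Real.exp (Real.pi / 2 * y ^ 2) * Real.exp (-Real.pi * y ^ 2) := by gcongr
    _ = _ := by rw [mul_assoc, ← Real.exp_add]; ring_nf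

lemma integrable_hgs (a : ℕ) : Integrable (hgs a) := by
  simpa using integrable_hgs_mul_pow a 1

lemma integral_hgs_zero : ∫ y, hgs 0 y = 1 := by
  simp only [hgs_zero]
  rw [integral_gaussian, div_self Real.pi_ne_zero, Real.sqrt_one]

lemma integrable_hg (a : ℕ) {r : ℝ} (hr : 0 < r) : Integrable (hg a r) :=
  ((integrable_hgs a).comp_div hr.ne').const_mul _

lemma integral_hg_zero {r : ℝ} (hr : 0 < r) : ∫ y, hg 0 r y = 1 := by
  unfold hg
  rw [integral_const_mul, Measure.integral_comp_div (hgs 0) r, integral_hgs_zero, abs_of_pos hr]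
  simp [hr.ne']

/-- Shifting a Gaussian by at most `θ` times its scale. -/
lemma hg_shift {r θ y w : ℝ} (hr : 0 < r) (hθ : 0 ≤ θ) (hw : |w| ≤ θ * r) :
    hg 0 r (y + w) ≤ 2 * Real.exp Real.pi * (1 + θ) * hg 0 (2 * (1 + θ) * r) y := by
  unfold hg
  rw [hgs_zero, hgs_zero]
  have key : -Real.pi * ((y + w) / r) ^ 2 ≤ Real.pi + -Real.pi * (y / (2 * (1 + θ) * r)) ^ 2 := by
    set z := y / r with hz
    set v := w / r with hv
    have hv' : |v| ≤ θ := by rw [hv, abs_div, abs_of_pos hr, div_le_iff₀ hr]; exact hw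
    have e1 : (y + w) / r = z + v := by rw [hz, hv]; ring
    have e2 : y / (2 * (1 + θ) * r) = z / (2 * (1 + θ)) := by rw [hz]; field_simp
    rw [e1, e2]
    have : (z / (2 * (1 + θ))) ^ 2 ≤ 1 + (z + v) ^ 2 := by
      rw [div_pow, div_le_iff₀ (by positivity)]
      have hv2 : v ^ 2 ≤ θ ^ 2 := by rw [← sq_abs v]; gcongr
      have h3 : z ^ 2 ≤ 2 * (z + v) ^ 2 + 2 * v ^ 2 := by nlinarith [sq_nonneg (z + 2 * v)]
      have h4 : 2 * (z + v) ^ 2 ≤ (z + v) ^ 2 * (2 * (1 + θ)) ^ 2 := by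
        have : (2:ℝ) ≤ (2 * (1 + θ)) ^ 2 := by nlinarith
        nlinarith [sq_nonneg (z + v)]
      nlinarith
    nlinarith [Real.pi_pos]
  calc r⁻¹ * Real.exp (-Real.pi * ((y + w) / r) ^ 2)
      ≤ r⁻¹ * (Real.exp Real.pi * Real.exp (-Real.pi * (y / (2 * (1 + θ) * r)) ^ 2)) := by
        rw [← Real.exp_add]; gcongr
    _ = _ := by field_simp

lemma hgs_bdd (a : ℕ) : ∃ C : ℝ, 0 < C ∧ ∀ y : ℝ, |hgs a y| ≤ C := by
  obtain ⟨C, hC, h⟩ := hgs_le a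
  refine ⟨C, hC, fun y => (h y).trans ?_⟩
  have : Real.exp (-(Real.pi / 4) * y ^ 2) ≤ 1 := by
    rw [Real.exp_le_one_iff]
    have := Real.pi_pos
    nlinarith [sq_nonneg y]
  nlinarith

lemma hasDerivAt_hgs_conv (a b : ℕ) (z : ℝ) :
    HasDerivAt (fun z => ∫ v, hgs a (z - v) * hgs b v) (∫ v, hgs (a + 1) (z - v) * hgs b v) z := by
  obtain ⟨C, hC, h⟩ := hgs_bdd a
  obtain ⟨D, hD, h'⟩ := hgs_bdd (a + 1)
  have hmeas : ∀ n z, AEStronglyMeasurable (fun v => hgs n (z - v) * hgs b v) volume := fun n z =>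
    (((continuous_hgs n).comp (continuous_const.sub continuous_id)).mul
      (continuous_hgs b)).aestronglyMeasurable
  refine (hasDerivAt_integral_of_dominated_loc_of_deriv_le (s := Set.univ)
    (F := fun z v => hgs a (z - v) * hgs b v) (F' := fun z v => hgs (a + 1) (z - v) * hgs b v)
    (bound := fun v => D * |hgs b v|)
    Filter.univ_mem (Filter.Eventually.of_forall fun z => hmeas a z) ?_ (hmeas (a + 1) z) ?_ ?_ ?_).2
  · refine ((integrable_hgs b).abs.const_mul C).mono' (hmeas a z)
      (Filter.Eventually.of_forall fun v => ?_)
    rw [Real.norm_eq_abs, abs_mul]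
    gcongr
    exact h _
  · refine Filter.Eventually.of_forall fun v z _ => ?_
    rw [Real.norm_eq_abs, abs_mul]
    gcongr
    exact h' _
  · exact (integrable_hgs b).abs.const_mul D
  · refine Filter.Eventually.of_forall fun v z _ => ?_
    have := HasDerivAt.comp (h₂ := hgs a) z (hasDerivAt_hgs a (z - v))
      ((hasDerivAt_id z).sub_const v)
    simpa using this.mul_const (hgs b v)

lemma hgs_conv_comm (a b : ℕ) (z : ℝ) :
    ∫ v, hgs a (z - v) * hgs b v = ∫ v, hgs b (z - v) * hgs a v := by
  rw [← integral_sub_left_eq_self _ volume z]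
  congr 1; ext v; rw [sub_sub_cancel, mul_comm]

lemma hgs_conv_zero (z : ℝ) : ∫ v, hgs 0 (z - v) * hgs 0 v = gd 0 (Real.sqrt 2) z := by
  have e : ∀ v, hgs 0 (z - v) * hgs 0 v =
      Real.exp (-Real.pi * (z / Real.sqrt 2) ^ 2) * Real.exp (-(2 * Real.pi) * (v - z / 2) ^ 2) := by
    intro v
    rw [hgs_zero, hgs_zero, ← Real.exp_add, ← Real.exp_add, div_pow,
      Real.sq_sqrt (by norm_num : (0:ℝ) ≤ 2)]
    ring_nf
  simp_rw [e]
  rw [integral_const_mul, integral_sub_right_eq_self (fun v => Real.exp (-(2 * Real.pi) * v ^ 2)),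
    integral_gaussian, gd_zero, hg, hgs_zero,
    show Real.pi / (2 * Real.pi) = 2⁻¹ by field_simp, Real.sqrt_inv, mul_comm]

lemma hgs_conv_one (a : ℕ) (z : ℝ) :
    ∫ v, hgs a (z - v) * hgs 1 v = gd (a + 1) (Real.sqrt 2) z := by
  induction a generalizing z with
  | zero =>
    rw [hgs_conv_comm]
    have h := hasDerivAt_hgs_conv 0 0 z
    simp_rw [hgs_conv_zero] at h
    exact h.unique (hasDerivAt_gd 0 _ z)
  | succ n ih =>
    have h := hasDerivAt_hgs_conv n 1 z
    simp_rw [ih] at h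
    exact h.unique (hasDerivAt_gd (n + 1) _ z)

/-- Reproducing formula writing a higher derivative as an average of first derivatives. -/
lemma hg_succ_eq_conv (a : ℕ) {r : ℝ} (hr : 0 < r) (y : ℝ) :
    hg (a + 1) (Real.sqrt 2 * r) y =
      Real.sqrt 2 ^ (a + 1) * ∫ v, hgs a v * hg 1 r (y - r * v) := by
  have h2 : (0:ℝ) < Real.sqrt 2 := by positivity
  have e : ∀ v, hgs a v * hg 1 r (y - r * v) = r⁻¹ * (hgs 1 (y / r - v) * hgs a v) := by
    intro v
    unfold hg
    rw [show (y - r * v) / r = y / r - v by field_simp]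
    ring
  simp_rw [e]
  rw [integral_const_mul, ← hgs_conv_comm, hgs_conv_one]
  unfold gd hg
  rw [show y / (Real.sqrt 2 * r) = y / r / Real.sqrt 2 by field_simp]
  field_simp

/-- Translated version of the reproducing formula. -/
lemma hg_succ_shift_eq_conv (a : ℕ) {r : ℝ} (hr : 0 < r) (y s : ℝ) :
    hg (a + 1) (Real.sqrt 2 * r) (y + r * s) =
      ∫ v, (Real.sqrt 2 ^ (a + 1) * hgs a (v + s)) * hg 1 r (y - r * v) := by
  rw [hg_succ_eq_conv a hr, ← integral_const_mul, ← integral_add_right_eq_self _ s]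
  congr 1; ext v
  rw [show y + r * s - r * (v + s) = y - r * v by ring]
  ring

/-- The coordinate `x^ε_l` of `ℝ^{2m}`. -/
def lx {m : ℕ} (l : Fin m) (ε : Fin 2) : Idx m := if ε = 0 then Sum.inl l else Sum.inr l

/-- The position of a coordinate of `ℝ^{2m}`. -/
def ix {m : ℕ} : Idx m → Fin m := Sum.elim id id

/-- The opposite corner. -/
def cmp {m : ℕ} (j : Corner m) : Corner m := fun i => 1 - j i

section

variable {m : ℕ}

lemma sel_eq (j : Corner m) (i : Fin m) : sel j i = lx i (j i) := rfl

@[simp] lemma lx_zero (l : Fin m) : lx l 0 = Sum.inl l := rfl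
@[simp] lemma lx_one (l : Fin m) : lx l 1 = Sum.inr l := rfl
@[simp] lemma ix_inl (l : Fin m) : ix (Sum.inl l : Idx m) = l := rfl
@[simp] lemma ix_inr (l : Fin m) : ix (Sum.inr l : Idx m) = l := rfl

@[simp] lemma ix_lx (l : Fin m) (ε : Fin 2) : ix (lx l ε) = l := by
  unfold lx; split_ifs <;> rfl

lemma lx_surj (κ : Idx m) : ∃ ε, κ = lx (ix κ) ε := by
  rcases κ with l | l
  · exact ⟨0, rfl⟩
  · exact ⟨1, rfl⟩

lemma lx_inj {l l' : Fin m} {ε ε' : Fin 2} (h : lx l ε = lx l' ε') : l = l' ∧ ε = ε' := by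
  have h1 : l = l' := by simpa using congrArg ix h
  subst h1
  refine ⟨rfl, ?_⟩
  fin_cases ε <;> fin_cases ε' <;> simp_all [lx]

@[simp] lemma ix_sel (j : Corner m) (i : Fin m) : ix (sel j i) = i := ix_lx i _

lemma fin2_sub_ne (e : Fin 2) : 1 - e ≠ e := by fin_cases e <;> decide

lemma fin2_eq_sub {e e' : Fin 2} (h : e' ≠ e) : e' = 1 - e := by
  fin_cases e <;> fin_cases e' <;> simp_all

@[simp] lemma cmp_cmp (j : Corner m) : cmp (cmp j) = j := by
  funext i; simp [cmp]

/-- Coordinates of `ℝ^{2m}` split as those seen by `j` and those seen by the opposite corner. -/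
def splitE (j : Corner m) : Fin m ⊕ Fin m ≃ Idx m :=
  Equiv.ofBijective (Sum.elim (sel j) (sel (cmp j))) (by
    constructor
    · rintro (a | a) (b | b) h
      · simp only [Sum.elim_inl, sel_eq] at h
        rw [(lx_inj h).1]
      · simp only [Sum.elim_inl, Sum.elim_inr, sel_eq] at h
        have := lx_inj h
        obtain ⟨rfl, h2⟩ := this
        exact absurd h2.symm (fin2_sub_ne _)
      · simp only [Sum.elim_inl, Sum.elim_inr, sel_eq] at h
        have := lx_inj h
        obtain ⟨rfl, h2⟩ := this
        exact absurd h2 (fin2_sub_ne _)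
      · simp only [Sum.elim_inr, sel_eq] at h
        rw [(lx_inj h).1]
    · intro κ
      obtain ⟨ε, h⟩ := lx_surj κ
      by_cases h' : ε = j (ix κ)
      · exact ⟨Sum.inl (ix κ), by simp only [Sum.elim_inl, sel_eq]; rw [← h', ← h]⟩
      · exact ⟨Sum.inr (ix κ), by
          simp only [Sum.elim_inr, sel_eq, cmp]; rw [← fin2_eq_sub h', ← h]⟩)

lemma measurePreserving_comp_equiv {ι ι' : Type*} [Fintype ι] [Fintype ι'] (e : ι' ≃ ι) :
    MeasurePreserving (fun x : ι → ℝ => fun i => x (e i)) volume volume := by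
  have h := (volume_measurePreserving_piCongrLeft (fun _ : ι => ℝ) e).symm
  exact h

lemma measurePreserving_split (j : Corner m) :
    MeasurePreserving (fun x : Idx m → ℝ => (proj j x, proj (cmp j) x)) volume volume := by
  have h1 := measurePreserving_comp_equiv (splitE j)
  have h2 := volume_measurePreserving_sumPiEquivProdPi (fun _ : Fin m ⊕ Fin m => ℝ)
  exact h2.comp h1

lemma measurable_proj (j : Corner m) : Measurable (proj j : (Idx m → ℝ) → Fin m → ℝ) := by
  unfold proj; fun_prop

lemma lintegral_proj_mul (j : Corner m) {G H : (Fin m → ℝ) → ℝ≥0∞} (hG : Measurable G)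
    (hH : Measurable H) :
    ∫⁻ x : Idx m → ℝ, G (proj j x) * H (proj (cmp j) x) = (∫⁻ y, G y) * ∫⁻ y, H y := by
  have h := (measurePreserving_split j).lintegral_comp
    (f := fun z : (Fin m → ℝ) × (Fin m → ℝ) => G z.1 * H z.2) (by fun_prop)
  simp only at h
  rw [h, Measure.volume_eq_prod, lintegral_prod_mul hG.aemeasurable hH.aemeasurable]

lemma prod_idx_split {M : Type*} [CommMonoid M] (j : Corner m) (h : Idx m → M) :
    ∏ κ, h κ = (∏ k, h (sel j k)) * ∏ k, h (sel (cmp j) k) := by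
  rw [← (splitE j).prod_comp, Fintype.prod_sum_type]
  rfl

lemma sum_idx_split {M : Type*} [AddCommMonoid M] (j : Corner m) (h : Idx m → M) :
    ∑ κ, h κ = (∑ k, h (sel j k)) + ∑ k, h (sel (cmp j) k) := by
  rw [← (splitE j).sum_comp, Fintype.sum_sum_type]
  rfl

lemma lintegral_prod_ofReal {ι : Type*} [Fintype ι] (h : ι → ℝ → ℝ) (hi : ∀ k, Integrable (h k))
    (hn : ∀ k y, 0 ≤ h k y) :
    ∫⁻ y : ι → ℝ, ENNReal.ofReal (∏ k, h k (y k)) = ENNReal.ofReal (∏ k, ∫ y, h k y) := by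
  have h1 : Integrable (fun y : ι → ℝ => ∏ k, h k (y k)) volume := Integrable.fintype_prod hi
  rw [← ofReal_integral_eq_lintegral_ofReal h1
    (Filter.Eventually.of_forall fun y => Finset.prod_nonneg fun k _ => hn k _),
    integral_fintype_prod_volume_eq_prod]

lemma lintegral_mulVec {A : Matrix (Fin m) (Fin m) ℝ} (hA : A.det ≠ 0)
    {h : (Fin m → ℝ) → ℝ≥0∞} (hh : Measurable h) :
    ∫⁻ p, h (A.mulVec p) = ENNReal.ofReal |A.det|⁻¹ * ∫⁻ y, h y := by
  have := Real.map_matrix_volume_pi_eq_smul_volume_pi hA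
  have h2 : ∫⁻ y, h y ∂(Measure.map (Matrix.toLin' A) volume) = ∫⁻ p, h (A.mulVec p) := by
    rw [lintegral_map hh (by exact (LinearMap.continuous_of_finiteDimensional _).measurable)]
    rfl
  rw [← h2, this, lintegral_smul_measure, abs_inv, smul_eq_mul]

lemma lintegral_prod_sub_mulVec {A : Matrix (Fin m) (Fin m) ℝ} (hA : A.det ≠ 0)
    (h : Fin m → ℝ → ℝ) (hi : ∀ k, Integrable (h k)) (hc : ∀ k, Continuous (h k))
    (hn : ∀ k y, 0 ≤ h k y) (x : Fin m → ℝ) :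
    ∫⁻ p, ENNReal.ofReal (∏ k, h k (x k - A.mulVec p k)) =
      ENNReal.ofReal |A.det|⁻¹ * ENNReal.ofReal (∏ k, ∫ y, h k y) := by
  have hm : Measurable fun y : Fin m → ℝ => ENNReal.ofReal (∏ k, h k (x k - y k)) := by
    refine ENNReal.measurable_ofReal.comp (Continuous.measurable ?_)
    fun_prop
  rw [lintegral_mulVec hA hm, lintegral_prod_ofReal (fun k y => h k (x k - y))
    (fun k => (hi k).comp_sub_left _) (fun k y => hn k _)]
  congr 3
  ext k
  exact integral_sub_left_eq_self (h k) volume (x k)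

/-- Exchanging a coordinate with an independent variable preserves volume. -/
lemma measurePreserving_exchange {ι : Type*} [Fintype ι] [DecidableEq ι] (κ : ι) :
    MeasurePreserving (fun z : (ι → ℝ) × ℝ => (Function.update z.1 κ z.2, z.1 κ)) volume volume := by
  have h1 := volume_measurePreserving_sumPiEquivProdPi (fun _ : ι ⊕ Unit => ℝ)
  have h2 := (MeasurePreserving.id (volume : Measure (ι → ℝ))).prod
    (volume_preserving_funUnique Unit ℝ)
  have h3 := h2.comp h1
  have h2' := (MeasurePreserving.id (volume : Measure (ι → ℝ))).prod
    (volume_preserving_funUnique Unit ℝ).symm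
  have h3' := h1.symm.comp h2'
  have h4 := measurePreserving_comp_equiv (Equiv.swap (Sum.inl κ : ι ⊕ Unit) (Sum.inr ()))
  have h5 := h3.comp (h4.comp h3')
  have aux : ∀ f g : (ι → ℝ) × ℝ → (ι → ℝ) × ℝ, MeasurePreserving g volume volume → f = g →
      MeasurePreserving f volume volume := fun f g hg h => h ▸ hg
  refine aux _ _ h5 ?_
  ext z i
  · by_cases hi : i = κ
    · subst hi
      simp [MeasurableEquiv.sumPiEquivProdPi, MeasurableEquiv.funUnique, Equiv.sumPiEquivProdPi]
    · have : Equiv.swap (Sum.inl κ : ι ⊕ Unit) (Sum.inr ()) (Sum.inl i) = Sum.inl i :=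
        Equiv.swap_apply_of_ne_of_ne (by simpa using hi) (by simp)
      simp [MeasurableEquiv.sumPiEquivProdPi, MeasurableEquiv.funUnique, Equiv.sumPiEquivProdPi,
        this, hi]
  · simp [MeasurableEquiv.sumPiEquivProdPi, MeasurableEquiv.funUnique, Equiv.sumPiEquivProdPi]

/-- Integrating out one coordinate and reinserting a probability density in it. -/
lemma integral_refresh {ι : Type*} [Fintype ι] [DecidableEq ι] (κ : ι) {ρ : ℝ → ℝ}
    (hρ : Integrable ρ) (hρ1 : ∫ y, ρ y = 1) {H : (ι → ℝ) → ℝ} (hH : Integrable H) :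
    Integrable (fun x : ι → ℝ => ρ (x κ) * ∫ a, H (Function.update x κ a)) ∧
    ∫ x : ι → ℝ, ρ (x κ) * ∫ a, H (Function.update x κ a) = ∫ x, H x := by
  have h0 : Integrable (fun z : (ι → ℝ) × ℝ => H z.1 * ρ z.2) volume := hH.mul_prod hρ
  have hmp := measurePreserving_exchange κ
  have h1 : Integrable (fun z : (ι → ℝ) × ℝ => H (Function.update z.1 κ z.2) * ρ (z.1 κ)) volume :=
    (hmp.integrable_comp h0.aestronglyMeasurable).mpr h0
  have e : ∀ x : ι → ℝ, ρ (x κ) * ∫ a, H (Function.update x κ a) =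
      ∫ a, H (Function.update x κ a) * ρ (x κ) := by
    intro x; rw [integral_mul_const, mul_comm]
  simp_rw [e]
  refine ⟨h1.integral_prod_left, ?_⟩
  have h2 : ∫ z : (ι → ℝ) × ℝ, H (Function.update z.1 κ z.2) * ρ (z.1 κ) =
      ∫ z : (ι → ℝ) × ℝ, H z.1 * ρ z.2 := by
    rw [← hmp.map_eq] at h0
    have := integral_map hmp.measurable.aemeasurable h0.aestronglyMeasurable
    rw [hmp.map_eq] at this
    exact this.symm
  rw [Measure.volume_eq_prod, integral_prod _ h1, integral_prod_mul, hρ1, mul_one] at h2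
  exact h2

/-- The dyadic level of a scale `t`. -/
def lev (t : ℝ) : ℤ := ⌈Real.logb 2 t⌉

lemma lev_eq {t : ℝ} {k : ℤ} (h : t ∈ Set.Ioc ((2:ℝ) ^ (k - 1)) ((2:ℝ) ^ k)) : lev t = k := by
  have ht : 0 < t := lt_trans (by positivity) h.1
  unfold lev
  rw [Int.ceil_eq_iff]
  constructor
  · rw [Real.lt_logb_iff_rpow_lt (by norm_num) ht]
    have : ((k:ℝ) - 1) = ((k - 1 : ℤ) : ℝ) := by push_cast; ring
    rw [this, Real.rpow_intCast]
    exact h.1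
  · rw [Real.logb_le_iff_le_rpow (by norm_num) ht, Real.rpow_intCast]
    exact h.2

lemma measurable_lev : Measurable lev := by
  unfold lev Real.logb
  exact (Real.measurable_log.div_const _).ceil

attribute [irreducible] lev

/-- The functions `F_j` localized at level `k` of the tree. -/
def fk (J : Matrix (Idx m) (Fin m) ℝ) (T : Set (ℤ × (Fin m → ℤ)))
    (F : Corner m → (Fin m → ℝ) → ℝ) (k : ℤ) (j : Corner m) : (Fin m → ℝ) → ℝ :=
  Set.indicator ((Amat J j).mulVec '' Tkset T k) (F j)

attribute [irreducible] fk

/-- Product of the localized functions at scale `t`. -/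
def bb (J : Matrix (Idx m) (Fin m) ℝ) (T : Set (ℤ × (Fin m → ℤ)))
    (F : Corner m → (Fin m → ℝ) → ℝ) (t : ℝ) (x : Idx m → ℝ) : ℝ :=
  ∏ j, fk J T F (lev t) j (proj j x)

/-- Standing hypotheses on a matrix, a tree, input functions and bounds for their averages. -/
structure Good (Δ : ℝ) (J : Matrix (Idx m) (Fin m) ℝ) (T : Set (ℤ × (Fin m → ℤ)))
    (Qt : ℤ × (Fin m → ℤ)) (F : Corner m → (Fin m → ℝ) → ℝ) (M : Corner m → ℝ) : Prop where
  reg : ∀ j, IsReg Δ (Amat J j)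
  tree : ConvexTree T Qt
  cont : ∀ j, Continuous (F j)
  supp : ∀ j, HasCompactSupport (F j)
  nn : ∀ j, 0 ≤ M j
  est : ∀ j, ∀ Q ∈ T, ∀ (y : Fin m → ℝ) (r : ℝ), 0 < r →
    (Amat J j).mulVec '' dC Q ⊆ box (fun i => y i - r) (fun i => y i + r) →
    ∫ x in box (fun i => y i - r) (fun i => y i + r), |F j x| ^ (2 ^ (m - 1) : ℕ) ≤
      (2 * r) ^ m * M j ^ (2 ^ (m - 1) : ℕ)

lemma abs_le_en {ι : Type*} [Fintype ι] (x : ι → ℝ) (i : ι) : |x i| ≤ en x := by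
  unfold en
  rw [← Real.sqrt_sq_eq_abs]
  exact Real.sqrt_le_sqrt (Finset.single_le_sum (f := fun i => x i ^ 2) (fun _ _ => sq_nonneg _)
    (Finset.mem_univ i))

lemma entry_le_opNorm (A : Matrix (Fin m) (Fin m) ℝ) (i k : Fin m) : |A i k| ≤ opNorm A := by
  have h := (LinearMap.toContinuousLinearMap (Matrix.toEuclideanLin A)).le_opNorm
    (EuclideanSpace.single k (1:ℝ))
  rw [PiLp.norm_single, norm_one, mul_one] at h
  refine le_trans ?_ h
  have h2 := EuclideanSpace.norm_eq (LinearMap.toContinuousLinearMap (Matrix.toEuclideanLin A)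
    (EuclideanSpace.single k (1:ℝ)))
  have h3 := abs_le_en (fun i => (LinearMap.toContinuousLinearMap (Matrix.toEuclideanLin A)
    (EuclideanSpace.single k (1:ℝ))) i) i
  unfold en at h3
  simp only [Real.norm_eq_abs, sq_abs] at h2
  rw [h2]
  refine le_trans (le_of_eq ?_) h3
  simp [Matrix.toLpLin_apply, Matrix.mulVec_single]

lemma IsReg.entry {Δ : ℝ} {A : Matrix (Fin m) (Fin m) ℝ} (h : IsReg Δ A) (i k : Fin m) :
    |A i k| ≤ Δ := (entry_le_opNorm A i k).trans h.1

lemma abs_det_le {Δ : ℝ} (A : Matrix (Fin m) (Fin m) ℝ) (h : ∀ i k, |A i k| ≤ Δ) :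
    |A.det| ≤ m.factorial * Δ ^ m := by
  have := Matrix.det_le (A := A) (abv := IsAbsoluteValue.toAbsoluteValue (abs : ℝ → ℝ)) (x := Δ)
    (fun i j => h i j)
  simpa [nsmul_eq_mul] using this

lemma IsReg.inv_entry {Δ : ℝ} (hΔ : 1 < Δ) {A : Matrix (Fin m) (Fin m) ℝ} (h : IsReg Δ A)
    (i k : Fin m) : |A⁻¹ i k| ≤ Δ * (m.factorial * Δ ^ m) := by
  rw [Matrix.inv_def, Matrix.smul_apply, smul_eq_mul, abs_mul, Ring.inverse_eq_inv', abs_inv]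
  gcongr
  · exact h.2.2
  rw [Matrix.adjugate_apply]
  apply abs_det_le
  intro a b
  rw [Matrix.updateRow_apply]
  split_ifs
  · rcases eq_or_ne b i with rfl | hb
    · simp only [Pi.single_eq_same, abs_one]; exact hΔ.le
    · simp only [Pi.single_eq_of_ne hb, abs_zero]; linarith
  · exact h.entry a b

lemma abs_mulVec_le {Δ : ℝ} {A : Matrix (Fin m) (Fin m) ℝ} (h : ∀ i k, |A i k| ≤ Δ)
    {p : Fin m → ℝ} {r : ℝ} (hp : ∀ k, |p k| ≤ r) (i : Fin m) :
    |A.mulVec p i| ≤ m * (Δ * r) := by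
  unfold Matrix.mulVec dotProduct
  refine (Finset.abs_sum_le_sum_abs _ _).trans ?_
  refine (Finset.sum_le_sum (g := fun _ => Δ * r) fun k _ => ?_).trans (by simp)
  rw [abs_mul]
  exact mul_le_mul (h i k) (hp k) (abs_nonneg _) ((abs_nonneg _).trans (h i k))

lemma measurableSet_dC (Q : ℤ × (Fin m → ℤ)) : MeasurableSet (dC Q) := by
  unfold dC
  simp only [Set.ofPred_forall]
  refine MeasurableSet.iInter fun i => ?_
  exact (measurableSet_le measurable_const (measurable_pi_apply i)).inter
    (measurableSet_lt (measurable_pi_apply i) measurable_const)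

lemma dC_eq_pi (Q : ℤ × (Fin m → ℤ)) : dC Q =
    Set.pi Set.univ fun i => Set.Ico ((2:ℝ) ^ Q.1 * (Q.2 i : ℝ)) ((2:ℝ) ^ Q.1 * ((Q.2 i : ℝ) + 1)) := by
  ext x; simp [dC, Set.mem_pi]

lemma volume_dC (Q : ℤ × (Fin m → ℤ)) :
    volume (dC Q) = ENNReal.ofReal (((2:ℝ) ^ Q.1) ^ m) := by
  rw [dC_eq_pi, Real.volume_pi_Ico]
  have : ∀ i : Fin m, (2:ℝ) ^ Q.1 * ((Q.2 i : ℝ) + 1) - (2:ℝ) ^ Q.1 * (Q.2 i : ℝ) = (2:ℝ) ^ Q.1 :=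
    fun i => by ring
  simp only [this, Finset.prod_const, Finset.card_univ, Fintype.card_fin]
  rw [ENNReal.ofReal_pow (by positivity)]

lemma measurableSet_Tkset (T : Set (ℤ × (Fin m → ℤ))) (k : ℤ) : MeasurableSet (Tkset T k) :=
  MeasurableSet.biUnion (Set.to_countable _) fun Q _ => measurableSet_dC Q

lemma mulVec_injective {A : Matrix (Fin m) (Fin m) ℝ} (hA : A.det ≠ 0) :
    Function.Injective A.mulVec := by
  exact Matrix.mulVec_injective_of_isUnit ((Matrix.isUnit_iff_isUnit_det A).mpr (isUnit_iff_ne_zero.mpr hA))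

lemma continuous_mulVec' {ι : Type*} (A : Matrix ι (Fin m) ℝ) : Continuous A.mulVec := by
  refine continuous_pi fun i => ?_
  simp only [Matrix.mulVec, dotProduct]
  fun_prop

lemma measurableSet_image {A : Matrix (Fin m) (Fin m) ℝ} (hA : A.det ≠ 0) {S : Set (Fin m → ℝ)}
    (hS : MeasurableSet S) : MeasurableSet (A.mulVec '' S) :=
  hS.image_of_continuousOn_injOn (continuous_mulVec' A).continuousOn (mulVec_injective hA).injOn

section
variable {Δ : ℝ} {J : Matrix (Idx m) (Fin m) ℝ} {T : Set (ℤ × (Fin m → ℤ))}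
  {Qt : ℤ × (Fin m → ℤ)} {F : Corner m → (Fin m → ℝ) → ℝ} {M : Corner m → ℝ}

lemma Good.det_ne (h : Good Δ J T Qt F M) (j : Corner m) : (Amat J j).det ≠ 0 := (h.reg j).2.1

lemma Good.measurable_fk (h : Good Δ J T Qt F M) (k : ℤ) (j : Corner m) :
    Measurable (fk J T F k j) := by
  unfold fk
  exact (h.cont j).measurable.indicator (measurableSet_image (h.det_ne j) (measurableSet_Tkset T k))

lemma Good.measurable_fk_lev (h : Good Δ J T Qt F M) (j : Corner m) :
    Measurable (fun z : ℝ × (Fin m → ℝ) => fk J T F (lev z.1) j z.2) := by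
  have : Measurable (fun z : ℤ × (Fin m → ℝ) => fk J T F z.1 j z.2) :=
    measurable_from_prod_countable_right fun k => h.measurable_fk k j
  have h2 : Measurable (fun z : ℝ × (Fin m → ℝ) => (lev z.1, z.2)) :=
    (measurable_lev.comp measurable_fst).prodMk measurable_snd
  exact Measurable.comp (g := fun z : ℤ × (Fin m → ℝ) => fk J T F z.1 j z.2) this h2

lemma Good.measurable_bb (h : Good Δ J T Qt F M) :
    Measurable (fun z : ℝ × (Idx m → ℝ) => bb J T F z.1 z.2) := by
  unfold bb
  refine Finset.measurable_prod _ fun j _ => ?_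
  have h2 : Measurable (fun z : ℝ × (Idx m → ℝ) => (z.1, proj j z.2)) :=
    measurable_fst.prodMk ((measurable_proj j).comp measurable_snd)
  exact Measurable.comp (g := fun z : ℝ × (Fin m → ℝ) => fk J T F (lev z.1) j z.2)
    (h.measurable_fk_lev j) h2

/-- Uniform bound and support radius of the input functions. -/
lemma Good.exists_bound (h : Good Δ J T Qt F M) : ∃ R : ℝ, 1 ≤ R ∧ ∀ j y,
    |F j y| ≤ R ∧ (F j y ≠ 0 → ∀ i, |y i| ≤ R) := by
  have h1 : ∀ j, ∃ R : ℝ, ∀ y, |F j y| ≤ R := fun j => by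
    obtain ⟨R, hR⟩ := (h.supp j).exists_bound_of_continuous (h.cont j)
    exact ⟨R, hR⟩
  have h2 : ∀ j, ∃ R : ℝ, ∀ y, F j y ≠ 0 → ∀ i, |y i| ≤ R := fun j => by
    obtain ⟨R, hR⟩ := (h.supp j).isCompact.isBounded.exists_norm_le
    refine ⟨R, fun y hy i => ?_⟩
    exact (norm_le_pi_norm y i).trans (hR y (subset_tsupport _ hy))
  choose R1 h1 using h1
  choose R2 h2 using h2
  have e1 : ∀ j, |R1 j| ≤ ∑ j, |R1 j| := fun j =>
    Finset.single_le_sum (f := fun j => |R1 j|) (fun _ _ => abs_nonneg _) (Finset.mem_univ j)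
  have e2 : ∀ j, |R2 j| ≤ ∑ j, |R2 j| := fun j =>
    Finset.single_le_sum (f := fun j => |R2 j|) (fun _ _ => abs_nonneg _) (Finset.mem_univ j)
  have p1 : 0 ≤ ∑ j, |R1 j| := Finset.sum_nonneg fun _ _ => abs_nonneg _
  have p2 : 0 ≤ ∑ j, |R2 j| := Finset.sum_nonneg fun _ _ => abs_nonneg _
  refine ⟨1 + ∑ j, |R1 j| + ∑ j, |R2 j|, by linarith, fun j y => ⟨?_, fun hy i => ?_⟩⟩
  · have := h1 j y; have := le_abs_self (R1 j); have := e1 j; linarith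
  · have := h2 j y hy i; have := le_abs_self (R2 j); have := e2 j; linarith

lemma abs_fk_le (k : ℤ) (j : Corner m) (y : Fin m → ℝ) : |fk J T F k j y| ≤ |F j y| := by
  unfold fk
  by_cases hy : y ∈ (Amat J j).mulVec '' Tkset T k
  · rw [Set.indicator_of_mem hy]
  · rw [Set.indicator_of_notMem hy]; simp

lemma fk_ne_zero {k : ℤ} {j : Corner m} {y : Fin m → ℝ} (h : fk J T F k j y ≠ 0) : F j y ≠ 0 := by
  intro h0
  have := abs_fk_le (J := J) (T := T) (F := F) k j y
  rw [h0, abs_zero] at this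
  exact h (abs_eq_zero.mp (le_antisymm this (abs_nonneg _)))

/-- The products are bounded with bounded support, uniformly over levels. -/
lemma Good.exists_bound_prod (h : Good Δ J T Qt F M) : ∃ R : ℝ, 1 ≤ R ∧ ∀ (k : ℤ) (x : Idx m → ℝ),
    |∏ j, fk J T F k j (proj j x)| ≤ R ∧
    ((∏ j, fk J T F k j (proj j x)) ≠ 0 → ∀ i, |x i| ≤ R) := by
  obtain ⟨R, hR, hb⟩ := h.exists_bound
  have hRle : R ≤ R ^ (Fintype.card (Corner m)) := by
    refine le_self_pow₀ hR ?_
    exact Fintype.card_ne_zero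
  refine ⟨R ^ (Fintype.card (Corner m)), one_le_pow₀ hR, fun k x => ⟨?_, fun hx i => ?_⟩⟩
  · rw [Finset.abs_prod]
    refine (Finset.prod_le_prod (g := fun _ => R) (fun _ _ => abs_nonneg _)
      fun j _ => (abs_fk_le k j _).trans (hb j _).1).trans ?_
    simp [Finset.card_univ]
  · refine le_trans ?_ hRle
    obtain ⟨ε, hε⟩ := lx_surj i
    have h1 := Finset.prod_ne_zero_iff.mp hx (fun _ => ε) (Finset.mem_univ _)
    have h2 := (hb _ _).2 (fk_ne_zero h1) (ix i)
    rw [hε]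
    simpa [proj, sel_eq] using h2

end

/-- Tensor product of derivatives of one-dimensional Gaussians with scales `r`. -/
def Ker (a : Idx m → ℕ) (r y : Idx m → ℝ) : ℝ := ∏ κ, gd (a κ) (r κ) (y κ)

lemma prod_erase_mul_Ker (a : Idx m → ℕ) (r y : Idx m → ℝ) (κ : Idx m) (n : ℕ) :
    (∏ κ' ∈ Finset.univ.erase κ, gd (a κ') (r κ') (y κ')) * gd (a κ + n) (r κ) (y κ) =
      Ker (a + Pi.single κ n) r y := by
  unfold Ker
  rw [← Finset.prod_erase_mul Finset.univ _ (Finset.mem_univ κ)]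
  congr 1
  · refine Finset.prod_congr rfl fun κ' h => ?_
    simp [Pi.single_eq_of_ne (Finset.ne_of_mem_erase h)]
  · simp

lemma hasDerivAt_Ker (a : Idx m → ℕ) (r : Idx m → ℝ) {y : ℝ → Idx m → ℝ} {y' : Idx m → ℝ} {s : ℝ}
    (hy : ∀ κ, HasDerivAt (fun s => y s κ) (y' κ) s) :
    HasDerivAt (fun s => Ker a r (y s)) (∑ κ, y' κ * Ker (a + Pi.single κ 1) r (y s)) s := by
  have h := HasDerivAt.fun_finsetProd (u := Finset.univ)
    (f := fun κ s => gd (a κ) (r κ) (y s κ)) (f' := fun κ => gd (a κ + 1) (r κ) (y s κ) * y' κ)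
    (fun κ _ => HasDerivAt.comp (h₂ := gd (a κ) (r κ)) s (hasDerivAt_gd (a κ) (r κ) (y s κ)) (hy κ))
  refine h.congr_deriv (Finset.sum_congr rfl fun κ _ => ?_)
  rw [smul_eq_mul, ← prod_erase_mul_Ker]; ring

lemma hasDerivAt_Ker_scale (a : Idx m → ℕ) {r : ℝ → Idx m → ℝ} {r' : Idx m → ℝ} (y : Idx m → ℝ)
    {s : ℝ} (hr : ∀ κ, HasDerivAt (fun s => r s κ) (r' κ) s) (h0 : ∀ κ, r s κ ≠ 0) :
    HasDerivAt (fun s => Ker a (r s) y)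
      (∑ κ, r' κ * (r s κ / (2 * Real.pi)) * Ker (a + Pi.single κ 2) (r s) y) s := by
  have h := HasDerivAt.fun_finsetProd (u := Finset.univ)
    (f := fun κ s => gd (a κ) (r s κ) (y κ))
    (f' := fun κ => (r s κ / (2 * Real.pi) * gd (a κ + 2) (r s κ) (y κ)) * r' κ)
    (fun κ _ => HasDerivAt.comp (h₂ := fun ρ => gd (a κ) ρ (y κ)) s
      (hasDerivAt_gd_scale (a κ) (y κ) (h0 κ)) (hr κ))
  refine h.congr_deriv (Finset.sum_congr rfl fun κ _ => ?_)
  rw [smul_eq_mul, ← prod_erase_mul_Ker]; ring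

lemma measurable_Ker (a : Idx m → ℕ) {Θ : Type*} [MeasurableSpace Θ] {r y : Θ → Idx m → ℝ}
    (hr : Measurable r) (hy : Measurable y) : Measurable fun θ => Ker a (r θ) (y θ) := by
  unfold Ker
  refine Finset.measurable_prod _ fun κ _ => ?_
  have : Measurable fun θ => (r θ κ, y θ κ) :=
    ((measurable_pi_apply κ).comp hr).prodMk ((measurable_pi_apply κ).comp hy)
  exact (measurable_gd (a κ)).comp this

/-- Gaussian tensor with parameter `c`. -/
def gau (c : ℝ) (y : Idx m → ℝ) : ℝ := ∏ κ, Real.exp (-c * y κ ^ 2)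

lemma gau_nonneg (c : ℝ) (y : Idx m → ℝ) : 0 ≤ gau c y :=
  Finset.prod_nonneg fun _ _ => (Real.exp_pos _).le

lemma continuous_gau (c : ℝ) : Continuous (gau c : (Idx m → ℝ) → ℝ) := by
  unfold gau; fun_prop

lemma exists_Ker_bound (a : Idx m → ℕ) {ρ₀ ρ₁ : ℝ} (h0 : 0 < ρ₀) : ∃ C : ℝ, 0 < C ∧
    ∀ r : Idx m → ℝ, (∀ κ, ρ₀ ≤ r κ ∧ r κ ≤ ρ₁) → ∀ y,
      |Ker a r y| ≤ C * gau (Real.pi / 4 / ρ₁ ^ 2) y := by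
  choose C hC h using fun κ => gd_le (a κ) (ρ₁ := ρ₁) h0
  refine ⟨∏ κ, C κ, Finset.prod_pos fun κ _ => hC κ, fun r hr y => ?_⟩
  unfold Ker gau
  rw [Finset.abs_prod, ← Finset.prod_mul_distrib]
  exact Finset.prod_le_prod (fun _ _ => abs_nonneg _) fun κ _ => h κ _ (hr κ).1 (hr κ).2 _

/-- The cube `|x_i| ≤ R` in `ℝ^{2m}`. -/
def cub (R : ℝ) : Set (Idx m → ℝ) := {x | ∀ i, |x i| ≤ R}

lemma measurableSet_cub (R : ℝ) : MeasurableSet (cub R : Set (Idx m → ℝ)) := by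
  unfold cub
  simp only [Set.ofPred_forall]
  exact MeasurableSet.iInter fun i => measurableSet_le (measurable_pi_apply i).abs measurable_const

lemma volume_cub_lt_top (R : ℝ) : volume (cub R : Set (Idx m → ℝ)) < ⊤ := by
  have : (cub R : Set (Idx m → ℝ)) ⊆ Metric.closedBall 0 (max R 0) := by
    intro x hx
    rw [mem_closedBall_zero_iff, pi_norm_le_iff_of_nonneg (le_max_right _ _)]
    exact fun i => (hx i).trans (le_max_left _ _)
  exact (measure_mono this).trans_lt measure_closedBall_lt_top

/-- Dominating function for the forms. -/
def dom (J : Matrix (Idx m) (Fin m) ℝ) (c R : ℝ) (z : (Fin m → ℝ) × (Idx m → ℝ)) : ℝ :=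
  (cub R).indicator (fun _ => 1) z.2 * gau c (z.2 - J.mulVec z.1)

lemma dom_nonneg (J : Matrix (Idx m) (Fin m) ℝ) (c R : ℝ) (z : (Fin m → ℝ) × (Idx m → ℝ)) :
    0 ≤ dom J c R z :=
  mul_nonneg (Set.indicator_nonneg (fun _ _ => zero_le_one) _) (gau_nonneg _ _)

lemma measurable_dom (J : Matrix (Idx m) (Fin m) ℝ) (c R : ℝ) : Measurable (dom J c R) := by
  unfold dom
  refine Measurable.mul ?_ ?_
  · exact (measurable_const.indicator (measurableSet_cub R)).comp measurable_snd
  · exact (continuous_gau c).measurable.comp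
      (measurable_snd.sub ((continuous_mulVec' J).measurable.comp measurable_fst))

lemma mulVec_sel (J : Matrix (Idx m) (Fin m) ℝ) (j : Corner m) (p : Fin m → ℝ) (k : Fin m) :
    J.mulVec p (sel j k) = (Amat J j).mulVec p k := rfl

lemma integrable_dom {J : Matrix (Idx m) (Fin m) ℝ} (hJ : (Amat J 0).det ≠ 0) {c : ℝ} (hc : 0 < c)
    (R : ℝ) : Integrable (dom J c R) := by
  refine ⟨(measurable_dom J c R).aestronglyMeasurable, ?_⟩
  rw [hasFiniteIntegral_iff_ofReal (Filter.Eventually.of_forall (dom_nonneg J c R))]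
  have hm : Measurable fun z => ENNReal.ofReal (dom J c R z) := (measurable_dom J c R).ennreal_ofReal
  rw [Measure.volume_eq_prod, lintegral_prod_symm _ hm.aemeasurable]
  set D : ℝ≥0∞ := ENNReal.ofReal |(Amat J 0).det|⁻¹ *
    ENNReal.ofReal (∏ _k : Fin m, ∫ y : ℝ, Real.exp (-c * y ^ 2)) with hD
  have key : ∀ x : Idx m → ℝ, ∫⁻ p, ENNReal.ofReal (dom J c R (p, x)) ≤
      (cub R).indicator (fun _ => D) x := by
    intro x
    by_cases hx : x ∈ cub R
    · rw [Set.indicator_of_mem hx]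
      rw [hD, ← lintegral_prod_sub_mulVec hJ (fun _ y => Real.exp (-c * y ^ 2))
        (fun _ => integrable_exp_neg_mul_sq hc) (fun _ => by fun_prop)
        (fun _ _ => (Real.exp_pos _).le) (proj 0 x)]
      refine lintegral_mono fun p => ENNReal.ofReal_le_ofReal ?_
      unfold dom gau
      rw [Set.indicator_of_mem hx, one_mul, prod_idx_split 0]
      refine mul_le_of_le_one_right (Finset.prod_nonneg fun _ _ => (Real.exp_pos _).le) ?_
      refine Finset.prod_le_one (fun _ _ => (Real.exp_pos _).le) fun κ _ => ?_
      rw [Real.exp_le_one_iff]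
      nlinarith [mul_nonneg hc.le (sq_nonneg ((x - J.mulVec p) (sel (cmp 0) κ)))]
    · simp [dom, hx]
  refine (lintegral_mono key).trans_lt ?_
  rw [lintegral_indicator (measurableSet_cub R), setLIntegral_const]
  exact ENNReal.mul_lt_top (ENNReal.mul_lt_top ENNReal.ofReal_lt_top ENNReal.ofReal_lt_top)
    (volume_cub_lt_top R)

/-- Integrability of functions dominated by `dom` over a finite parameter space. -/
lemma integrable_of_dom {J : Matrix (Idx m) (Fin m) ℝ} (hJ : (Amat J 0).det ≠ 0) {c : ℝ}
    (hc : 0 < c) (R C : ℝ) {Θ : Type*} [MeasurableSpace Θ] {ν : Measure Θ} [IsFiniteMeasure ν]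
    {f : Θ × (Fin m → ℝ) × (Idx m → ℝ) → ℝ} (hf : Measurable f)
    (hb : ∀ᵐ θ ∂ν, ∀ z, |f (θ, z)| ≤ C * dom J c R z) :
    Integrable f (ν.prod volume) := by
  have h1 : Integrable (fun z : Θ × (Fin m → ℝ) × (Idx m → ℝ) => C * dom J c R z.2)
      (ν.prod volume) := ((integrable_dom hJ hc R).comp_snd ν).const_mul C
  refine h1.mono' hf.aestronglyMeasurable ?_
  have := (Measure.quasiMeasurePreserving_fst (μ := ν)
    (ν := (volume : Measure ((Fin m → ℝ) × (Idx m → ℝ))))).ae hb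
  filter_upwards [this] with z hz
  exact hz z.2

/-- Measure on `(t, p, x)` with `t` in a finite range of dyadic scales. -/
def om (m : ℕ) (K : ℤ) (N : ℕ) : Measure (ℝ × (Fin m → ℝ) × (Idx m → ℝ)) :=
  (volume.restrict (Set.Ioc ((2:ℝ) ^ (K - N)) ((2:ℝ) ^ K))).prod volume

/-- Scales `t μ` on all coordinates. -/
def scl (t : ℝ) (μ : Fin m → ℝ) : Idx m → ℝ := fun κ => t * μ (ix κ)

lemma measurable_scl (μ : Fin m → ℝ) : Measurable fun t => scl t μ := by
  unfold scl; fun_prop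

/-- Integrand of the elementary forms. -/
def GG (J : Matrix (Idx m) (Fin m) ℝ) (T : Set (ℤ × (Fin m → ℤ)))
    (F : Corner m → (Fin m → ℝ) → ℝ) (μ : Fin m → ℝ) (d : ℕ) (a : Idx m → ℕ)
    (z : ℝ × (Fin m → ℝ) × (Idx m → ℝ)) : ℝ :=
  z.1 ^ d * z.1⁻¹ * bb J T F z.1 z.2.2 * Ker a (scl z.1 μ) (z.2.2 - J.mulVec z.2.1)

/-- The elementary forms. -/
def LL (J : Matrix (Idx m) (Fin m) ℝ) (T : Set (ℤ × (Fin m → ℤ)))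
    (F : Corner m → (Fin m → ℝ) → ℝ) (K : ℤ) (N : ℕ) (μ : Fin m → ℝ) (d : ℕ)
    (a : Idx m → ℕ) : ℝ :=
  ∫ z, GG J T F μ d a z ∂(om m K N)

section
variable {Δ : ℝ} {J : Matrix (Idx m) (Fin m) ℝ} {T : Set (ℤ × (Fin m → ℤ))}
  {Qt : ℤ × (Fin m → ℤ)} {F : Corner m → (Fin m → ℝ) → ℝ} {M : Corner m → ℝ}

lemma Good.measurable_GG (h : Good Δ J T Qt F M) (μ : Fin m → ℝ) (d : ℕ) (a : Idx m → ℕ) :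
    Measurable (GG J T F μ d a) := by
  unfold GG
  refine Measurable.mul (Measurable.mul ?_ ?_) ?_
  · exact (measurable_fst.pow_const d).mul measurable_fst.inv
  · have h2 : Measurable (fun z : ℝ × (Fin m → ℝ) × (Idx m → ℝ) => (z.1, z.2.2)) := by fun_prop
    exact h.measurable_bb.comp h2
  · refine measurable_Ker a ((measurable_scl μ).comp measurable_fst) ?_
    exact (measurable_snd.comp measurable_snd).sub
      ((continuous_mulVec' J).measurable.comp (measurable_fst.comp measurable_snd))

lemma Good.bb_le (h : Good Δ J T Qt F M) : ∃ R : ℝ, 1 ≤ R ∧ ∀ (t : ℝ) (x : Idx m → ℝ),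
    |bb J T F t x| ≤ R * (cub R).indicator (fun _ => 1) x := by
  obtain ⟨R, hR, hb⟩ := h.exists_bound_prod
  refine ⟨R, hR, fun t x => ?_⟩
  by_cases hx : x ∈ cub R
  · rw [Set.indicator_of_mem hx, mul_one]; exact (hb (lev t) x).1
  · have : bb J T F t x = 0 := by
      by_contra h0
      exact hx ((hb (lev t) x).2 h0)
    rw [this, Set.indicator_of_notMem hx]; simp

lemma scl_bounds {μ : Fin m → ℝ} {c₀ c₁ t₀ t₁ t : ℝ} (h0 : 0 < c₀) (ht0 : 0 < t₀)
    (hμ : ∀ k, c₀ ≤ μ k ∧ μ k ≤ c₁)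
    (ht : t₀ ≤ t ∧ t ≤ t₁) (κ : Idx m) : t₀ * c₀ ≤ scl t μ κ ∧ scl t μ κ ≤ t₁ * c₁ := by
  unfold scl
  have h1 := hμ (ix κ)
  constructor
  · exact mul_le_mul ht.1 h1.1 h0.le (ht0.le.trans ht.1)
  · exact mul_le_mul ht.2 h1.2 (h0.le.trans h1.1) (ht0.le.trans (ht.1.trans ht.2))

/-- Uniform domination of the integrands for scales in a compact range. -/
lemma Good.GG_dom (h : Good Δ J T Qt F M) (d : ℕ) (a : Idx m → ℕ) {c₀ c₁ t₀ t₁ : ℝ} (h0 : 0 < c₀)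
    (h01 : c₀ ≤ c₁) (ht0 : 0 < t₀) (ht01 : t₀ ≤ t₁) : ∃ C R c : ℝ, 0 < c ∧ 0 ≤ C ∧
    ∀ μ : Fin m → ℝ, (∀ k, c₀ ≤ μ k ∧ μ k ≤ c₁) → ∀ t, t₀ ≤ t → t ≤ t₁ → ∀ z,
      |GG J T F μ d a (t, z)| ≤ C * dom J c R z := by
  obtain ⟨R, hR, hb⟩ := h.bb_le
  obtain ⟨C, hC, hK⟩ := exists_Ker_bound (m := m) a (ρ₀ := t₀ * c₀) (ρ₁ := t₁ * c₁) (by positivity)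
  have h1 : 0 < t₁ * c₁ := mul_pos (ht0.trans_le ht01) (h0.trans_le h01)
  have ht1 : 0 < t₁ := ht0.trans_le ht01
  refine ⟨t₁ ^ d * t₀⁻¹ * R * C, R, Real.pi / 4 / (t₁ * c₁) ^ 2, by positivity, by positivity,
    fun μ hμ t htt htt' z => ?_⟩
  have ht : 0 < t := ht0.trans_le htt
  unfold GG dom
  simp only
  rw [abs_mul, abs_mul, abs_mul, abs_pow, abs_inv, abs_of_pos ht]
  have e1 := hb t z.2
  have e2 := hK (scl t μ) (scl_bounds h0 ht0 hμ ⟨htt, htt'⟩) (z.2 - J.mulVec z.1)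
  calc t ^ d * t⁻¹ * |bb J T F t z.2| * |Ker a (scl t μ) (z.2 - J.mulVec z.1)|
      ≤ t₁ ^ d * t₀⁻¹ * (R * (cub R).indicator (fun _ => 1) z.2) *
        (C * gau (Real.pi / 4 / (t₁ * c₁) ^ 2) (z.2 - J.mulVec z.1)) := by
        have hi : 0 ≤ (cub R).indicator (fun _ => (1:ℝ)) z.2 :=
          Set.indicator_nonneg (fun _ _ => zero_le_one) _
        have h3 : t ^ d * t⁻¹ ≤ t₁ ^ d * t₀⁻¹ := by gcongr
        refine mul_le_mul (mul_le_mul h3 e1 (abs_nonneg _) (by positivity)) e2 (abs_nonneg _) ?_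
        positivity
    _ = _ := by ring

lemma exists_bounds (μ : Fin m → ℝ) (hμ : ∀ k, 0 < μ k) :
    ∃ c₀ c₁ : ℝ, 0 < c₀ ∧ c₀ ≤ c₁ ∧ ∀ k, c₀ ≤ μ k ∧ μ k ≤ c₁ := by
  have hs : 0 ≤ ∑ k, μ k := Finset.sum_nonneg fun k _ => (hμ k).le
  have hs' : 0 ≤ ∑ k, (μ k)⁻¹ := Finset.sum_nonneg fun k _ => (inv_pos.mpr (hμ k)).le
  have h1 : (1 + ∑ k, (μ k)⁻¹)⁻¹ ≤ 1 := by
    rw [inv_le_one₀ (by positivity)]; linarith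
  refine ⟨(1 + ∑ k, (μ k)⁻¹)⁻¹, 1 + ∑ k, μ k, by positivity, by linarith, fun k => ⟨?_, ?_⟩⟩
  · rw [inv_le_comm₀ (by positivity) (hμ k)]
    have := Finset.single_le_sum (f := fun k => (μ k)⁻¹) (fun k _ => (inv_pos.mpr (hμ k)).le)
      (Finset.mem_univ k)
    linarith
  · have := Finset.single_le_sum (f := fun k => μ k) (fun k _ => (hμ k).le) (Finset.mem_univ k)
    linarith

instance (K : ℤ) (N : ℕ) :
    IsFiniteMeasure ((volume : Measure ℝ).restrict (Set.Ioc ((2:ℝ) ^ (K - N)) ((2:ℝ) ^ K))) :=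
  ⟨by simp⟩

lemma ae_scale {K : ℤ} {N : ℕ} {P : ℝ → Prop}
    (h : ∀ t, (2:ℝ) ^ (K - N) ≤ t → t ≤ (2:ℝ) ^ K → P t) :
    ∀ᵐ t ∂((volume : Measure ℝ).restrict (Set.Ioc ((2:ℝ) ^ (K - N)) ((2:ℝ) ^ K))), P t := by
  rw [ae_restrict_iff' measurableSet_Ioc]
  exact Filter.Eventually.of_forall fun t ht => h t ht.1.le ht.2

lemma two_zpow_le (K : ℤ) (N : ℕ) : (2:ℝ) ^ (K - N) ≤ (2:ℝ) ^ K :=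
  zpow_le_zpow_right₀ (by norm_num) (by omega)

lemma Good.integrable_GG (h : Good Δ J T Qt F M) (K : ℤ) (N : ℕ) {μ : Fin m → ℝ}
    (hμ : ∀ k, 0 < μ k) (d : ℕ) (a : Idx m → ℕ) : Integrable (GG J T F μ d a) (om m K N) := by
  obtain ⟨c₀, c₁, h0, h1, hb⟩ := exists_bounds μ hμ
  obtain ⟨C, R, c, hc, -, hd⟩ := h.GG_dom d a h0 h1 (t₀ := (2:ℝ) ^ (K - N)) (t₁ := (2:ℝ) ^ K)
    (by positivity) (two_zpow_le K N)
  exact integrable_of_dom (h.det_ne 0) hc R C (h.measurable_GG μ d a)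
    (ae_scale fun t ht ht' z => hd μ hb t ht ht' z)

end

lemma measurableSet_box (a b : Fin m → ℝ) : MeasurableSet (box a b) := by
  unfold box
  simp only [Set.ofPred_forall]
  refine MeasurableSet.iInter fun i => ?_
  exact (measurableSet_le measurable_const (measurable_pi_apply i)).inter
    (measurableSet_le (measurable_pi_apply i) measurable_const)

lemma box_eq_pi {ι : Type*} (a b : ι → ℝ) : {x : ι → ℝ | ∀ i, a i ≤ x i ∧ x i ≤ b i} =
    Set.pi Set.univ fun i => Set.Icc (a i) (b i) := by
  exact Set.ext fun x => ⟨fun h i _ => h i, fun h i => h i trivial⟩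

lemma volume_box (y : Fin m → ℝ) {r : ℝ} (hr : 0 ≤ r) :
    volume (box (fun i => y i - r) (fun i => y i + r)) = ENNReal.ofReal ((2 * r) ^ m) := by
  unfold box
  rw [box_eq_pi, volume_pi, Measure.pi_pi]
  have : ∀ i : Fin m, y i + r - (y i - r) = 2 * r := fun i => by ring
  simp only [Real.volume_Icc, this, Finset.prod_const, Finset.card_univ, Fintype.card_fin]
  rw [ENNReal.ofReal_pow (by positivity)]

/-- Brascamp–Lieb type inequality for the cube structure. -/
lemma lintegral_prod_proj_le (hm : 1 ≤ m) {G : Corner m → (Fin m → ℝ) → ℝ≥0∞}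
    (hG : ∀ j, Measurable (G j)) {V : ℝ} (hV : 0 ≤ V) {M : Corner m → ℝ} (hM : ∀ j, 0 ≤ M j)
    (h : ∀ j, ∫⁻ y, G j y ^ (2 ^ (m - 1) : ℕ) ≤ ENNReal.ofReal (V * M j ^ (2 ^ (m - 1) : ℕ))) :
    ∫⁻ x, ∏ j, G j (proj j x) ≤ ENNReal.ofReal (V ^ 2 * ∏ j, M j) := by
  have hcard : Fintype.card (Corner m) = 2 ^ m := by simp
  have h2 : (2:ℝ) ^ m = 2 * 2 ^ (m - 1) := by
    rw [← pow_succ']; congr 1; omega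
  have hq : (((2:ℝ) ^ m)⁻¹) * ((2 ^ (m - 1) : ℕ) : ℝ) = 1 / 2 := by
    rw [h2]; push_cast; field_simp
  have hbij : ∀ φ : Corner m → ℝ≥0∞, ∏ j, φ (cmp j) = ∏ j, φ j := fun φ =>
    Function.Bijective.prod_comp (Function.Involutive.bijective cmp_cmp) φ
  have e1 : ∀ x : Idx m → ℝ, ∏ j, G j (proj j x) =
      ∏ j, (G j (proj j x) ^ (2 ^ (m - 1) : ℕ) *
        G (cmp j) (proj (cmp j) x) ^ (2 ^ (m - 1) : ℕ)) ^ (((2:ℝ) ^ m)⁻¹) := by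
    intro x
    have hp : ∀ g : ℝ≥0∞, (g ^ (2 ^ (m - 1) : ℕ)) ^ (((2:ℝ) ^ m)⁻¹) = g ^ (1 / 2 : ℝ) := fun g => by
      rw [← ENNReal.rpow_natCast, ← ENNReal.rpow_mul, mul_comm, hq]
    simp only [ENNReal.mul_rpow_of_nonneg _ _ (show (0:ℝ) ≤ ((2:ℝ) ^ m)⁻¹ by positivity), hp]
    rw [Finset.prod_mul_distrib, hbij fun j => G j (proj j x) ^ (1 / 2 : ℝ),
      ← Finset.prod_mul_distrib]
    refine Finset.prod_congr rfl fun j _ => ?_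
    rw [← ENNReal.rpow_add_of_nonneg _ _ (by norm_num) (by norm_num)]
    norm_num
  simp only [e1]
  refine (ENNReal.lintegral_prod_norm_pow_le Finset.univ (fun j _ => ?_) ?_
    (fun _ _ => by positivity)).trans ?_
  · exact (((hG j).comp (measurable_proj j)).pow_const _ |>.mul
      (((hG _).comp (measurable_proj _)).pow_const _)).aemeasurable
  · rw [Finset.sum_const, Finset.card_univ, hcard, nsmul_eq_mul]
    push_cast; field_simp
  have e2 : ∀ j, ∫⁻ x, (G j (proj j x) ^ (2 ^ (m - 1) : ℕ) *
        G (cmp j) (proj (cmp j) x) ^ (2 ^ (m - 1) : ℕ)) ≤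
      ENNReal.ofReal (V * M j ^ (2 ^ (m - 1) : ℕ)) *
        ENNReal.ofReal (V * M (cmp j) ^ (2 ^ (m - 1) : ℕ)) := fun j => by
    rw [lintegral_proj_mul j (G := fun y => G j y ^ (2 ^ (m - 1) : ℕ))
      (H := fun y => G (cmp j) y ^ (2 ^ (m - 1) : ℕ)) ((hG j).pow_const _) ((hG _).pow_const _)]
    exact mul_le_mul' (h j) (h _)
  refine (Finset.prod_le_prod' fun j _ => ENNReal.rpow_le_rpow (e2 j) (by positivity)).trans ?_
  simp only [ENNReal.mul_rpow_of_nonneg _ _ (show (0:ℝ) ≤ ((2:ℝ) ^ m)⁻¹ by positivity)]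
  rw [Finset.prod_mul_distrib,
    hbij fun j => ENNReal.ofReal (V * M j ^ (2 ^ (m - 1) : ℕ)) ^ (((2:ℝ) ^ m)⁻¹)]
  have e3 : ∀ j, ENNReal.ofReal (V * M j ^ (2 ^ (m - 1) : ℕ)) ^ (((2:ℝ) ^ m)⁻¹) =
      ENNReal.ofReal (V ^ (((2:ℝ) ^ m)⁻¹) * M j ^ (1 / 2 : ℝ)) := fun j => by
    rw [ENNReal.ofReal_rpow_of_nonneg (mul_nonneg hV (pow_nonneg (hM j) _)) (by positivity),
      Real.mul_rpow hV (pow_nonneg (hM j) _), ← Real.rpow_natCast (M j), ← Real.rpow_mul (hM j),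
      mul_comm _ (((2:ℝ) ^ m)⁻¹), hq]
  simp only [e3]
  have hnn : ∀ j, 0 ≤ V ^ (((2:ℝ) ^ m)⁻¹) * M j ^ (1 / 2 : ℝ) := fun j =>
    mul_nonneg (Real.rpow_nonneg hV _) (Real.rpow_nonneg (hM j) _)
  rw [← ENNReal.ofReal_prod_of_nonneg fun j _ => hnn j,
    ← ENNReal.ofReal_mul (Finset.prod_nonneg fun j _ => hnn j), ← Finset.prod_mul_distrib]
  refine ENNReal.ofReal_le_ofReal (le_of_eq ?_)
  have e4 : ∀ j, V ^ (((2:ℝ) ^ m)⁻¹) * M j ^ (1 / 2 : ℝ) *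
      (V ^ (((2:ℝ) ^ m)⁻¹) * M j ^ (1 / 2 : ℝ)) = (V ^ (((2:ℝ) ^ m)⁻¹)) ^ 2 * M j := fun j => by
    have : M j ^ (1 / 2 : ℝ) * M j ^ (1 / 2 : ℝ) = M j := by
      rw [← Real.sqrt_eq_rpow]; exact Real.mul_self_sqrt (hM j)
    calc _ = (V ^ (((2:ℝ) ^ m)⁻¹)) ^ 2 * (M j ^ (1 / 2 : ℝ) * M j ^ (1 / 2 : ℝ)) := by ring
      _ = _ := by rw [this]
  simp only [e4, Finset.prod_mul_distrib, Finset.prod_const, Finset.card_univ, hcard]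
  congr 1
  rw [← pow_mul, mul_comm 2, pow_mul]
  congr 1
  rw [← Real.rpow_natCast, ← Real.rpow_mul hV]
  push_cast
  rw [inv_mul_cancel₀ (by positivity), Real.rpow_one]

section
variable {Δ : ℝ} {J : Matrix (Idx m) (Fin m) ℝ} {T : Set (ℤ × (Fin m → ℤ))}
  {Qt : ℤ × (Fin m → ℤ)} {F : Corner m → (Fin m → ℝ) → ℝ} {M : Corner m → ℝ}

lemma dC_diam {Q : ℤ × (Fin m → ℤ)} {d d' : Fin m → ℝ} (h : d ∈ dC Q) (h' : d' ∈ dC Q)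
    (i : Fin m) : |d' i - d i| ≤ (2:ℝ) ^ Q.1 := by
  have h1 := h i; have h2 := h' i
  rw [abs_le]; constructor <;> nlinarith [h1.1, h1.2, h2.1, h2.2]

/-- Images of cubes are contained in boxes around their points. -/
lemma Good.image_subset_box (h : Good Δ J T Qt F M) (j : Corner m) {Q : ℤ × (Fin m → ℤ)}
    {d y : Fin m → ℝ} (hd : d ∈ dC Q) {t s : ℝ} (ht : ∀ i, |(Amat J j).mulVec d i - y i| ≤ t)
    (hs : (2:ℝ) ^ Q.1 ≤ s) : (Amat J j).mulVec '' dC Q ⊆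
      box (fun i => y i - (t + m * (Δ * s))) (fun i => y i + (t + m * (Δ * s))) := by
  rintro _ ⟨d', hd', rfl⟩ i
  have h1 : |(Amat J j).mulVec (d' - d) i| ≤ m * (Δ * s) :=
    abs_mulVec_le (fun i k => (h.reg j).entry i k) (fun k => (dC_diam hd hd' k).trans hs) i
  rw [Matrix.mulVec_sub, Pi.sub_apply, abs_le] at h1
  have h2 := abs_le.mp (ht i)
  constructor <;> linarith [h1.1, h1.2, h2.1, h2.2]

lemma Good.lintegral_box_le (h : Good Δ J T Qt F M) (hΔ : 1 < Δ) {t : ℝ} (ht : 0 < t) {k : ℤ}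
    (hk : (2:ℝ) ^ k ≤ 2 * t) (j : Corner m) (y : Fin m → ℝ) :
    ∫⁻ w in box (fun i => y i - t) (fun i => y i + t), ‖fk J T F k j w‖ₑ ^ (2 ^ (m - 1) : ℕ) ≤
      ENNReal.ofReal ((2 * (t + m * (Δ * (2 * t)))) ^ m * M j ^ (2 ^ (m - 1) : ℕ)) := by
  by_cases hex : ∃ w ∈ box (fun i => y i - t) (fun i => y i + t), fk J T F k j w ≠ 0
  · obtain ⟨w, hw, hne⟩ := hex
    have hw2 : w ∈ (Amat J j).mulVec '' Tkset T k := by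
      by_contra hc
      apply hne
      unfold fk
      exact Set.indicator_of_notMem hc _
    obtain ⟨d, hd, rfl⟩ := hw2
    unfold Tkset at hd
    simp only [Set.mem_iUnion] at hd
    obtain ⟨Q, ⟨hQT, hQk⟩, hdQ⟩ := hd
    have hr : 0 < t + m * (Δ * (2 * t)) := by
      have : 0 < Δ := by linarith
      positivity
    have hsub := h.image_subset_box j hdQ (y := y) (t := t) (s := 2 * t)
      (fun i => by rw [abs_le]; constructor <;> linarith [(hw i).1, (hw i).2]) (by rw [hQk]; exact hk)
    have hest := h.est j Q hQT y _ hr hsub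
    refine le_trans ?_ (ENNReal.ofReal_le_ofReal hest)
    have hInteg : Integrable (fun x => |F j x| ^ (2 ^ (m - 1) : ℕ)) := by
      refine Continuous.integrable_of_hasCompactSupport ((h.cont j).abs.pow _) ?_
      exact (h.supp j).comp_left (g := fun s : ℝ => |s| ^ (2 ^ (m - 1) : ℕ)) (by simp)
    rw [ofReal_integral_eq_lintegral_ofReal hInteg.integrableOn
      (Filter.Eventually.of_forall fun x => by positivity)]
    refine (lintegral_mono_set (μ := volume)
      (t := box (fun i => y i - (t + m * (Δ * (2 * t)))) (fun i => y i + (t + m * (Δ * (2 * t))))) ?_).trans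
      (lintegral_mono fun w => ?_)
    · intro w hw i
      have : 0 ≤ m * (Δ * (2 * t)) := by
        have : 0 < Δ := by linarith
        positivity
      exact ⟨by linarith [(hw i).1], by linarith [(hw i).2]⟩
    · rw [ENNReal.ofReal_pow (abs_nonneg _), ← Real.enorm_eq_ofReal_abs]
      gcongr
      rw [Real.enorm_eq_ofReal_abs, Real.enorm_eq_ofReal_abs]
      exact ENNReal.ofReal_le_ofReal (abs_fk_le k j w)
  · push Not at hex
    rw [setLIntegral_congr_fun (g := fun _ => 0) (measurableSet_box _ _) (fun w hw => by
      simp [hex w hw])]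
    simp

end

lemma enorm_finset_prod {ι : Type*} (s : Finset ι) (f : ι → ℝ) :
    ‖∏ i ∈ s, f i‖ₑ = ∏ i ∈ s, ‖f i‖ₑ := by
  simp only [enorm_eq_nnnorm, nnnorm_prod]
  exact map_prod ENNReal.ofNNRealHom _ s

lemma Ker_zero (r y : Idx m → ℝ) : Ker 0 r y = ∏ κ, hg 0 (r κ) (y κ) := by
  unfold Ker; simp [gd_zero]

lemma Ker_zero_nonneg {r : Idx m → ℝ} (hr : ∀ κ, 0 ≤ r κ) (y : Idx m → ℝ) : 0 ≤ Ker 0 r y := by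
  rw [Ker_zero]; exact Finset.prod_nonneg fun κ _ => hg_zero_nonneg (hr κ) _

lemma Ker_zero_shift {c₀ : ℝ} (hc : 0 < c₀) {μ : Fin m → ℝ} (hμ : ∀ k, c₀ ≤ μ k) {t : ℝ}
    (ht : 0 < t) (y w : Idx m → ℝ) (hw : ∀ κ, |w κ| ≤ t) :
    Ker 0 (scl t μ) (y + w) ≤ (2 * Real.exp Real.pi * (1 + c₀⁻¹)) ^ (2 * m) *
      Ker 0 (scl t fun k => 2 * (1 + c₀⁻¹) * μ k) y := by
  rw [Ker_zero, Ker_zero]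
  have hcard : Fintype.card (Idx m) = 2 * m := by simp; ring
  rw [← hcard, ← Finset.card_univ, ← Finset.prod_const, ← Finset.prod_mul_distrib]
  have hp : ∀ k, 0 < μ k := fun k => hc.trans_le (hμ k)
  refine Finset.prod_le_prod (fun κ _ => hg_zero_nonneg ?_ _) fun κ _ => ?_
  · have := hp (ix κ); unfold scl; positivity
  · have hsc : 0 < scl t μ κ := by have := hp (ix κ); unfold scl; positivity
    have h1 := hg_shift (y := y κ) (w := w κ) hsc (θ := c₀⁻¹) (by positivity) (by
      refine (hw κ).trans ?_
      unfold scl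
      have := hμ (ix κ)
      rw [← mul_assoc, mul_comm _ t, mul_assoc]
      refine le_mul_of_one_le_right ht.le ?_
      rw [inv_mul_eq_div, one_le_div hc]; exact this)
    refine h1.trans (le_of_eq ?_)
    congr 2
    unfold scl; ring

lemma volume_idx_box (x : Idx m → ℝ) {t : ℝ} (ht : 0 ≤ t) :
    volume {y : Idx m → ℝ | ∀ κ, |y κ - x κ| ≤ t} = ENNReal.ofReal ((2 * t) ^ (2 * m)) := by
  have h1 : {y : Idx m → ℝ | ∀ κ, |y κ - x κ| ≤ t} =
      Set.pi Set.univ fun κ => Set.Icc (x κ - t) (x κ + t) := by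
    rw [← box_eq_pi]
    refine Set.ext fun y => forall_congr' fun κ => ?_
    rw [abs_le]; constructor <;> rintro ⟨h1, h2⟩ <;> constructor <;> linarith
  rw [h1, volume_pi, Measure.pi_pi]
  have : ∀ i : Idx m, x i + t - (x i - t) = 2 * t := fun i => by ring
  simp only [Real.volume_Icc, this, Finset.prod_const, Finset.card_univ]
  rw [ENNReal.ofReal_pow (by positivity)]
  congr 1; simp; ring

section
variable {Δ : ℝ} {J : Matrix (Idx m) (Fin m) ℝ} {T : Set (ℤ × (Fin m → ℤ))}
  {Qt : ℤ × (Fin m → ℤ)} {F : Corner m → (Fin m → ℝ) → ℝ} {M : Corner m → ℝ}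

lemma Good.measurable_beta (h : Good Δ J T Qt F M) (k : ℤ) :
    Measurable fun x : Idx m → ℝ => ∏ j, fk J T F k j (proj j x) :=
  Finset.measurable_prod _ fun j _ => (h.measurable_fk k j).comp (measurable_proj j)

lemma Good.lintegral_near (h : Good Δ J T Qt F M) (hm : 1 ≤ m) (hΔ : 1 < Δ) {t : ℝ} (ht : 0 < t)
    {k : ℤ} (hk : (2:ℝ) ^ k ≤ 2 * t) (y : Idx m → ℝ) :
    ∫⁻ x, {x : Idx m → ℝ | ∀ κ, |y κ - x κ| ≤ t}.indicator
      (fun x => ‖∏ j, fk J T F k j (proj j x)‖ₑ) x ≤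
      ENNReal.ofReal (((2 * (t + m * (Δ * (2 * t)))) ^ m) ^ 2 * ∏ j, M j) := by
  have hΔ0 : 0 < Δ := by linarith
  refine le_trans (lintegral_mono fun x => ?_) (lintegral_prod_proj_le hm
    (G := fun j => (box (fun i => proj j y i - t) (fun i => proj j y i + t)).indicator
      (fun w => ‖fk J T F k j w‖ₑ)) (fun j => ?_) (by positivity) h.nn fun j => ?_)
  · by_cases hx : x ∈ {x : Idx m → ℝ | ∀ κ, |y κ - x κ| ≤ t}
    · rw [Set.indicator_of_mem hx, enorm_finset_prod]
      refine le_of_eq (Finset.prod_congr rfl fun j _ => ?_)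
      rw [Set.indicator_of_mem]
      intro i
      have := abs_le.mp (hx (sel j i))
      simp only [proj]
      constructor <;> linarith [this.1, this.2]
    · rw [Set.indicator_of_notMem hx]; exact bot_le
  · exact (h.measurable_fk k j).enorm.indicator (measurableSet_box _ _)
  · refine le_trans (le_of_eq ?_) (h.lintegral_box_le hΔ ht hk j (proj j y))
    rw [← lintegral_indicator (measurableSet_box _ _)]
    refine lintegral_congr fun w => ?_
    by_cases hw : w ∈ box (fun i => proj j y i - t) (fun i => proj j y i + t)
    · rw [Set.indicator_of_mem hw, Set.indicator_of_mem hw]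
    · rw [Set.indicator_of_notMem hw, Set.indicator_of_notMem hw]; simp

/-- Single scale estimate, for fixed `p`. -/
lemma Good.lintegral_cube_fixed (h : Good Δ J T Qt F M) (hm : 1 ≤ m) (hΔ : 1 < Δ) {c₀ : ℝ}
    (hc : 0 < c₀) {μ : Fin m → ℝ} (hμ : ∀ k, c₀ ≤ μ k) {t : ℝ} (ht : 0 < t)
    {k : ℤ} (hk : (2:ℝ) ^ k ≤ 2 * t) (j₀ : Corner m) {E S : Set (Fin m → ℝ)}
    (hE : MeasurableSet E) (hS : ∀ w ∈ S, ∀ w', (∀ i, |w' i - w i| ≤ t) → w' ∈ E)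
    (p : Fin m → ℝ) :
    ∫⁻ x, ‖∏ j, fk J T F k j (proj j x)‖ₑ * S.indicator 1 (proj j₀ x) *
        ENNReal.ofReal (Ker 0 (scl t μ) (x - J.mulVec p)) ≤
      ENNReal.ofReal ((2 * Real.exp Real.pi * (1 + c₀⁻¹)) ^ (2 * m) *
        ((1 + m * (Δ * 2)) ^ (2 * m) * ∏ j, M j)) *
      ∫⁻ y, E.indicator 1 (proj j₀ y) *
        ENNReal.ofReal (Ker 0 (scl t fun k => 2 * (1 + c₀⁻¹) * μ k) (y - J.mulVec p)) := by
  have hΔ0 : 0 < Δ := by linarith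
  set CC := (2 * Real.exp Real.pi * (1 + c₀⁻¹)) ^ (2 * m) with hCC
  have hCC0 : 0 ≤ CC := by positivity
  set B : (Idx m → ℝ) → ℝ≥0∞ := fun x => ‖∏ j, fk J T F k j (proj j x)‖ₑ with hB
  have hBm : Measurable B := (h.measurable_beta k).enorm
  set c : ℝ≥0∞ := ENNReal.ofReal ((2 * t) ^ (2 * m)) with hcdef
  have hc0 : c ≠ 0 := by rw [hcdef]; simp only [ne_eq, ENNReal.ofReal_eq_zero, not_le]; positivity
  have hct : c ≠ ⊤ := ENNReal.ofReal_ne_top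
  have hmK : ∀ ν : Fin m → ℝ, Measurable fun x : Idx m → ℝ =>
      ENNReal.ofReal (Ker 0 (scl t ν) (x - J.mulVec p)) := fun ν =>
    (measurable_Ker 0 measurable_const (measurable_id.sub_const _)).ennreal_ofReal
  set K' : (Idx m → ℝ) → ℝ≥0∞ := fun y =>
    ENNReal.ofReal (Ker 0 (scl t fun k => 2 * (1 + c₀⁻¹) * μ k) (y - J.mulVec p)) with hK'
  have hmind : Measurable fun y : Idx m → ℝ => E.indicator (1 : (Fin m → ℝ) → ℝ≥0∞) (proj j₀ y) :=
    (measurable_one.indicator hE).comp (measurable_proj j₀)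
  have hmnear : MeasurableSet {z : (Idx m → ℝ) × (Idx m → ℝ) | ∀ κ, |z.2 κ - z.1 κ| ≤ t} := by
    simp only [Set.ofPred_forall]
    refine MeasurableSet.iInter fun κ => measurableSet_le ?_ measurable_const
    exact (((measurable_pi_apply κ).comp measurable_snd).sub
      ((measurable_pi_apply κ).comp measurable_fst)).abs
  have step : c * ∫⁻ x, B x * S.indicator 1 (proj j₀ x) *
        ENNReal.ofReal (Ker 0 (scl t μ) (x - J.mulVec p)) ≤
      ∫⁻ x, ∫⁻ y, ENNReal.ofReal CC * ((E.indicator 1 (proj j₀ y) * K' y) *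
        {z : (Idx m → ℝ) × (Idx m → ℝ) | ∀ κ, |z.2 κ - z.1 κ| ≤ t}.indicator (fun z => B z.1) (x, y)) := by
    rw [← lintegral_const_mul' _ _ hct]
    refine lintegral_mono fun x => ?_
    have : c = ∫⁻ y, {y : Idx m → ℝ | ∀ κ, |y κ - x κ| ≤ t}.indicator 1 y := by
      rw [lintegral_indicator_one₀, volume_idx_box x ht.le]
      exact (hmnear.preimage (measurable_prodMk_left (x := x))).nullMeasurableSet
    rw [this, ← lintegral_mul_const]
    swap
    · exact measurable_one.indicator (hmnear.preimage (measurable_prodMk_left (x := x)))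
    refine lintegral_mono fun y => ?_
    by_cases hy : ∀ κ, |y κ - x κ| ≤ t
    · rw [Set.indicator_of_mem (show y ∈ {y : Idx m → ℝ | ∀ κ, |y κ - x κ| ≤ t} from hy),
        Set.indicator_of_mem (show (x, y) ∈
          {z : (Idx m → ℝ) × (Idx m → ℝ) | ∀ κ, |z.2 κ - z.1 κ| ≤ t} from hy)]
      by_cases hx : proj j₀ x ∈ S
      · rw [Set.indicator_of_mem hx, Set.indicator_of_mem (hS _ hx (proj j₀ y) fun i => hy _)]
        simp only [Pi.one_apply, one_mul, mul_one]
        rw [mul_comm (K' y), mul_left_comm, hK', ← ENNReal.ofReal_mul hCC0]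
        gcongr
        have := Ker_zero_shift hc hμ ht (y - J.mulVec p) (x - y) (fun κ => by
          rw [Pi.sub_apply, abs_sub_comm]; exact hy κ)
        simpa using this
      · rw [Set.indicator_of_notMem hx]; simp
    · rw [Set.indicator_of_notMem (show y ∉ {y : Idx m → ℝ | ∀ κ, |y κ - x κ| ≤ t} from hy)]
      simp
  have step2 : ∫⁻ x, ∫⁻ y, ENNReal.ofReal CC * ((E.indicator 1 (proj j₀ y) * K' y) *
        {z : (Idx m → ℝ) × (Idx m → ℝ) | ∀ κ, |z.2 κ - z.1 κ| ≤ t}.indicator (fun z => B z.1) (x, y)) ≤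
      ENNReal.ofReal CC * (ENNReal.ofReal (((2 * (t + m * (Δ * (2 * t)))) ^ m) ^ 2 * ∏ j, M j) *
        ∫⁻ y, E.indicator 1 (proj j₀ y) * K' y) := by
    have hmm : Measurable fun z : (Idx m → ℝ) × (Idx m → ℝ) =>
        ENNReal.ofReal CC * ((E.indicator 1 (proj j₀ z.2) * K' z.2) *
        {z : (Idx m → ℝ) × (Idx m → ℝ) | ∀ κ, |z.2 κ - z.1 κ| ≤ t}.indicator (fun z => B z.1) z) :=
      measurable_const.mul (((hmind.mul (hmK _)).comp measurable_snd).mul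
        ((hBm.comp measurable_fst).indicator hmnear))
    rw [lintegral_lintegral_swap hmm.aemeasurable]
    rw [← lintegral_const_mul' _ _ ENNReal.ofReal_ne_top, ← lintegral_const_mul' _ _ ENNReal.ofReal_ne_top]
    refine lintegral_mono fun y => ?_
    rw [lintegral_const_mul' _ _ ENNReal.ofReal_ne_top, lintegral_const_mul]
    swap
    · exact ((hBm.comp measurable_fst).indicator hmnear).comp measurable_prodMk_right
    rw [mul_comm (E.indicator 1 (proj j₀ y) * K' y)]
    gcongr
    exact h.lintegral_near hm hΔ ht hk y
  have step3 := step.trans step2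
  rw [← ENNReal.mul_le_mul_iff_right hc0 hct]
  refine step3.trans (le_of_eq ?_)
  rw [← mul_assoc, ← mul_assoc c, ← ENNReal.ofReal_mul hCC0, hcdef,
    ← ENNReal.ofReal_mul (by positivity)]
  congr 2
  have e : 2 * (t + m * (Δ * (2 * t))) = (2 * t) * (1 + m * (Δ * 2)) := by ring
  rw [e, ← pow_mul, mul_comm m 2, mul_pow]
  ring

/-- Single scale estimate, localized to the image of one dyadic cube. -/
lemma single_cube (hm : 1 ≤ m) {Δ : ℝ} (hΔ : 1 < Δ) {c₀ : ℝ} (hc : 0 < c₀) : ∃ C : ℝ, 0 ≤ C ∧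
    ∀ (J : Matrix (Idx m) (Fin m) ℝ) (T : Set (ℤ × (Fin m → ℤ))) (Qt : ℤ × (Fin m → ℤ))
      (F : Corner m → (Fin m → ℝ) → ℝ) (M : Corner m → ℝ), Good Δ J T Qt F M →
    ∀ (μ : Fin m → ℝ), (∀ k, c₀ ≤ μ k) → ∀ (t : ℝ) (k : ℤ), 0 < t → (2:ℝ) ^ k ≤ 2 * t →
    ∀ (j₀ : Corner m) (Q : ℤ × (Fin m → ℤ)), (2:ℝ) ^ Q.1 ≤ 2 * t → t ≤ 2 * (2:ℝ) ^ Q.1 →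
    ∫⁻ p : Fin m → ℝ, ∫⁻ x, ‖∏ j, fk J T F k j (proj j x)‖ₑ *
        ((Amat J j₀).mulVec '' dC Q).indicator 1 (proj j₀ x) *
        ENNReal.ofReal (Ker 0 (scl t μ) (x - J.mulVec p)) ≤
      ENNReal.ofReal (C * ∏ j, M j) * volume (dC Q) := by
  have hΔ0 : 0 < Δ := by linarith
  refine ⟨(2 * Real.exp Real.pi * (1 + c₀⁻¹)) ^ (2 * m) * (1 + m * (Δ * 2)) ^ (2 * m) *
    (Δ * (2 * ((1 + m * (Δ * 2)) * 2)) ^ m), by positivity, ?_⟩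
  intro J T Qt F M h μ hμ t k ht hk j₀ Q hQ hQ'
  set d : Fin m → ℝ := fun i => (2:ℝ) ^ Q.1 * (Q.2 i : ℝ) with hd
  have hdQ : d ∈ dC Q := fun i => ⟨le_rfl, by
    have : (0:ℝ) < 2 ^ Q.1 := by positivity
    simp only [hd]; nlinarith⟩
  set y₀ := (Amat J j₀).mulVec d
  set r := t + m * (Δ * (2 * t)) with hr
  have hr0 : 0 ≤ r := by positivity
  set E := box (fun i => y₀ i - r) (fun i => y₀ i + r) with hE
  have hEm : MeasurableSet E := measurableSet_box _ _
  have hS : ∀ w ∈ (Amat J j₀).mulVec '' dC Q, ∀ w', (∀ i, |w' i - w i| ≤ t) → w' ∈ E := by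
    intro w hw w' hw' i
    have h1 := h.image_subset_box j₀ hdQ (y := y₀) (t := 0) (s := 2 * t) (fun i => by simp [y₀]) hQ hw i
    have h2 := abs_le.mp (hw' i)
    simp only [zero_add] at h1
    simp only [hr]
    constructor <;> linarith [h1.1, h1.2, h2.1, h2.2]
  refine (lintegral_mono fun p => h.lintegral_cube_fixed hm hΔ hc hμ ht hk j₀ hEm hS p).trans ?_
  rw [lintegral_const_mul' _ _ ENNReal.ofReal_ne_top]
  set ν : Fin m → ℝ := fun k => 2 * (1 + c₀⁻¹) * μ k with hν
  have hνp : ∀ k, 0 < ν k := fun k => by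
    have : 0 < μ k := hc.trans_le (hμ k)
    positivity
  have hsc : ∀ κ, 0 < scl t ν κ := fun κ => mul_pos ht (hνp _)
  have hfix : ∀ p : Fin m → ℝ, ∫⁻ y, E.indicator 1 (proj j₀ y) *
        ENNReal.ofReal (Ker 0 (scl t ν) (y - J.mulVec p)) =
      ∫⁻ w, E.indicator 1 w *
        ENNReal.ofReal (∏ i, hg 0 (t * ν i) (w i - (Amat J j₀).mulVec p i)) := by
    intro p
    have e : ∀ y : Idx m → ℝ, E.indicator 1 (proj j₀ y) *
        ENNReal.ofReal (Ker 0 (scl t ν) (y - J.mulVec p)) =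
        (E.indicator 1 (proj j₀ y) * ENNReal.ofReal (∏ i, hg 0 (t * ν i)
          (proj j₀ y i - (Amat J j₀).mulVec p i))) * ENNReal.ofReal (∏ i, hg 0 (t * ν i)
          (proj (cmp j₀) y i - (Amat J (cmp j₀)).mulVec p i)) := by
      intro y
      rw [mul_assoc, ← ENNReal.ofReal_mul (Finset.prod_nonneg fun i _ =>
        hg_zero_nonneg (mul_pos ht (hνp i)).le _), Ker_zero, prod_idx_split j₀]
      simp only [scl, ix_sel, Pi.sub_apply, mulVec_sel, proj]
    have hmp : ∀ j, Measurable fun w : Fin m → ℝ =>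
        ENNReal.ofReal (∏ i, hg 0 (t * ν i) (w i - (Amat J j).mulVec p i)) := fun j => by
      refine (Finset.measurable_prod _ fun i _ => ?_).ennreal_ofReal
      exact (continuous_hg 0 _).measurable.comp ((measurable_pi_apply i).sub_const _)
    simp only [e]
    rw [lintegral_proj_mul j₀ (G := fun w => E.indicator 1 w * ENNReal.ofReal (∏ i, hg 0 (t * ν i)
          (w i - (Amat J j₀).mulVec p i))) (H := fun w => ENNReal.ofReal (∏ i, hg 0 (t * ν i)
          (w i - (Amat J (cmp j₀)).mulVec p i))) ((measurable_one.indicator hEm).mul (hmp _)) (hmp _)]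
    rw [lintegral_prod_ofReal (fun i s => hg 0 (t * ν i) (s - (Amat J (cmp j₀)).mulVec p i))
      (fun i => (integrable_hg 0 (mul_pos ht (hνp i))).comp_sub_right _)
      (fun i s => hg_zero_nonneg (mul_pos ht (hνp i)).le _)]
    have : ∀ i, ∫ s, hg 0 (t * ν i) (s - (Amat J (cmp j₀)).mulVec p i) = 1 := fun i => by
      rw [integral_sub_right_eq_self (fun s => hg 0 (t * ν i) s)]
      exact integral_hg_zero (mul_pos ht (hνp i))
    simp [this]
  simp only [hfix]
  have hmz : Measurable fun z : (Fin m → ℝ) × (Fin m → ℝ) => E.indicator (1 : (Fin m → ℝ) → ℝ≥0∞) z.2 *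
      ENNReal.ofReal (∏ i, hg 0 (t * ν i) (z.2 i - (Amat J j₀).mulVec z.1 i)) := by
    refine ((measurable_one.indicator hEm).comp measurable_snd).mul ?_
    refine (Finset.measurable_prod _ fun i _ => ?_).ennreal_ofReal
    exact (continuous_hg 0 _).measurable.comp (((measurable_pi_apply i).comp measurable_snd).sub
      ((measurable_pi_apply i).comp ((continuous_mulVec' _).measurable.comp measurable_fst)))
  rw [lintegral_lintegral_swap hmz.aemeasurable]
  have hin : ∀ w : Fin m → ℝ, ∫⁻ p, E.indicator 1 w *
        ENNReal.ofReal (∏ i, hg 0 (t * ν i) (w i - (Amat J j₀).mulVec p i)) ≤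
      E.indicator (fun _ => ENNReal.ofReal Δ) w := by
    intro w
    by_cases hw : w ∈ E
    · rw [Set.indicator_of_mem hw, Set.indicator_of_mem hw]
      simp only [Pi.one_apply, one_mul]
      rw [lintegral_prod_sub_mulVec (h.det_ne j₀) (fun i => hg 0 (t * ν i))
        (fun i => integrable_hg 0 (mul_pos ht (hνp i))) (fun i => continuous_hg 0 _)
        (fun i s => hg_zero_nonneg (mul_pos ht (hνp i)).le _)]
      simp only [integral_hg_zero (mul_pos ht (hνp _)), Finset.prod_const_one, ENNReal.ofReal_one,
        mul_one]
      exact ENNReal.ofReal_le_ofReal (h.reg j₀).2.2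
    · simp [hw]
  refine (mul_le_mul_right (lintegral_mono hin) _).trans ?_
  rw [lintegral_indicator hEm, setLIntegral_const, hE, volume_box _ hr0, volume_dC]
  have hMp : 0 ≤ ∏ j, M j := Finset.prod_nonneg fun j _ => h.nn j
  rw [← ENNReal.ofReal_mul hΔ0.le, ← ENNReal.ofReal_mul (by positivity),
    ← ENNReal.ofReal_mul (by positivity)]
  refine ENNReal.ofReal_le_ofReal ?_
  have hle : (2 * r) ^ m ≤ (2 * ((1 + m * (Δ * 2)) * 2)) ^ m * ((2:ℝ) ^ Q.1) ^ m := by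
    rw [← mul_pow]
    refine pow_le_pow_left₀ (by positivity) ?_ _
    have e : r = (1 + m * (Δ * 2)) * t := by rw [hr]; ring
    rw [e]
    have : (1 + m * (Δ * 2)) * t ≤ (1 + m * (Δ * 2)) * (2 * (2:ℝ) ^ Q.1) := by gcongr
    linarith
  calc _ ≤ (2 * Real.exp Real.pi * (1 + c₀⁻¹)) ^ (2 * m) *
        ((1 + m * (Δ * 2)) ^ (2 * m) * ∏ j, M j) * (Δ *
        ((2 * ((1 + m * (Δ * 2)) * 2)) ^ m * ((2:ℝ) ^ Q.1) ^ m)) := by gcongr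
    _ = _ := by ring

end

/-- The dyadic cube at level `k` containing `x`. -/
def cubeAt (k : ℤ) (x : Fin m → ℝ) : ℤ × (Fin m → ℤ) := (k, fun i => ⌊x i / (2:ℝ) ^ k⌋)

lemma mem_cubeAt (k : ℤ) (x : Fin m → ℝ) : x ∈ dC (cubeAt k x) := by
  intro i
  have h2 : (0:ℝ) < 2 ^ k := by positivity
  simp only [cubeAt]
  constructor
  · have := Int.floor_le (x i / (2:ℝ) ^ k)
    rw [le_div_iff₀ h2] at this; linarith
  · have := Int.lt_floor_add_one (x i / (2:ℝ) ^ k)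
    rw [div_lt_iff₀ h2] at this; linarith

lemma dC_nested {Q Q' : ℤ × (Fin m → ℤ)} (hle : Q.1 ≤ Q'.1) {x : Fin m → ℝ} (hx : x ∈ dC Q)
    (hx' : x ∈ dC Q') : dC Q ⊆ dC Q' := by
  obtain ⟨n, hn⟩ := Int.le.dest hle
  have e : (2:ℝ) ^ Q'.1 = 2 ^ Q.1 * ((2 ^ n : ℤ) : ℝ) := by
    rw [← hn, zpow_add₀ (by norm_num), zpow_natCast]; push_cast; ring
  have hp : (0:ℝ) < 2 ^ Q.1 := by positivity
  intro y hy i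
  have h1 := hx i; have h2 := hx' i; have h3 := hy i
  rw [e] at h2 ⊢
  have a1 : 2 ^ n * Q'.2 i < Q.2 i + 1 := by
    have : (2:ℝ) ^ Q.1 * (((2 ^ n : ℤ) : ℝ) * Q'.2 i) < 2 ^ Q.1 * (Q.2 i + 1) := by
      linarith [h1.2, h2.1]
    have := lt_of_mul_lt_mul_left this hp.le
    exact_mod_cast this
  have a2 : Q.2 i < 2 ^ n * (Q'.2 i + 1) := by
    have : (2:ℝ) ^ Q.1 * Q.2 i < 2 ^ Q.1 * (((2 ^ n : ℤ) : ℝ) * (Q'.2 i + 1)) := by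
      linarith [h1.1, h2.2]
    have := lt_of_mul_lt_mul_left this hp.le
    exact_mod_cast this
  have b1 : ((2 ^ n : ℤ) : ℝ) * Q'.2 i ≤ Q.2 i := by
    have := Int.lt_add_one_iff.mp a1
    exact_mod_cast this
  have b2 : (Q.2 i : ℝ) + 1 ≤ ((2 ^ n : ℤ) : ℝ) * (Q'.2 i + 1) := by
    have : Q.2 i + 1 ≤ 2 ^ n * (Q'.2 i + 1) := a2
    exact_mod_cast this
  have c1 := mul_le_mul_of_nonneg_left b1 hp.le
  have c2 := mul_le_mul_of_nonneg_left b2 hp.le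
  constructor <;> linarith [h3.1, h3.2]

lemma dC_eq_of_mem {Q Q' : ℤ × (Fin m → ℤ)} (hl : Q.1 = Q'.1) {x : Fin m → ℝ} (hx : x ∈ dC Q)
    (hx' : x ∈ dC Q') : Q = Q' := by
  refine Prod.ext hl (funext fun i => ?_)
  have h1 := hx i; have h2 := hx' i
  rw [hl] at h1
  have hp : (0:ℝ) < 2 ^ Q'.1 := by positivity
  have a1 : (Q.2 i : ℝ) < Q'.2 i + 1 := lt_of_mul_lt_mul_left (lt_of_le_of_lt h1.1 h2.2) hp.le
  have a2 : (Q'.2 i : ℝ) < Q.2 i + 1 := lt_of_mul_lt_mul_left (lt_of_le_of_lt h2.1 h1.2) hp.le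
  have a1' : Q.2 i < Q'.2 i + 1 := by exact_mod_cast a1
  have a2' : Q'.2 i < Q.2 i + 1 := by exact_mod_cast a2
  omega

lemma mem_Tkset {T : Set (ℤ × (Fin m → ℤ))} {k : ℤ} {x : Fin m → ℝ} :
    x ∈ Tkset T k ↔ ∃ Q ∈ T, Q.1 = k ∧ x ∈ dC Q := by
  unfold Tkset
  simp only [Set.mem_iUnion]
  constructor
  · rintro ⟨Q, ⟨h1, h2⟩, h3⟩; exact ⟨Q, h1, h2, h3⟩
  · rintro ⟨Q, h1, h2, h3⟩; exact ⟨Q, ⟨h1, h2⟩, h3⟩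

lemma ConvexTree.Tkset_mono {T : Set (ℤ × (Fin m → ℤ))} {Qt : ℤ × (Fin m → ℤ)}
    (h : ConvexTree T Qt) {k : ℤ} (hk : k ≤ Qt.1) : Tkset T (k - 1) ⊆ Tkset T k := by
  intro x hx
  obtain ⟨Q, hQT, hQk, hxQ⟩ := mem_Tkset.mp hx
  refine mem_Tkset.mpr ⟨cubeAt k x, ?_, rfl, mem_cubeAt k x⟩
  refine h.2.2 Q hQT _ (dC_nested ?_ hxQ (mem_cubeAt k x))
    (dC_nested hk (mem_cubeAt k x) (h.2.1 Q hQT hxQ))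
  rw [hQk]; simp [cubeAt]

/-- Maximal cubes removed from the tree. -/
def bdry (T : Set (ℤ × (Fin m → ℤ))) : Set (ℤ × (Fin m → ℤ)) :=
  {Q | Q ∉ T ∧ ∃ Q' ∈ T, Q'.1 = Q.1 + 1 ∧ dC Q ⊆ dC Q'}

lemma sum_volume_le {𝒬 : Set (ℤ × (Fin m → ℤ))} {Qt : ℤ × (Fin m → ℤ)}
    (hd : 𝒬.PairwiseDisjoint dC) (hs : ∀ Q ∈ 𝒬, dC Q ⊆ dC Qt) :
    ∑' Q, 𝒬.indicator (fun Q => volume (dC Q)) Q ≤ volume (dC Qt) := by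
  rw [← tsum_subtype, ← measure_biUnion (Set.to_countable 𝒬) hd fun Q _ => measurableSet_dC Q]
  exact measure_mono (Set.iUnion₂_subset hs)

lemma ConvexTree.sum_bdry_le {T : Set (ℤ × (Fin m → ℤ))} {Qt : ℤ × (Fin m → ℤ)}
    (h : ConvexTree T Qt) :
    ∑' Q, (bdry T).indicator (fun Q => volume (dC Q)) Q ≤ volume (dC Qt) := by
  have key : ∀ Q ∈ bdry T, ∀ Q₂ ∈ bdry T, Q.1 < Q₂.1 → ∀ x, x ∈ dC Q → x ∈ dC Q₂ → False := by
    rintro Q ⟨-, Q', hQ', hl, hsub⟩ Q₂ ⟨hn, Q₂', hQ₂', -, hsub₂⟩ hlt x hx hx₂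
    refine hn (h.2.2 Q' hQ' Q₂ (dC_nested ?_ (hsub hx) hx₂) (hsub₂.trans (h.2.1 _ hQ₂')))
    omega
  refine sum_volume_le ?_ ?_
  · intro Q hQ Q₂ hQ₂ hne
    rw [Function.onFun, Set.disjoint_left]
    intro x hx hx₂
    rcases lt_trichotomy Q.1 Q₂.1 with hl | hl | hl
    · exact key Q hQ Q₂ hQ₂ hl x hx hx₂
    · exact hne (dC_eq_of_mem hl hx hx₂)
    · exact key Q₂ hQ₂ Q hQ hl x hx₂ hx
  · rintro Q ⟨-, Q', hQ', -, hsub⟩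
    exact hsub.trans (h.2.1 _ hQ')

lemma ConvexTree.sum_level_le {T : Set (ℤ × (Fin m → ℤ))} {Qt : ℤ × (Fin m → ℤ)}
    (h : ConvexTree T Qt) (k : ℤ) :
    ∑' Q, {Q ∈ T | Q.1 = k}.indicator (fun Q => volume (dC Q)) Q ≤ volume (dC Qt) := by
  refine sum_volume_le ?_ fun Q hQ => h.2.1 Q hQ.1
  intro Q hQ Q₂ hQ₂ hne
  rw [Function.onFun, Set.disjoint_left]
  exact fun x hx hx₂ => hne (dC_eq_of_mem (hQ.2.trans hQ₂.2.symm) hx hx₂)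

lemma mem_bdry_of_diff {T : Set (ℤ × (Fin m → ℤ))} {k : ℤ} {x : Fin m → ℝ} (hx : x ∈ Tkset T k)
    (hx' : x ∉ Tkset T (k - 1)) : cubeAt (k - 1) x ∈ {Q ∈ bdry T | Q.1 = k - 1} := by
  obtain ⟨Q, hQT, hQk, hxQ⟩ := mem_Tkset.mp hx
  refine ⟨⟨fun hT => hx' (mem_Tkset.mpr ⟨_, hT, rfl, mem_cubeAt _ x⟩), Q, hQT, ?_, ?_⟩, rfl⟩
  · rw [hQk]; simp [cubeAt]
  · refine dC_nested ?_ (mem_cubeAt _ x) hxQ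
    rw [hQk]; simp [cubeAt]

/-- Form at a single scale. -/
def VV (J : Matrix (Idx m) (Fin m) ℝ) (β : (Idx m → ℝ) → ℝ) (μ : Fin m → ℝ) (s : ℝ) : ℝ :=
  ∫ z : (Fin m → ℝ) × (Idx m → ℝ), β z.2 * Ker 0 (scl s μ) (z.2 - J.mulVec z.1)

lemma measurable_Ker_sub (J : Matrix (Idx m) (Fin m) ℝ) (a : Idx m → ℕ) (r : Idx m → ℝ) :
    Measurable fun z : (Fin m → ℝ) × (Idx m → ℝ) => Ker a r (z.2 - J.mulVec z.1) :=
  measurable_Ker a measurable_const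
    (measurable_snd.sub ((continuous_mulVec' J).measurable.comp measurable_fst))

lemma VV_cover (hm : 1 ≤ m) {Δ : ℝ} (hΔ : 1 < Δ) {c₀ : ℝ} (hc : 0 < c₀) : ∃ C : ℝ, 0 ≤ C ∧
    ∀ (J : Matrix (Idx m) (Fin m) ℝ) (T : Set (ℤ × (Fin m → ℤ))) (Qt : ℤ × (Fin m → ℤ))
      (F : Corner m → (Fin m → ℝ) → ℝ) (M : Corner m → ℝ), Good Δ J T Qt F M →
    ∀ (μ : Fin m → ℝ), (∀ k, c₀ ≤ μ k) → ∀ (t : ℝ) (k : ℤ), 0 < t → (2:ℝ) ^ k ≤ 2 * t →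
    ∀ 𝒬 : Set (ℤ × (Fin m → ℤ)), (∀ Q ∈ 𝒬, (2:ℝ) ^ Q.1 ≤ 2 * t ∧ t ≤ 2 * (2:ℝ) ^ Q.1) →
    ∀ β : (Idx m → ℝ) → ℝ, (∀ x, β x ≠ 0 →
      |β x| ≤ |∏ j, fk J T F k j (proj j x)| ∧
        ∃ j₀, ∃ Q ∈ 𝒬, proj j₀ x ∈ (Amat J j₀).mulVec '' dC Q) →
    ‖VV J β μ t‖ₑ ≤ ENNReal.ofReal (C * ∏ j, M j) *
      ∑' Q, 𝒬.indicator (fun Q => volume (dC Q)) Q := by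
  classical
  obtain ⟨C, hC, hsc⟩ := single_cube hm hΔ hc
  refine ⟨Fintype.card (Corner m) * C, by positivity, ?_⟩
  intro J T Qt F M h μ hμ t k ht hk 𝒬 h𝒬 β hcov
  have hsn : ∀ κ : Idx m, 0 ≤ scl t μ κ := fun κ => mul_nonneg ht.le (hc.le.trans (hμ _))
  set W : Corner m → ℤ × (Fin m → ℤ) → (Fin m → ℝ) × (Idx m → ℝ) → ℝ≥0∞ := fun j₀ Q z =>
    ‖∏ j, fk J T F k j (proj j z.2)‖ₑ *
        ((Amat J j₀).mulVec '' dC Q).indicator 1 (proj j₀ z.2) *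
        ENNReal.ofReal (Ker 0 (scl t μ) (z.2 - J.mulVec z.1)) with hW
  have hWm : ∀ j₀ Q, Measurable (W j₀ Q) := fun j₀ Q => by
    refine (((h.measurable_beta k).comp measurable_snd).enorm.mul ?_).mul
      (measurable_Ker_sub J 0 _).ennreal_ofReal
    exact (measurable_one.indicator (measurableSet_image (h.det_ne j₀) (measurableSet_dC Q))).comp
      ((measurable_proj j₀).comp measurable_snd)
  have hpt : ∀ z : (Fin m → ℝ) × (Idx m → ℝ),
      ‖β z.2 * Ker 0 (scl t μ) (z.2 - J.mulVec z.1)‖ₑ ≤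
        ∑ j₀, ∑' Q, 𝒬.indicator (fun Q => W j₀ Q z) Q := by
    intro z
    by_cases hz : β z.2 = 0
    · simp [hz]
    obtain ⟨h1, j₀, Q, hQ, hmem⟩ := hcov _ hz
    refine le_trans ?_ (Finset.single_le_sum (f := fun j₀ => ∑' Q, 𝒬.indicator (fun Q => W j₀ Q z) Q)
      (fun _ _ => bot_le) (Finset.mem_univ j₀))
    refine le_trans ?_ (ENNReal.le_tsum Q)
    rw [Set.indicator_of_mem hQ]
    simp only [hW]
    rw [Set.indicator_of_mem hmem, Pi.one_apply, mul_one, enorm_mul,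
      Real.enorm_of_nonneg (Ker_zero_nonneg hsn _)]
    gcongr
    rw [Real.enorm_eq_ofReal_abs, Real.enorm_eq_ofReal_abs]
    exact ENNReal.ofReal_le_ofReal h1
  unfold VV
  refine (enorm_integral_le_lintegral_enorm _).trans ((lintegral_mono hpt).trans ?_)
  have hindm : ∀ j₀ Q, Measurable fun z => 𝒬.indicator (fun Q => W j₀ Q z) Q := fun j₀ Q => by
    by_cases hQ : Q ∈ 𝒬
    · simp only [Set.indicator_of_mem hQ]; exact hWm j₀ Q
    · simp only [Set.indicator_of_notMem hQ]; exact measurable_const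
  rw [lintegral_finsetSum _ fun j₀ _ => Measurable.tsum fun Q => hindm j₀ Q]
  have hMp : 0 ≤ ∏ j, M j := Finset.prod_nonneg fun j _ => h.nn j
  have hj : ∀ j₀, ∫⁻ z, ∑' Q, 𝒬.indicator (fun Q => W j₀ Q z) Q ≤
      ENNReal.ofReal (C * ∏ j, M j) * ∑' Q, 𝒬.indicator (fun Q => volume (dC Q)) Q := by
    intro j₀
    rw [lintegral_tsum fun Q => (hindm j₀ Q).aemeasurable, ← ENNReal.tsum_mul_left]
    refine ENNReal.tsum_le_tsum fun Q => ?_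
    by_cases hQ : Q ∈ 𝒬
    · simp only [Set.indicator_of_mem hQ]
      rw [Measure.volume_eq_prod, lintegral_prod _ (hWm j₀ Q).aemeasurable]
      exact hsc J T Qt F M h μ hμ t k ht hk j₀ Q (h𝒬 Q hQ).1 (h𝒬 Q hQ).2
    · simp [hQ]
  refine (Finset.sum_le_sum fun j₀ _ => hj j₀).trans (le_of_eq ?_)
  rw [Finset.sum_const, Finset.card_univ, nsmul_eq_mul, ← mul_assoc, mul_assoc _ C,
    ENNReal.ofReal_mul (p := (Fintype.card (Corner m) : ℝ)) (by positivity), ENNReal.ofReal_natCast]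

section
variable {Δ : ℝ} {J : Matrix (Idx m) (Fin m) ℝ} {T : Set (ℤ × (Fin m → ℤ))}
  {Qt : ℤ × (Fin m → ℤ)} {F : Corner m → (Fin m → ℝ) → ℝ} {M : Corner m → ℝ}

/-- Product of localized functions at level `k`. -/
def bk (J : Matrix (Idx m) (Fin m) ℝ) (T : Set (ℤ × (Fin m → ℤ)))
    (F : Corner m → (Fin m → ℝ) → ℝ) (k : ℤ) (x : Idx m → ℝ) : ℝ :=
  ∏ j, fk J T F k j (proj j x)

lemma Good.measurable_bk (h : Good Δ J T Qt F M) (k : ℤ) : Measurable (bk J T F k) :=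
  h.measurable_beta k

lemma Good.bk_le (h : Good Δ J T Qt F M) : ∃ R : ℝ, 1 ≤ R ∧ ∀ (k : ℤ) (x : Idx m → ℝ),
    |bk J T F k x| ≤ R * (cub R).indicator (fun _ => 1) x := by
  obtain ⟨R, hR, hb⟩ := h.bb_le
  refine ⟨R, hR, fun k x => ?_⟩
  have := hb (2 ^ k) x
  unfold bb at this
  rwa [lev_eq (k := k) ⟨zpow_lt_zpow_right₀ (by norm_num) (by omega), le_rfl⟩] at this

lemma integrable_beta_Ker {β : (Idx m → ℝ) → ℝ} (hJ : (Amat J 0).det ≠ 0) (hβ : Measurable β)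
    {R : ℝ} (hb : ∀ x, |β x| ≤ R * (cub R).indicator (fun _ => 1) x) (a : Idx m → ℕ)
    {r : Idx m → ℝ} (hr : ∀ κ, 0 < r κ) :
    Integrable fun z : (Fin m → ℝ) × (Idx m → ℝ) => β z.2 * Ker a r (z.2 - J.mulVec z.1) := by
  have hs : ∃ ρ₀ ρ₁ : ℝ, 0 < ρ₀ ∧ 0 < ρ₁ ∧ ∀ κ, ρ₀ ≤ r κ ∧ r κ ≤ ρ₁ := by
    rcases isEmpty_or_nonempty (Idx m) with hE | hE
    · exact ⟨1, 1, one_pos, one_pos, fun κ => hE.elim κ⟩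
    · obtain ⟨κ₀, h0⟩ := Finite.exists_min r
      obtain ⟨κ₁, h1⟩ := Finite.exists_max r
      exact ⟨r κ₀, r κ₁, hr _, hr _, fun κ => ⟨h0 κ, h1 κ⟩⟩
  obtain ⟨ρ₀, ρ₁, h0, h1, hρ⟩ := hs
  obtain ⟨C, hC, hK⟩ := exists_Ker_bound (m := m) a (ρ₀ := ρ₀) (ρ₁ := ρ₁) h0
  refine ((integrable_dom hJ (c := Real.pi / 4 / ρ₁ ^ 2) (by positivity) R).const_mul (R * C)).mono'
    ((hβ.comp measurable_snd).mul (measurable_Ker_sub J a r)).aestronglyMeasurable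
    (Filter.Eventually.of_forall fun z => ?_)
  rw [Real.norm_eq_abs, abs_mul]
  calc |β z.2| * |Ker a r (z.2 - J.mulVec z.1)| ≤ (R * (cub R).indicator (fun _ => 1) z.2) *
        (C * gau (Real.pi / 4 / ρ₁ ^ 2) (z.2 - J.mulVec z.1)) :=
        mul_le_mul (hb _) (hK r hρ _) (abs_nonneg _) ((abs_nonneg _).trans (hb _))
    _ = _ := by unfold dom; ring

/-- Derivative of `VV` in the scale. -/
def VD (J : Matrix (Idx m) (Fin m) ℝ) (β : (Idx m → ℝ) → ℝ) (μ : Fin m → ℝ) (s : ℝ) : ℝ :=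
  ∫ z : (Fin m → ℝ) × (Idx m → ℝ), ∑ κ, μ (ix κ) * (s * μ (ix κ) / (2 * Real.pi)) *
    (β z.2 * Ker (0 + Pi.single κ 2) (scl s μ) (z.2 - J.mulVec z.1))

lemma hasDerivAt_VV {β : (Idx m → ℝ) → ℝ} (hJ : (Amat J 0).det ≠ 0) (hβ : Measurable β)
    {R : ℝ} (hb : ∀ x, |β x| ≤ R * (cub R).indicator (fun _ => 1) x) {μ : Fin m → ℝ}
    (hμ : ∀ k, 0 < μ k) {s : ℝ} (hs : 0 < s) : HasDerivAt (VV J β μ) (VD J β μ s) s := by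
  obtain ⟨c₀, c₁, h0, h01, hc⟩ := exists_bounds μ hμ
  have h1 : 0 < c₁ := h0.trans_le h01
  have hmeas : ∀ (a : Idx m → ℕ) (s : ℝ), Measurable fun z : (Fin m → ℝ) × (Idx m → ℝ) =>
      β z.2 * Ker a (scl s μ) (z.2 - J.mulVec z.1) := fun a s =>
    (hβ.comp measurable_snd).mul (measurable_Ker_sub J a _)
  obtain ⟨C, hC, hK⟩ : ∃ C : Idx m → ℝ, (∀ κ, 0 < C κ) ∧ ∀ κ (r : Idx m → ℝ),
      (∀ κ', s / 2 * c₀ ≤ r κ' ∧ r κ' ≤ 2 * s * c₁) → ∀ y, |Ker (0 + Pi.single κ 2) r y| ≤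
        C κ * gau (Real.pi / 4 / (2 * s * c₁) ^ 2) y := by
    choose C hC using fun κ : Idx m => exists_Ker_bound (m := m) (0 + Pi.single κ 2)
      (ρ₀ := s / 2 * c₀) (ρ₁ := 2 * s * c₁) (by positivity)
    exact ⟨C, fun κ => (hC κ).1, fun κ => (hC κ).2⟩
  set W : ℝ → (Fin m → ℝ) × (Idx m → ℝ) → ℝ := fun s z =>
    ∑ κ, μ (ix κ) * (s * μ (ix κ) / (2 * Real.pi)) *
    (β z.2 * Ker (0 + Pi.single κ 2) (scl s μ) (z.2 - J.mulVec z.1)) with hW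
  set c : ℝ := Real.pi / 4 / (2 * s * c₁) ^ 2 with hcd
  set B : ℝ := ∑ κ, μ (ix κ) * (2 * s * μ (ix κ) / (2 * Real.pi)) * (R * C κ) with hB
  have hWm : Measurable (W s) := by
    rw [hW]; exact Finset.measurable_sum _ fun κ _ => (hmeas _ s).const_mul _
  have hWb : ∀ z, ∀ s' ∈ Set.Ioo (s / 2) (2 * s), ‖W s' z‖ ≤ B * dom J c R z := by
    intro z s' hs'
    have hs0 : 0 < s' := lt_trans (by positivity) hs'.1
    rw [hB, hW, Finset.sum_mul]
    refine (norm_sum_le _ _).trans (Finset.sum_le_sum fun κ _ => ?_)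
    have hμκ := hμ (ix κ)
    rw [Real.norm_eq_abs, abs_mul, abs_mul (β z.2), abs_of_pos (show 0 < μ (ix κ) * (s' * μ (ix κ) / (2 * Real.pi)) by positivity)]
    have e1 := hK κ (scl s' μ) (scl_bounds h0 (by positivity) hc ⟨hs'.1.le, hs'.2.le⟩)
      (z.2 - J.mulVec z.1)
    have e2 : |β z.2| * |Ker (0 + Pi.single κ 2) (scl s' μ) (z.2 - J.mulVec z.1)| ≤
        (R * C κ) * dom J c R z := by
      refine (mul_le_mul (hb z.2) e1 (abs_nonneg _) ((abs_nonneg _).trans (hb _))).trans (le_of_eq ?_)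
      unfold dom; ring
    rw [mul_assoc _ (R * C κ)]
    refine mul_le_mul ?_ e2 (mul_nonneg (abs_nonneg _) (abs_nonneg _)) (by positivity)
    gcongr
    exact hs'.2.le
  have hWd : ∀ z, ∀ s' ∈ Set.Ioo (s / 2) (2 * s), HasDerivAt (fun s => β z.2 * Ker 0 (scl s μ)
      (z.2 - J.mulVec z.1)) (W s' z) s' := by
    intro z s' hs'
    have hs0 : 0 < s' := lt_trans (by positivity) hs'.1
    have := (hasDerivAt_Ker_scale 0 (r := fun s => scl s μ) (r' := fun κ => μ (ix κ)) (s := s')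
      (z.2 - J.mulVec z.1) (fun κ => by
        unfold scl; simpa using (hasDerivAt_id s').mul_const (μ (ix κ)))
      (fun κ => (mul_pos hs0 (hμ _)).ne')).const_mul (β z.2)
    refine this.congr_deriv ?_
    rw [Finset.mul_sum]
    refine Finset.sum_congr rfl fun κ _ => ?_
    unfold scl; ring
  have hdi : Integrable (fun z => B * dom J c R z) :=
    (integrable_dom hJ (by positivity) R).const_mul _
  have hV : VV J β μ = fun s => ∫ z : (Fin m → ℝ) × (Idx m → ℝ),
      β z.2 * Ker 0 (scl s μ) (z.2 - J.mulVec z.1) := rfl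
  have hVD : VD J β μ s = ∫ z, W s z := rfl
  rw [hV, hVD]
  have hi0 : Integrable fun z : (Fin m → ℝ) × (Idx m → ℝ) =>
      β z.2 * Ker 0 (scl s μ) (z.2 - J.mulVec z.1) :=
    integrable_beta_Ker hJ hβ hb 0 fun κ => mul_pos hs (hμ _)
  have hnh : Set.Ioo (s / 2) (2 * s) ∈ nhds s := Ioo_mem_nhds (by linarith) (by linarith)
  have hm0 : ∀ᶠ s in nhds s, AEStronglyMeasurable (fun z : (Fin m → ℝ) × (Idx m → ℝ) =>
      β z.2 * Ker 0 (scl s μ) (z.2 - J.mulVec z.1)) :=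
    Filter.Eventually.of_forall fun s => (hmeas 0 s).aestronglyMeasurable
  clear_value W c B
  exact (hasDerivAt_integral_of_dominated_loc_of_deriv_le hnh hm0 hi0 hWm.aestronglyMeasurable
    (Filter.Eventually.of_forall hWb) hdi (Filter.Eventually.of_forall hWd)).2

lemma sum_mul_GG_eq (μ : Fin m → ℝ) {t : ℝ} {k : ℤ}
    (ht : t ∈ Set.Ioc ((2:ℝ) ^ (k - 1)) ((2:ℝ) ^ k)) :
    ∫ z, ∑ κ, (μ (ix κ) ^ 2 / (2 * Real.pi)) * GG J T F μ 2 (Pi.single κ 2) (t, z) =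
      VD J (bk J T F k) μ t := by
  have ht0 : t ≠ 0 := (lt_trans (by positivity) ht.1).ne'
  unfold VD
  refine integral_congr_ae (Filter.Eventually.of_forall fun z => Finset.sum_congr rfl fun κ _ => ?_)
  simp only [GG, bb, bk, lev_eq ht, zero_add]
  field_simp

/-- The telescoping identity. -/
lemma Good.telescope (h : Good Δ J T Qt F M) (N : ℕ) {μ : Fin m → ℝ} (hμ : ∀ k, 0 < μ k) :
    ∑ κ, (μ (ix κ) ^ 2 / (2 * Real.pi)) * LL J T F Qt.1 N μ 2 (Pi.single κ 2) =
      ∑ n ∈ Finset.range N, (VV J (bk J T F (Qt.1 - N + n + 1)) μ (2 ^ (Qt.1 - N + n + 1)) -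
        VV J (bk J T F (Qt.1 - N + n + 1)) μ (2 ^ (Qt.1 - N + n))) := by
  set K := Qt.1
  have hInteg : Integrable (fun z => ∑ κ, (μ (ix κ) ^ 2 / (2 * Real.pi)) *
      GG J T F μ 2 (Pi.single κ 2) z) (om m K N) :=
    integrable_finsetSum _ fun κ _ => (h.integrable_GG K N hμ 2 _).const_mul _
  have e1 : ∑ κ, (μ (ix κ) ^ 2 / (2 * Real.pi)) * LL J T F K N μ 2 (Pi.single κ 2) =
      ∫ z, ∑ κ, (μ (ix κ) ^ 2 / (2 * Real.pi)) * GG J T F μ 2 (Pi.single κ 2) z ∂(om m K N) := by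
    rw [integral_finsetSum _ fun κ _ => (h.integrable_GG K N hμ 2 _).const_mul _]
    simp only [integral_const_mul, LL]
  rw [e1]
  unfold om at hInteg ⊢
  rw [integral_prod _ hInteg]
  set ψ : ℝ → ℝ := fun t => ∫ z, ∑ κ, (μ (ix κ) ^ 2 / (2 * Real.pi)) *
    GG J T F μ 2 (Pi.single κ 2) (t, z) with hψ
  have hψi : IntegrableOn ψ (Set.Ioc ((2:ℝ) ^ (K - N)) ((2:ℝ) ^ K)) := hInteg.integral_prod_left
  have hmono : ∀ n n' : ℤ, n ≤ n' → (2:ℝ) ^ n ≤ 2 ^ n' := fun n n' hn =>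
    zpow_le_zpow_right₀ (by norm_num) hn
  have hii : ∀ n < N, IntervalIntegrable ψ volume ((2:ℝ) ^ (K - N + (n : ℕ))) (2 ^ (K - N + (n + 1 : ℕ))) := by
    intro n hn
    rw [intervalIntegrable_iff_integrableOn_Ioc_of_le (hmono _ _ (by push_cast; omega))]
    exact hψi.mono_set (Set.Ioc_subset_Ioc (hmono _ _ (by omega)) (hmono _ _ (by push_cast; omega)))
  have hsum := intervalIntegral.sum_integral_adjacent_intervals
    (a := fun n : ℕ => (2:ℝ) ^ (K - N + n)) hii
  have e2 : ∫ t in Set.Ioc ((2:ℝ) ^ (K - N)) ((2:ℝ) ^ K), ψ t =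
      ∫ t in ((2:ℝ) ^ (K - N + (0:ℕ)))..(2 ^ (K - N + (N:ℕ))), ψ t := by
    rw [intervalIntegral.integral_of_le (hmono _ _ (by push_cast; omega))]
    congr 3 <;> push_cast <;> ring_nf
  rw [e2, ← hsum]
  refine Finset.sum_congr rfl fun n hn => ?_
  obtain ⟨R, hR, hb⟩ := h.bk_le
  have hle := hmono (K - N + (n:ℕ)) (K - N + (n + 1 : ℕ)) (by push_cast; omega)
  have hcongr : ∀ t ∈ Set.Ioc ((2:ℝ) ^ (K - N + (n : ℕ))) (2 ^ (K - N + (n + 1 : ℕ))),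
      ψ t = VD J (bk J T F (K - N + n + 1)) μ t := by
    intro t ht
    refine sum_mul_GG_eq μ (k := K - N + n + 1) ?_
    have a1 : K - N + n + 1 - 1 = K - N + (n:ℤ) := by ring
    have a2 : K - N + n + 1 = K - N + ((n + 1 : ℕ) : ℤ) := by push_cast; ring
    rw [a1, a2]; exact ht
  have hD := intervalIntegral.integral_eq_sub_of_hasDerivAt
    (a := (2:ℝ) ^ (K - N + (n : ℕ))) (b := 2 ^ (K - N + (n + 1 : ℕ)))
    (f := VV J (bk J T F (K - N + n + 1)) μ) (f' := VD J (bk J T F (K - N + n + 1)) μ)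
    (fun t ht => hasDerivAt_VV (h.det_ne 0) (h.measurable_bk _) (hb _) hμ (by
      rw [Set.uIcc_of_le hle] at ht
      exact lt_of_lt_of_le (by positivity) ht.1)) (by
      rw [intervalIntegrable_iff_integrableOn_Ioc_of_le hle]
      have := hii n (Finset.mem_range.mp hn)
      rw [intervalIntegrable_iff_integrableOn_Ioc_of_le hle] at this
      exact this.congr_fun hcongr measurableSet_Ioc)
  rw [intervalIntegral.integral_of_le hle, setIntegral_congr_fun measurableSet_Ioc hcongr,
    ← intervalIntegral.integral_of_le hle, hD]
  have a2 : K - N + ((n + 1 : ℕ) : ℤ) = K - N + n + 1 := by push_cast; ring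
  rw [a2]

end

/-- Size of the right-hand side of the estimates. -/
def Bd (Qt : ℤ × (Fin m → ℤ)) (M : Corner m → ℝ) : ℝ := ((2:ℝ) ^ Qt.1) ^ m * ∏ j, M j

lemma abel_sum (f : ℕ → ℕ → ℝ) (N : ℕ) :
    ∑ n ∈ Finset.range (N + 1), (f n (n + 1) - f n n) =
      f N (N + 1) - f 0 0 + ∑ n ∈ Finset.range N, (f n (n + 1) - f (n + 1) (n + 1)) := by
  induction N with
  | zero => simp
  | succ N ih => rw [Finset.sum_range_succ, ih, Finset.sum_range_succ]; ring

lemma sum_bdry_levels_le {T : Set (ℤ × (Fin m → ℤ))} {Qt : ℤ × (Fin m → ℤ)}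
    (h : ConvexTree T Qt) (a : ℤ) (N : ℕ) :
    ∑ n ∈ Finset.range N, ∑' Q, {Q ∈ bdry T | Q.1 = a + n}.indicator (fun Q => volume (dC Q)) Q ≤
      volume (dC Qt) := by
  classical
  rw [← Summable.tsum_finsetSum fun _ _ => ENNReal.summable]
  refine (ENNReal.tsum_le_tsum fun Q => ?_).trans h.sum_bdry_le
  by_cases hQ : Q ∈ bdry T
  · rw [Set.indicator_of_mem hQ]
    have : ∀ n ∈ Finset.range N, {Q ∈ bdry T | Q.1 = a + n}.indicator (fun Q => volume (dC Q)) Q =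
        if (Q.1 - a).toNat = n ∧ a ≤ Q.1 then volume (dC Q) else 0 := by
      intro n _
      rw [Set.indicator_apply]
      refine if_congr ?_ rfl rfl
      simp only [Set.mem_ofPred_eq, hQ, true_and]
      omega
    rw [Finset.sum_congr rfl this]
    by_cases ha : a ≤ Q.1
    · simp only [ha, and_true, Finset.sum_ite_eq]
      split_ifs <;> simp
    · simp [ha]
  · rw [Set.indicator_of_notMem hQ]
    refine (Finset.sum_eq_zero fun n _ => Set.indicator_of_notMem (fun h => hQ h.1) _).le

section
variable {Δ : ℝ} {J : Matrix (Idx m) (Fin m) ℝ} {T : Set (ℤ × (Fin m → ℤ))}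
  {Qt : ℤ × (Fin m → ℤ)} {F : Corner m → (Fin m → ℝ) → ℝ} {M : Corner m → ℝ}

lemma Good.Bd_nonneg (h : Good Δ J T Qt F M) : 0 ≤ Bd Qt M :=
  mul_nonneg (by positivity) (Finset.prod_nonneg fun j _ => h.nn j)

lemma mem_of_fk_ne_zero {k : ℤ} {j : Corner m} {y : Fin m → ℝ} (h : fk J T F k j y ≠ 0) :
    y ∈ (Amat J j).mulVec '' Tkset T k := by
  by_contra hy
  unfold fk at h
  exact h (Set.indicator_of_notMem hy _)

lemma bk_cover {k : ℤ} {x : Idx m → ℝ} (h : bk J T F k x ≠ 0) :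
    ∃ j₀ : Corner m, ∃ Q ∈ {Q ∈ T | Q.1 = k}, proj j₀ x ∈ (Amat J j₀).mulVec '' dC Q := by
  unfold bk at h
  obtain ⟨p, hp, he⟩ := mem_of_fk_ne_zero (Finset.prod_ne_zero_iff.mp h 0 (Finset.mem_univ _))
  obtain ⟨Q, hQ, hk, hpQ⟩ := mem_Tkset.mp hp
  exact ⟨0, Q, ⟨hQ, hk⟩, p, hpQ, he⟩

lemma Good.bk_sub_cover (hg : Good Δ J T Qt F M) {k : ℤ} (hk : k ≤ Qt.1) {x : Idx m → ℝ}
    (h : bk J T F (k - 1) x - bk J T F k x ≠ 0) :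
    |bk J T F (k - 1) x - bk J T F k x| ≤ |bk J T F k x| ∧
    ∃ j₀ : Corner m, ∃ Q ∈ {Q ∈ bdry T | Q.1 = k - 1}, proj j₀ x ∈ (Amat J j₀).mulVec '' dC Q := by
  have hne : ∃ j : Corner m, fk J T F (k - 1) j (proj j x) ≠ fk J T F k j (proj j x) := by
    by_contra hc
    push Not at hc
    exact h (sub_eq_zero.mpr (Finset.prod_congr rfl fun j _ => hc j))
  obtain ⟨j, hj⟩ := hne
  have hsub : (Amat J j).mulVec '' Tkset T (k - 1) ⊆ (Amat J j).mulVec '' Tkset T k :=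
    Set.image_mono (hg.tree.Tkset_mono hk)
  have h1 : proj j x ∉ (Amat J j).mulVec '' Tkset T (k - 1) := by
    intro hm1
    apply hj
    unfold fk
    rw [Set.indicator_of_mem hm1, Set.indicator_of_mem (hsub hm1)]
  have h0 : fk J T F (k - 1) j (proj j x) = 0 := by
    unfold fk; exact Set.indicator_of_notMem h1 _
  have h2 := mem_of_fk_ne_zero fun he => hj (h0.trans he.symm)
  have hb0 : bk J T F (k - 1) x = 0 := Finset.prod_eq_zero (Finset.mem_univ j) h0
  refine ⟨by rw [hb0, zero_sub, abs_neg], j, ?_⟩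
  obtain ⟨p, hp, he⟩ := h2
  have hp' : p ∉ Tkset T (k - 1) := fun hp' => h1 ⟨p, hp', he⟩
  exact ⟨_, mem_bdry_of_diff hp hp', p, mem_cubeAt _ _, he⟩

lemma Good.VV_sub (h : Good Δ J T Qt F M) {μ : Fin m → ℝ} (hμ : ∀ k, 0 < μ k) {s : ℝ} (hs : 0 < s)
    (k k' : ℤ) : VV J (bk J T F k) μ s - VV J (bk J T F k') μ s =
      VV J (fun x => bk J T F k x - bk J T F k' x) μ s := by
  obtain ⟨R, -, hb⟩ := h.bk_le
  have hi := fun k => integrable_beta_Ker (h.det_ne 0) (h.measurable_bk k) (hb k) 0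
    (r := scl s μ) fun κ => mul_pos hs (hμ _)
  unfold VV
  rw [← integral_sub (hi k) (hi k')]
  simp only [sub_mul]

end

/-- Uniform bound for the telescoping form. -/
lemma telescope_bound (hm : 1 ≤ m) {Δ : ℝ} (hΔ : 1 < Δ) {c₀ : ℝ} (hc : 0 < c₀) :
    ∃ C : ℝ, 0 ≤ C ∧ ∀ (J : Matrix (Idx m) (Fin m) ℝ) (T : Set (ℤ × (Fin m → ℤ)))
      (Qt : ℤ × (Fin m → ℤ)) (F : Corner m → (Fin m → ℝ) → ℝ) (M : Corner m → ℝ),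
      Good Δ J T Qt F M → ∀ (N : ℕ) (μ : Fin m → ℝ), (∀ k, c₀ ≤ μ k) →
    |∑ κ, (μ (ix κ) ^ 2 / (2 * Real.pi)) * LL J T F Qt.1 N μ 2 (Pi.single κ 2)| ≤ C * Bd Qt M := by
  obtain ⟨C, hC, hV⟩ := VV_cover hm hΔ hc
  refine ⟨3 * C, by positivity, ?_⟩
  intro J T Qt F M h N μ hμ
  have hμ0 : ∀ k, 0 < μ k := fun k => hc.trans_le (hμ k)
  rw [h.telescope N hμ0]
  rcases N with _ | N
  · simpa using mul_nonneg (by positivity) h.Bd_nonneg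
  set a : ℤ := Qt.1 - ((N + 1 : ℕ) : ℤ) with ha
  set f : ℕ → ℕ → ℝ := fun n k => VV J (bk J T F (a + n + 1)) μ (2 ^ (a + k)) with hf
  have e : ∑ n ∈ Finset.range (N + 1), (VV J (bk J T F (a + n + 1)) μ (2 ^ (a + n + 1)) -
        VV J (bk J T F (a + n + 1)) μ (2 ^ (a + n))) =
      ∑ n ∈ Finset.range (N + 1), (f n (n + 1) - f n n) := by
    refine Finset.sum_congr rfl fun n _ => ?_
    rw [hf]; push_cast; rw [add_assoc a]
  rw [e, abel_sum]
  set D := ENNReal.ofReal (C * ∏ j, M j)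
  set V := volume (dC Qt) with hVd
  have two_z : ∀ k : ℤ, (2:ℝ) ^ k = 2 * 2 ^ (k - 1) := fun k => by
    rw [zpow_sub_one₀ (by norm_num)]; ring
  have hpos : ∀ k : ℤ, (0:ℝ) < 2 ^ k := fun k => by positivity
  have hlev : ∀ (k : ℤ) (t : ℝ), 0 < t → (2:ℝ) ^ k ≤ 2 * t → t ≤ 2 * 2 ^ k →
      ‖VV J (bk J T F k) μ t‖ₑ ≤ D * V := by
    intro k t ht h1 h2
    refine (hV J T Qt F M h μ hμ t k ht h1 {Q ∈ T | Q.1 = k} (fun Q hQ => ?_) _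
      fun x hx => ⟨le_rfl, bk_cover hx⟩).trans (mul_le_mul_right (h.tree.sum_level_le k) _)
    rw [hQ.2]; exact ⟨h1, h2⟩
  have b1 : ‖f N (N + 1)‖ₑ ≤ D * V := by
    refine hlev _ _ (hpos _) ?_ ?_
    · push_cast; rw [add_assoc a]; linarith [hpos (a + (N + 1))]
    · push_cast; rw [add_assoc a]; linarith [hpos (a + (N + 1))]
  have b2 : ‖f 0 0‖ₑ ≤ D * V := by
    refine hlev _ _ (hpos _) ?_ ?_
    · rw [two_z]; simp
    · rw [two_z]; simp; linarith [hpos a]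
  have b3 : ∀ n ∈ Finset.range N, ‖f n (n + 1) - f (n + 1) (n + 1)‖ₑ ≤
      D * ∑' Q, {Q ∈ bdry T | Q.1 = a + 1 + n}.indicator (fun Q => volume (dC Q)) Q := by
    intro n hn
    have hnN := Finset.mem_range.mp hn
    set k : ℤ := a + n + 2 with hk
    have e1 : a + n + 1 = k - 1 := by rw [hk]; ring
    have e3 : a + ((n + 1 : ℕ) : ℤ) = k - 1 := by rw [hk]; push_cast; ring
    have e4 : a + 1 + n = k - 1 := by rw [hk]; ring
    have hkK : k ≤ Qt.1 := by rw [hk, ha]; push_cast; omega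
    simp only [hf, e1, e3, e4, sub_add_cancel]
    rw [h.VV_sub hμ0 (hpos _)]
    refine hV J T Qt F M h μ hμ _ k (hpos _) (two_z k).le _ (fun Q hQ => ?_) _
      fun x hx => h.bk_sub_cover hkK hx
    rw [hQ.2]
    constructor <;> linarith [hpos (k - 1)]
  have hV' : V = ENNReal.ofReal (((2:ℝ) ^ Qt.1) ^ m) := by rw [hVd, volume_dC]
  have tot : ‖f N (N + 1) - f 0 0 + ∑ n ∈ Finset.range N, (f n (n + 1) - f (n + 1) (n + 1))‖ₑ ≤
      D * V + D * V + D * V := by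
    refine (enorm_add_le _ _).trans (add_le_add ((enorm_sub_le).trans (add_le_add b1 b2)) ?_)
    refine (enorm_sum_le _ _).trans ((Finset.sum_le_sum b3).trans ?_)
    rw [← Finset.mul_sum]
    exact mul_le_mul_right (sum_bdry_levels_le h.tree _ _) _
  have hMn : 0 ≤ ∏ j, M j := Finset.prod_nonneg fun j _ => h.nn j
  have e5 : D * V + D * V + D * V = ENNReal.ofReal (3 * C * Bd Qt M) := by
    rw [hV', ← ENNReal.ofReal_mul (by positivity), ← ENNReal.ofReal_add (by positivity)
      (by positivity), ← ENNReal.ofReal_add (by positivity) (by positivity)]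
    congr 1; unfold Bd; ring
  rw [e5, Real.enorm_eq_ofReal_abs] at tot
  exact (ENNReal.ofReal_le_ofReal_iff
    (mul_nonneg (by positivity) h.Bd_nonneg)).mp tot

/-- Replace the two rows of index `l` by the row `(l, ε)`. -/
def symJ (J : Matrix (Idx m) (Fin m) ℝ) (l : Fin m) (ε : Fin 2) : Matrix (Idx m) (Fin m) ℝ :=
  fun κ q => if ix κ = l then J (lx l ε) q else J κ q

/-- Precompose a family indexed by corners with the replacement of `j l` by `ε`. -/
def symC {X : Type*} (F : Corner m → X) (l : Fin m) (ε : Fin 2) : Corner m → X :=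
  fun j => F (Function.update j l ε)

/-- Symmetry of the data in the coordinates of a set `S`. -/
structure SymOn (S : Finset (Fin m)) (J : Matrix (Idx m) (Fin m) ℝ)
    (F : Corner m → (Fin m → ℝ) → ℝ) : Prop where
  row : ∀ k ∈ S, ∀ ε ε', J (lx k ε) = J (lx k ε')
  fn : ∀ k ∈ S, ∀ j ε, F (Function.update j k ε) = F j

lemma sel_update_self (j : Corner m) (l : Fin m) (ε : Fin 2) :
    sel (Function.update j l ε) l = lx l ε := by
  rw [sel_eq, Function.update_self]

lemma sel_update_ne (j : Corner m) {l k : Fin m} (h : k ≠ l) (ε : Fin 2) :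
    sel (Function.update j l ε) k = sel j k := by
  rw [sel_eq, Function.update_of_ne h, sel_eq]

lemma symJ_lx (J : Matrix (Idx m) (Fin m) ℝ) (l : Fin m) (ε ε' : Fin 2) :
    symJ J l ε (lx l ε') = J (lx l ε) := by
  funext q; simp [symJ]

lemma symJ_ne (J : Matrix (Idx m) (Fin m) ℝ) {l : Fin m} {ε : Fin 2} {κ : Idx m} (h : ix κ ≠ l) :
    symJ J l ε κ = J κ := by
  funext q; simp [symJ, h]

lemma mulVec_row_congr {J J' : Matrix (Idx m) (Fin m) ℝ} {κ κ' : Idx m} (h : J κ = J' κ')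
    (p : Fin m → ℝ) : J.mulVec p κ = J'.mulVec p κ' := by
  simp only [Matrix.mulVec, h]

lemma Amat_symJ (J : Matrix (Idx m) (Fin m) ℝ) (l : Fin m) (ε : Fin 2) (j : Corner m) :
    Amat (symJ J l ε) j = Amat J (Function.update j l ε) := by
  ext k q
  by_cases hk : k = l
  · subst hk
    simp only [Amat, Matrix.of_apply, sel_update_self]
    rw [sel_eq, symJ_lx]
  · simp only [Amat, Matrix.of_apply, sel_update_ne j hk]
    rw [symJ_ne J (by simpa using hk)]

lemma fk_sym (J : Matrix (Idx m) (Fin m) ℝ) (T : Set (ℤ × (Fin m → ℤ)))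
    (F : Corner m → (Fin m → ℝ) → ℝ) (l : Fin m) (ε : Fin 2) (k : ℤ) (j : Corner m) :
    fk (symJ J l ε) T (symC F l ε) k j = fk J T F k (Function.update j l ε) := by
  unfold fk; rw [Amat_symJ]; rfl

lemma prod_symC_mul (M : Corner m → ℝ) (l : Fin m) :
    (∏ j, symC M l 0 j) * ∏ j, symC M l 1 j = (∏ j, M j) ^ 2 := by
  have hinv : Function.Involutive fun j : Corner m => Function.update j l (1 - j l) := by
    intro j
    simp
  have e : ∏ j : Corner m, M (Function.update j l (1 - j l)) = ∏ j, M j :=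
    Equiv.prod_comp hinv.toPerm M
  rw [sq]
  nth_rewrite 2 [← e]
  rw [← Finset.prod_mul_distrib, ← Finset.prod_mul_distrib]
  refine Finset.prod_congr rfl fun j _ => ?_
  unfold symC
  rcases Fin.eq_zero_or_eq_succ (j l) with h | ⟨i, h⟩
  · have e0 : Function.update j l 0 = j := by rw [← h, Function.update_eq_self]
    rw [h, e0]; simp
  · have h1 : j l = 1 := by rw [h]; fin_cases i; rfl
    have e0 : Function.update j l 1 = j := by rw [← h1, Function.update_eq_self]
    rw [h1, e0, mul_comm]; simp

section
variable {Δ : ℝ} {J : Matrix (Idx m) (Fin m) ℝ} {T : Set (ℤ × (Fin m → ℤ))}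
  {Qt : ℤ × (Fin m → ℤ)} {F : Corner m → (Fin m → ℝ) → ℝ} {M : Corner m → ℝ}

lemma Good.sym (h : Good Δ J T Qt F M) (l : Fin m) (ε : Fin 2) :
    Good Δ (symJ J l ε) T Qt (symC F l ε) (symC M l ε) where
  reg j := by rw [Amat_symJ]; exact h.reg _
  tree := h.tree
  cont j := h.cont _
  supp j := h.supp _
  nn j := h.nn _
  est j := by rw [Amat_symJ]; exact h.est _

lemma SymOn.sym {S : Finset (Fin m)} (h : SymOn S J F) (l : Fin m) (ε : Fin 2) :
    SymOn (insert l S) (symJ J l ε) (symC F l ε) where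
  row k hk e e' := by
    by_cases hkl : k = l
    · subst hkl; rw [symJ_lx, symJ_lx]
    · rw [symJ_ne J (by simpa using hkl), symJ_ne J (by simpa using hkl)]
      exact h.row k ((Finset.mem_insert.mp hk).resolve_left hkl) _ _
  fn k hk j e := by
    unfold symC
    by_cases hkl : k = l
    · subst hkl; rw [Function.update_idem]
    · rw [Function.update_comm hkl]
      exact h.fn k ((Finset.mem_insert.mp hk).resolve_left hkl) _ _

/-- Product of the localized functions over the corners with `j l = ε`. -/
def PP (J : Matrix (Idx m) (Fin m) ℝ) (T : Set (ℤ × (Fin m → ℤ)))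
    (F : Corner m → (Fin m → ℝ) → ℝ) (l : Fin m) (ε : Fin 2) (k : ℤ) (x : Idx m → ℝ) : ℝ :=
  ∏ j with j l = ε, fk J T F k j (proj j x)

lemma bk_eq_PP (l : Fin m) (k : ℤ) (x : Idx m → ℝ) :
    bk J T F k x = PP J T F l 0 k x * PP J T F l 1 k x := by
  unfold bk PP
  rw [← Finset.prod_filter_mul_prod_filter_not Finset.univ (fun j : Corner m => j l = 0)]
  congr 1
  refine Finset.prod_congr (Finset.filter_congr fun j _ => ?_) fun _ _ => rfl
  constructor
  · exact fun h => fin2_eq_sub h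
  · intro h; rw [h]; decide

lemma proj_update_of_ne {j : Corner m} {l : Fin m} {ε : Fin 2} (h : j l ≠ ε) (x : Idx m → ℝ)
    (a : ℝ) : proj j (Function.update x (lx l ε) a) = proj j x := by
  funext k
  unfold proj
  rw [Function.update_of_ne]
  rw [sel_eq]
  intro he
  obtain ⟨rfl, h2⟩ := lx_inj he
  exact h h2

lemma PP_update_ne {l : Fin m} {ε ε' : Fin 2} (h : ε ≠ ε') (k : ℤ) (x : Idx m → ℝ) (a : ℝ) :
    PP J T F l ε k (Function.update x (lx l ε') a) = PP J T F l ε k x := by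
  unfold PP
  refine Finset.prod_congr rfl fun j hj => ?_
  rw [proj_update_of_ne]
  rw [(Finset.mem_filter.mp hj).2]; exact h

lemma PP_sym (l : Fin m) (ε : Fin 2) (k : ℤ) (x : Idx m → ℝ) (a : ℝ) :
    PP (symJ J l ε) T (symC F l ε) l 0 k (Function.update x (lx l 0) a) =
      PP J T F l ε k (Function.update x (lx l ε) a) := by
  unfold PP
  refine Finset.prod_bij' (fun j _ => Function.update j l ε) (fun j _ => Function.update j l 0)
    ?_ ?_ ?_ ?_ ?_
  · intro j _; simp
  · intro j _; simp
  · intro j hj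
    rw [Function.update_idem, ← (Finset.mem_filter.mp hj).2, Function.update_eq_self]
  · intro j hj
    rw [Function.update_idem, ← (Finset.mem_filter.mp hj).2, Function.update_eq_self]
  · intro j hj
    rw [fk_sym]
    congr 1
    funext i
    unfold proj
    have hj0 := (Finset.mem_filter.mp hj).2
    by_cases hi : i = l
    · subst hi
      rw [sel_update_self, Function.update_self, sel_eq, hj0, Function.update_self]
    · rw [sel_update_ne j hi, Function.update_of_ne, Function.update_of_ne] <;>
      · rw [sel_eq]; intro he; exact hi (lx_inj he).1

/-- Integral of the half product in the coordinate `(l, ε)` against `θ`. -/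
def Phi (J : Matrix (Idx m) (Fin m) ℝ) (T : Set (ℤ × (Fin m → ℤ)))
    (F : Corner m → (Fin m → ℝ) → ℝ) (l : Fin m) (ε : Fin 2) (k : ℤ) (θ : ℝ → ℝ)
    (x : Idx m → ℝ) : ℝ :=
  ∫ a, PP J T F l ε k (Function.update x (lx l ε) a) * θ a

lemma Phi_sym (l : Fin m) (ε : Fin 2) (k : ℤ) (θ : ℝ → ℝ) (x : Idx m → ℝ) :
    Phi J T F l ε k θ x = Phi (symJ J l ε) T (symC F l ε) l 0 k θ x := by
  unfold Phi; simp only [PP_sym]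

lemma Phi_update_ne {l : Fin m} {ε ε' : Fin 2} (h : ε ≠ ε') (k : ℤ) (θ : ℝ → ℝ) (x : Idx m → ℝ)
    (b : ℝ) : Phi J T F l ε k θ (Function.update x (lx l ε') b) = Phi J T F l ε k θ x := by
  unfold Phi
  refine integral_congr_ae (Filter.Eventually.of_forall fun a => ?_)
  simp only
  rw [Function.update_comm, PP_update_ne h]
  intro he; exact h (lx_inj he).2.symm

lemma Good.measurable_PP (h : Good Δ J T Qt F M) (l : Fin m) (ε : Fin 2) :
    Measurable fun z : ℝ × (Idx m → ℝ) => PP J T F l ε (lev z.1) z.2 := by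
  unfold PP
  refine Finset.measurable_prod _ fun j _ => ?_
  have h2 : Measurable (fun z : ℝ × (Idx m → ℝ) => (z.1, proj j z.2)) :=
    measurable_fst.prodMk ((measurable_proj j).comp measurable_snd)
  exact Measurable.comp (g := fun z : ℝ × (Fin m → ℝ) => fk J T F (lev z.1) j z.2)
    (h.measurable_fk_lev j) h2

lemma measurable_upd (κ : Idx m) :
    Measurable fun z : (Idx m → ℝ) × ℝ => Function.update z.1 κ z.2 := by
  refine measurable_pi_iff.mpr fun κ' => ?_
  by_cases hk : κ' = κ
  · subst hk; simpa using measurable_snd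
  · simp only [Function.update_of_ne hk]; exact (measurable_pi_apply κ').comp measurable_fst

lemma Good.measurable_Phi (h : Good Δ J T Qt F M) (l : Fin m) (ε : Fin 2) {Θ : Type*}
    [MeasurableSpace Θ] {t : Θ → ℝ} {x : Θ → Idx m → ℝ} {θ : Θ → ℝ → ℝ} (ht : Measurable t)
    (hx : Measurable x) (hθ : Measurable fun z : Θ × ℝ => θ z.1 z.2) :
    Measurable fun ω => Phi J T F l ε (lev (t ω)) (θ ω) (x ω) := by
  have h1 : Measurable fun z : Θ × ℝ => (t z.1, Function.update (x z.1) (lx l ε) z.2) :=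
    (ht.comp measurable_fst).prodMk (Measurable.comp
      (g := fun z : (Idx m → ℝ) × ℝ => Function.update z.1 (lx l ε) z.2) (measurable_upd _)
      ((hx.comp measurable_fst).prodMk measurable_snd))
  have h2 : Measurable fun z : Θ × ℝ =>
      PP J T F l ε (lev (t z.1)) (Function.update (x z.1) (lx l ε) z.2) * θ z.1 z.2 :=
    (Measurable.comp (g := fun z : ℝ × (Idx m → ℝ) => PP J T F l ε (lev z.1) z.2)
      (h.measurable_PP l ε) h1).mul hθ
  unfold Phi
  exact (h2.stronglyMeasurable.integral_prod_right').measurable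

/-- Integration over the two coordinates of index `l` decouples. -/
lemma integral_refresh_two (l : Fin m) (k : ℤ) (h : Idx m → ℝ → ℝ)
    (hi : Integrable fun x => bk J T F k x * ∏ κ, h κ (x κ)) :
    (Integrable fun x => (∏ κ, if ix κ = l then hg 0 1 (x κ) else h κ (x κ)) *
        (Phi J T F l 0 k (h (lx l 0)) x * Phi J T F l 1 k (h (lx l 1)) x)) ∧
    ∫ x, bk J T F k x * ∏ κ, h κ (x κ) =
      ∫ x, (∏ κ, if ix κ = l then hg 0 1 (x κ) else h κ (x κ)) *
        (Phi J T F l 0 k (h (lx l 0)) x * Phi J T F l 1 k (h (lx l 1)) x) := by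
  classical
  have hρ : Integrable (hg 0 1) := integrable_hg 0 one_pos
  have hρ1 : ∫ y, hg 0 1 y = 1 := integral_hg_zero one_pos
  have hne : lx l 0 ≠ lx l 1 := fun he => absurd (lx_inj he).2 (by decide)
  set R : Finset (Idx m) := (Finset.univ.erase (lx l 0)).erase (lx l 1) with hR
  have hmem : ∀ κ ∈ R, κ ≠ lx l 0 ∧ κ ≠ lx l 1 := fun κ hκ => by
    simp only [hR, Finset.mem_erase, Finset.mem_univ, and_true] at hκ; exact ⟨hκ.2, hκ.1⟩
  have hsplit : ∀ q : Idx m → ℝ, ∏ κ, q κ = (q (lx l 0) * q (lx l 1)) * ∏ κ ∈ R, q κ := by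
    intro q
    rw [← Finset.mul_prod_erase Finset.univ q (Finset.mem_univ (lx l 0)),
      ← Finset.mul_prod_erase (Finset.univ.erase (lx l 0)) q (a := lx l 1)
        (Finset.mem_erase.mpr ⟨hne.symm, Finset.mem_univ _⟩), mul_assoc]
  have hRup : ∀ (x : Idx m → ℝ) (ε : Fin 2) (a : ℝ),
      ∏ κ ∈ R, h κ (Function.update x (lx l ε) a κ) = ∏ κ ∈ R, h κ (x κ) := by
    intro x ε a
    refine Finset.prod_congr rfl fun κ hκ => ?_
    rw [Function.update_of_ne]
    fin_cases ε
    · exact (hmem κ hκ).1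
    · exact (hmem κ hκ).2
  have s1 := integral_refresh (lx l 0) hρ hρ1 hi
  have e1 : (fun x : Idx m → ℝ => hg 0 1 (x (lx l 0)) * ∫ a, bk J T F k (Function.update x (lx l 0) a) *
      ∏ κ, h κ (Function.update x (lx l 0) a κ)) = fun x => hg 0 1 (x (lx l 0)) *
      (PP J T F l 1 k x * h (lx l 1) (x (lx l 1)) * (∏ κ ∈ R, h κ (x κ)) *
        Phi J T F l 0 k (h (lx l 0)) x) := by
    funext x
    congr 1
    unfold Phi
    rw [← integral_const_mul]
    refine integral_congr_ae (Filter.Eventually.of_forall fun a => ?_)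
    simp only
    rw [bk_eq_PP l, PP_update_ne (by decide : (1 : Fin 2) ≠ 0), hsplit, hRup,
      Function.update_self, Function.update_of_ne hne.symm]
    ring
  rw [e1] at s1
  have s2 := integral_refresh (lx l 1) hρ hρ1 s1.1
  suffices e : (fun x : Idx m → ℝ => (∏ κ, if ix κ = l then hg 0 1 (x κ) else h κ (x κ)) *
        (Phi J T F l 0 k (h (lx l 0)) x * Phi J T F l 1 k (h (lx l 1)) x)) =
      fun x => hg 0 1 (x (lx l 1)) * ∫ a, hg 0 1 (Function.update x (lx l 1) a (lx l 0)) *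
        ((PP J T F l 1 k (Function.update x (lx l 1) a) *
          h (lx l 1) (Function.update x (lx l 1) a (lx l 1)) *
          ∏ κ ∈ R, h κ (Function.update x (lx l 1) a κ)) *
          Phi J T F l 0 k (h (lx l 0)) (Function.update x (lx l 1) a)) by
    rw [e, ← s1.2]
    exact ⟨s2.1, s2.2.symm⟩
  funext x
  have e2 : ∏ κ, (if ix κ = l then hg 0 1 (x κ) else h κ (x κ)) =
      hg 0 1 (x (lx l 0)) * hg 0 1 (x (lx l 1)) * ∏ κ ∈ R, h κ (x κ) := by
    rw [hsplit]
    simp only [ix_lx, if_true]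
    congr 1
    refine Finset.prod_congr rfl fun κ hκ => if_neg fun he => ?_
    obtain ⟨ε, hε⟩ := lx_surj κ
    rw [he] at hε
    fin_cases ε
    · exact (hmem κ hκ).1 hε
    · exact (hmem κ hκ).2 hε
  have e3 : Phi J T F l 1 k (h (lx l 1)) x =
    ∫ a, PP J T F l 1 k (Function.update x (lx l 1) a) * h (lx l 1) a := rfl
  rw [e2, e3, ← integral_const_mul, ← integral_const_mul, ← integral_const_mul]
  refine integral_congr_ae (Filter.Eventually.of_forall fun a => ?_)
  simp only
  rw [Phi_update_ne (by decide : (0 : Fin 2) ≠ 1), hRup, Function.update_self,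
    Function.update_of_ne hne]
  ring

end

lemma lintegral_cs {α : Type*} [MeasurableSpace α] (ν : Measure α) {w f g : α → ℝ≥0∞}
    (hw : Measurable w) (hf : Measurable f) (hg : Measurable g) :
    (∫⁻ a, w a * (f a * g a) ∂ν) ^ 2 ≤ (∫⁻ a, w a * f a ^ 2 ∂ν) * ∫⁻ a, w a * g a ^ 2 ∂ν := by
  have h := ENNReal.lintegral_mul_le_Lp_mul_Lq (ν.withDensity w) Real.HolderConjugate.two_two
    hf.aemeasurable hg.aemeasurable
  rw [lintegral_withDensity_eq_lintegral_mul ν hw (hf.mul hg)] at h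
  simp only [ENNReal.rpow_two] at h
  rw [lintegral_withDensity_eq_lintegral_mul ν hw (hf.pow_const 2),
    lintegral_withDensity_eq_lintegral_mul ν hw (hg.pow_const 2)] at h
  simp only [Pi.mul_apply] at h
  refine (pow_le_pow_left' h 2).trans (le_of_eq ?_)
  rw [mul_pow, ← ENNReal.rpow_two, ← ENNReal.rpow_two, ← ENNReal.rpow_mul, ← ENNReal.rpow_mul]
  norm_num

/-- Gaussian weight with fixed unit weights in the two coordinates of index `l`. -/
def wt (J : Matrix (Idx m) (Fin m) ℝ) (l : Fin m) (ρ : Fin m → ℝ) (t : ℝ) (p : Fin m → ℝ)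
    (x : Idx m → ℝ) : ℝ :=
  ∏ κ, if ix κ = l then hg 0 1 (x κ) else hg 0 (t * ρ (ix κ)) (x κ - J.mulVec p κ)

lemma wt_nonneg (J : Matrix (Idx m) (Fin m) ℝ) (l : Fin m) {ρ : Fin m → ℝ} (hρ : ∀ k, 0 ≤ ρ k)
    {t : ℝ} (ht : 0 ≤ t) (p : Fin m → ℝ) (x : Idx m → ℝ) : 0 ≤ wt J l ρ t p x := by
  refine Finset.prod_nonneg fun κ _ => ?_
  split_ifs
  · exact hg_zero_nonneg zero_le_one _
  · exact hg_zero_nonneg (mul_nonneg ht (hρ _)) _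

lemma measurable_wt (J : Matrix (Idx m) (Fin m) ℝ) (l : Fin m) (ρ : Fin m → ℝ) :
    Measurable fun z : ℝ × (Fin m → ℝ) × (Idx m → ℝ) => wt J l ρ z.1 z.2.1 z.2.2 := by
  unfold wt
  refine Finset.measurable_prod _ fun κ _ => ?_
  have hx : Measurable fun z : ℝ × (Fin m → ℝ) × (Idx m → ℝ) => z.2.2 κ :=
    (measurable_pi_apply κ).comp (measurable_snd.comp measurable_snd)
  have hJ : Measurable fun z : ℝ × (Fin m → ℝ) × (Idx m → ℝ) => J.mulVec z.2.1 κ :=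
    (measurable_pi_apply κ).comp ((continuous_mulVec' J).measurable.comp
      (measurable_fst.comp measurable_snd))
  split_ifs
  · exact (continuous_hg 0 1).measurable.comp hx
  · exact Measurable.comp (g := fun z : ℝ × ℝ => hg 0 z.1 z.2) (measurable_hg 0)
      ((measurable_fst.mul_const _).prodMk (hx.sub hJ))

lemma wt_symJ (J : Matrix (Idx m) (Fin m) ℝ) (l : Fin m) (ε : Fin 2) (ρ : Fin m → ℝ) (t : ℝ)
    (p : Fin m → ℝ) (x : Idx m → ℝ) : wt (symJ J l ε) l ρ t p x = wt J l ρ t p x := by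
  unfold wt
  refine Finset.prod_congr rfl fun κ _ => ?_
  split_ifs with h
  · rfl
  · rw [mulVec_row_congr (symJ_ne J h)]

/-- Square form attached to the coordinate `(l, ε)`. -/
def YY (J : Matrix (Idx m) (Fin m) ℝ) (T : Set (ℤ × (Fin m → ℤ)))
    (F : Corner m → (Fin m → ℝ) → ℝ) (K : ℤ) (N : ℕ) (l : Fin m) (ε : Fin 2) (ρ : Fin m → ℝ)
    (θ : ℝ → (Fin m → ℝ) → ℝ → ℝ) : ℝ≥0∞ :=
  ∫⁻ z, ENNReal.ofReal (z.1⁻¹ * wt J l ρ z.1 z.2.1 z.2.2) *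
    ‖Phi J T F l ε (lev z.1) (θ z.1 z.2.1) z.2.2‖ₑ ^ 2 ∂(om m K N)

/-- The positive form with first order derivatives in the coordinates of index `l`. -/
def PY (J : Matrix (Idx m) (Fin m) ℝ) (T : Set (ℤ × (Fin m → ℤ)))
    (F : Corner m → (Fin m → ℝ) → ℝ) (K : ℤ) (N : ℕ) (l : Fin m) (μ : Fin m → ℝ) : ℝ≥0∞ :=
  YY J T F K N l 0 μ fun t p a => hg 1 (t * μ l) (a - J.mulVec p (lx l 0))

/-- Uniform bound of the positive forms for data symmetric on `S`. -/
def PS (Δ : ℝ) (S : Finset (Fin m)) : Prop :=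
  ∀ c₀ : ℝ, 0 < c₀ → ∃ C : ℝ, 0 ≤ C ∧ ∀ (J : Matrix (Idx m) (Fin m) ℝ)
    (T : Set (ℤ × (Fin m → ℤ))) (Qt : ℤ × (Fin m → ℤ)) (F : Corner m → (Fin m → ℝ) → ℝ)
    (M : Corner m → ℝ), Good Δ J T Qt F M → SymOn S J F → ∀ (N : ℕ), ∀ i ∈ S,
    ∀ (μ : Fin m → ℝ) (Λ : ℝ), (∀ k ∈ S, c₀ ≤ μ k ∧ μ k ≤ Λ) → (∀ k ∉ S, μ k = Λ) → c₀ ≤ Λ →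
      PY J T F Qt.1 N i μ ≤ ENNReal.ofReal (C * Bd Qt M)

section
variable {Δ : ℝ} {J : Matrix (Idx m) (Fin m) ℝ} {T : Set (ℤ × (Fin m → ℤ))}
  {Qt : ℤ × (Fin m → ℤ)} {F : Corner m → (Fin m → ℝ) → ℝ} {M : Corner m → ℝ}

lemma YY_sym (K : ℤ) (N : ℕ) (l : Fin m) (ε : Fin 2) (ρ : Fin m → ℝ)
    (θ : ℝ → (Fin m → ℝ) → ℝ → ℝ) :
    YY J T F K N l ε ρ θ = YY (symJ J l ε) T (symC F l ε) K N l 0 ρ θ := by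
  unfold YY
  simp only [wt_symJ, Phi_sym l ε]

lemma enorm_integral_le_wt (l : Fin m) (k : ℤ) {ρ : Fin m → ℝ} {t : ℝ} {B : ℝ} (hB : 1 ≤ B) (p : Fin m → ℝ) {η : Idx m → ℝ → ℝ}
    (hη : ∀ κ, ix κ ≠ l → ∀ y, |η κ y| ≤ B * hg 0 (t * ρ (ix κ)) y) :
    ‖∫ x, bk J T F k x * ∏ κ, η κ (x κ - J.mulVec p κ)‖ₑ ≤
      ∫⁻ x, ENNReal.ofReal (B ^ Fintype.card (Idx m) * wt J l ρ t p x) *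
        (‖Phi J T F l 0 k (fun a => η (lx l 0) (a - J.mulVec p (lx l 0))) x‖ₑ *
          ‖Phi J T F l 1 k (fun a => η (lx l 1) (a - J.mulVec p (lx l 1))) x‖ₑ) := by
  by_cases hi : Integrable fun x => bk J T F k x * ∏ κ, η κ (x κ - J.mulVec p κ)
  · rw [(integral_refresh_two l k (fun κ y => η κ (y - J.mulVec p κ)) hi).2]
    refine (enorm_integral_le_lintegral_enorm _).trans (lintegral_mono fun x => ?_)
    rw [enorm_mul, enorm_mul]
    refine mul_le_mul_left ?_ _
    rw [Real.enorm_eq_ofReal_abs]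
    refine ENNReal.ofReal_le_ofReal ?_
    rw [Finset.abs_prod, ← Finset.card_univ, ← Finset.prod_const]
    unfold wt
    rw [← Finset.prod_mul_distrib]
    refine Finset.prod_le_prod (fun _ _ => abs_nonneg _) fun κ _ => ?_
    split_ifs with hκ
    · have := hg_zero_nonneg zero_le_one (x κ)
      rw [abs_of_nonneg this]; nlinarith
    · exact hη κ hκ _
  · rw [integral_undef hi]; simp

lemma Good.measurable_YY_integrand (h : Good Δ J T Qt F M) (l : Fin m) (ε : Fin 2)
    {θ : ℝ → (Fin m → ℝ) → ℝ → ℝ}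
    (hθ : Measurable fun z : (ℝ × (Fin m → ℝ)) × ℝ => θ z.1.1 z.1.2 z.2) :
    Measurable fun z : ℝ × (Fin m → ℝ) × (Idx m → ℝ) =>
      ‖Phi J T F l ε (lev z.1) (θ z.1 z.2.1) z.2.2‖ₑ := by
  refine Measurable.enorm ?_
  refine h.measurable_Phi l ε (t := fun z : ℝ × (Fin m → ℝ) × (Idx m → ℝ) => z.1)
    (x := fun z => z.2.2) (θ := fun z => θ z.1 z.2.1) measurable_fst
    (measurable_snd.comp measurable_snd) ?_
  exact Measurable.comp (g := fun z : (ℝ × (Fin m → ℝ)) × ℝ => θ z.1.1 z.1.2 z.2) hθ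
    (((measurable_fst.comp measurable_fst).prodMk
      (measurable_fst.comp (measurable_snd.comp measurable_fst))).prodMk measurable_snd)

/-- Cauchy--Schwarz for the multilinear form. -/
lemma Good.form_sq_le (h : Good Δ J T Qt F M) (K : ℤ) (N : ℕ) (l : Fin m) {ρ : Fin m → ℝ} {B : ℝ}
    (hB : 1 ≤ B) {η : Idx m → ℝ → ℝ → ℝ}
    (hηm : ∀ ε, Measurable fun z : ℝ × ℝ => η (lx l ε) z.1 z.2)
    (hη : ∀ κ, ix κ ≠ l → ∀ t, 0 < t → ∀ y, |η κ t y| ≤ B * hg 0 (t * ρ (ix κ)) y) :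
    (∫⁻ t in Set.Ioc ((2:ℝ) ^ (K - N)) ((2:ℝ) ^ K), ENNReal.ofReal t⁻¹ *
      ‖∫ p, ∫ x, bb J T F t x * ∏ κ, η κ t (x κ - J.mulVec p κ)‖ₑ) ^ 2 ≤
    ENNReal.ofReal (B ^ Fintype.card (Idx m)) ^ 2 *
      (YY J T F K N l 0 ρ (fun t p a => η (lx l 0) t (a - J.mulVec p (lx l 0))) *
       YY J T F K N l 1 ρ (fun t p a => η (lx l 1) t (a - J.mulVec p (lx l 1)))) := by
  have hθ : ∀ ε, Measurable fun z : (ℝ × (Fin m → ℝ)) × ℝ =>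
      η (lx l ε) z.1.1 (z.2 - J.mulVec z.1.2 (lx l ε)) := fun ε => by
    have h2 : Measurable fun z : (ℝ × (Fin m → ℝ)) × ℝ =>
        (z.1.1, z.2 - J.mulVec z.1.2 (lx l ε)) :=
      (measurable_fst.comp measurable_fst).prodMk (measurable_snd.sub
        ((measurable_pi_apply _).comp ((continuous_mulVec' J).measurable.comp
          (measurable_snd.comp measurable_fst))))
    exact Measurable.comp (g := fun z : ℝ × ℝ => η (lx l ε) z.1 z.2) (hηm ε) h2
  set Φ : Fin 2 → ℝ × (Fin m → ℝ) × (Idx m → ℝ) → ℝ≥0∞ := fun ε z =>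
    ‖Phi J T F l ε (lev z.1) (fun a => η (lx l ε) z.1 (a - J.mulVec z.2.1 (lx l ε))) z.2.2‖ₑ
    with hΦ
  have hΦm : ∀ ε, Measurable (Φ ε) := fun ε => h.measurable_YY_integrand l ε
    (θ := fun t p a => η (lx l ε) t (a - J.mulVec p (lx l ε))) (hθ ε)
  set w : ℝ × (Fin m → ℝ) × (Idx m → ℝ) → ℝ≥0∞ := fun z =>
    ENNReal.ofReal (z.1⁻¹ * wt J l ρ z.1 z.2.1 z.2.2) with hw
  have hwm : Measurable w := (measurable_fst.inv.mul (measurable_wt J l ρ)).ennreal_ofReal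
  have hBn : 0 ≤ B ^ Fintype.card (Idx m) := by positivity
  have hmeas : Measurable fun z => w z * (Φ 0 z * Φ 1 z) := hwm.mul ((hΦm 0).mul (hΦm 1))
  have key : ∫⁻ t in Set.Ioc ((2:ℝ) ^ (K - N)) ((2:ℝ) ^ K), ENNReal.ofReal t⁻¹ *
      ‖∫ p, ∫ x, bb J T F t x * ∏ κ, η κ t (x κ - J.mulVec p κ)‖ₑ ≤
      ENNReal.ofReal (B ^ Fintype.card (Idx m)) * ∫⁻ z, w z * (Φ 0 z * Φ 1 z) ∂(om m K N) := by
    unfold om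
    rw [lintegral_prod _ hmeas.aemeasurable, ← lintegral_const_mul' _ _ ENNReal.ofReal_ne_top]
    refine setLIntegral_mono' measurableSet_Ioc fun t ht => ?_
    have ht0 : 0 < t := lt_trans (by positivity) ht.1
    have hmt : Measurable fun y : (Fin m → ℝ) × (Idx m → ℝ) =>
        w (t, y) * (Φ 0 (t, y) * Φ 1 (t, y)) := hmeas.comp measurable_prodMk_left
    rw [Measure.volume_eq_prod, lintegral_prod _ hmt.aemeasurable,
      ← lintegral_const_mul' _ _ ENNReal.ofReal_ne_top]
    refine (mul_le_mul_right (enorm_integral_le_lintegral_enorm _) _).trans ?_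
    rw [← lintegral_const_mul' _ _ ENNReal.ofReal_ne_top]
    refine lintegral_mono fun p => ?_
    refine (mul_le_mul_right (enorm_integral_le_wt l (lev t) hB p
      (η := fun κ => η κ t) fun κ hκ y => hη κ hκ t ht0 y) _).trans (le_of_eq ?_)
    rw [← lintegral_const_mul' _ _ ENNReal.ofReal_ne_top,
      ← lintegral_const_mul' _ _ ENNReal.ofReal_ne_top]
    refine lintegral_congr fun x => ?_
    simp only [hw, hΦ]
    have e : ENNReal.ofReal t⁻¹ * ENNReal.ofReal (B ^ Fintype.card (Idx m) * wt J l ρ t p x) =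
        ENNReal.ofReal (B ^ Fintype.card (Idx m)) * ENNReal.ofReal (t⁻¹ * wt J l ρ t p x) := by
      rw [← ENNReal.ofReal_mul (by positivity), ← ENNReal.ofReal_mul hBn]
      congr 1
      ring
    rw [← mul_assoc, e, mul_assoc]
  refine (pow_le_pow_left' key 2).trans ?_
  rw [mul_pow]
  exact mul_le_mul_right (lintegral_cs _ hwm (hΦm 0) (hΦm 1)) _

end

section
variable {Δ : ℝ} {J : Matrix (Idx m) (Fin m) ℝ} {T : Set (ℤ × (Fin m → ℤ))}
  {Qt : ℤ × (Fin m → ℤ)} {F : Corner m → (Fin m → ℝ) → ℝ} {M : Corner m → ℝ}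

lemma Good.measurable_YY (h : Good Δ J T Qt F M) (l : Fin m) (ε : Fin 2) (ρ : Fin m → ℝ)
    {θ : ℝ → (Fin m → ℝ) → ℝ → ℝ}
    (hθ : Measurable fun z : (ℝ × (Fin m → ℝ)) × ℝ => θ z.1.1 z.1.2 z.2) :
    Measurable fun z : ℝ × (Fin m → ℝ) × (Idx m → ℝ) =>
      ENNReal.ofReal (z.1⁻¹ * wt J l ρ z.1 z.2.1 z.2.2) *
        ‖Phi J T F l ε (lev z.1) (θ z.1 z.2.1) z.2.2‖ₑ ^ 2 :=
  (measurable_fst.inv.mul (measurable_wt J l ρ)).ennreal_ofReal.mul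
    ((h.measurable_YY_integrand l ε hθ).pow_const 2)

lemma Good.YY_eq (h : Good Δ J T Qt F M) (K : ℤ) (N : ℕ) (l : Fin m) (ε : Fin 2) (ρ : Fin m → ℝ)
    {θ : ℝ → (Fin m → ℝ) → ℝ → ℝ}
    (hθ : Measurable fun z : (ℝ × (Fin m → ℝ)) × ℝ => θ z.1.1 z.1.2 z.2) :
    YY J T F K N l ε ρ θ = ∫⁻ t in Set.Ioc ((2:ℝ) ^ (K - N)) ((2:ℝ) ^ K), ∫⁻ p, ∫⁻ x,
      ENNReal.ofReal (t⁻¹ * wt J l ρ t p x) * ‖Phi J T F l ε (lev t) (θ t p) x‖ₑ ^ 2 := by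
  have hm := h.measurable_YY l ε ρ hθ
  unfold YY om
  rw [lintegral_prod _ hm.aemeasurable]
  refine lintegral_congr fun t => ?_
  have hmt : Measurable fun y : (Fin m → ℝ) × (Idx m → ℝ) =>
      ENNReal.ofReal (t⁻¹ * wt J l ρ t y.1 y.2) * ‖Phi J T F l ε (lev t) (θ t y.1) y.2‖ₑ ^ 2 :=
    hm.comp measurable_prodMk_left
  rw [Measure.volume_eq_prod, lintegral_prod _ hmt.aemeasurable]

lemma measurable_hg_mulVec (J : Matrix (Idx m) (Fin m) ℝ) (n : ℕ) (κ : Idx m) (a b : ℝ) :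
    Measurable fun z : (ℝ × (Fin m → ℝ)) × ℝ =>
      hg n (z.1.1 * a) (z.2 - J.mulVec z.1.2 κ + z.1.1 * b) := by
  have h2 : Measurable fun z : (ℝ × (Fin m → ℝ)) × ℝ =>
      (z.1.1 * a, z.2 - J.mulVec z.1.2 κ + z.1.1 * b) :=
    ((measurable_fst.comp measurable_fst).mul_const a).prodMk ((measurable_snd.sub
      ((measurable_pi_apply _).comp ((continuous_mulVec' J).measurable.comp
        (measurable_snd.comp measurable_fst)))).add
        ((measurable_fst.comp measurable_fst).mul_const b))
  exact Measurable.comp (g := fun z : ℝ × ℝ => hg n z.1 z.2) (measurable_hg n) h2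

/-- Translation vector moving only the unsymmetrized rows other than `(l, 0)`. -/
lemma Good.exists_shift (hΔ : 1 < Δ) (h : Good Δ J T Qt F M) {S : Finset (Fin m)}
    (hS : SymOn S J F) (l : Fin m) (v : ℝ) :
    ∃ δ : Fin m → ℝ, J.mulVec δ (lx l 0) = v ∧ (∀ κ, ix κ ≠ l → ix κ ∈ S → J.mulVec δ κ = 0) ∧
      ∀ κ, |J.mulVec δ κ| ≤ m * (Δ * (Δ * (m.factorial * Δ ^ m))) * |v| := by
  set A := Amat J 0 with hA
  have hu : IsUnit A.det := (h.det_ne 0).isUnit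
  set δ : Fin m → ℝ := A⁻¹.mulVec (Pi.single l v) with hδ
  have hAδ : A.mulVec δ = Pi.single l v := by
    rw [hδ, Matrix.mulVec_mulVec, Matrix.mul_nonsing_inv A hu, Matrix.one_mulVec]
  have hrow : ∀ k, J.mulVec δ (lx k 0) = (Pi.single l v : Fin m → ℝ) k := fun k => by
    rw [← hAδ]; rfl
  refine ⟨δ, by rw [hrow]; simp, fun κ hl hκ => ?_, fun κ => ?_⟩
  · obtain ⟨ε, hε⟩ := lx_surj κ
    rw [hε, mulVec_row_congr (hS.row (ix κ) hκ ε 0), hrow]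
    exact Pi.single_eq_of_ne (M := fun _ : Fin m => ℝ) hl v
  · have hδb : ∀ k, |δ k| ≤ Δ * (m.factorial * Δ ^ m) * |v| := fun k => by
      rw [hδ, Matrix.mulVec_single, Pi.smul_apply, MulOpposite.smul_eq_mul_unop, abs_mul]
      exact mul_le_mul_of_nonneg_right ((h.reg 0).inv_entry hΔ k l) (abs_nonneg _)
    obtain ⟨ε, hε⟩ := lx_surj κ
    have := abs_mulVec_le (A := Amat J fun _ => ε) (h.reg _).entry hδb (ix κ)
    have e : J.mulVec δ κ = (Amat J fun _ => ε).mulVec δ (ix κ) := by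
      conv_lhs => rw [hε]
      rfl
    rw [e]
    refine this.trans (le_of_eq (by ring))

lemma wt_shift_le {l : Fin m} {ρ : Fin m → ℝ} (hρ : ∀ k, k ≠ l → 0 < ρ k) {θ : ℝ} (hθ : 0 ≤ θ)
    {δ : Fin m → ℝ} (hδ : ∀ κ, ix κ ≠ l → |J.mulVec δ κ| ≤ θ * ρ (ix κ)) {t : ℝ} (ht : 0 < t)
    {μ : Fin m → ℝ} (hμ : ∀ k, k ≠ l → μ k = 2 * (1 + θ) * ρ k)
    (p : Fin m → ℝ) (x : Idx m → ℝ) :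
    wt J l ρ t (p + -(t • δ)) x ≤
      (2 * Real.exp Real.pi * (1 + θ)) ^ Fintype.card (Idx m) * wt J l μ t p x := by
  unfold wt
  rw [← Finset.card_univ, ← Finset.prod_const, ← Finset.prod_mul_distrib]
  refine Finset.prod_le_prod (fun κ _ => ?_) fun κ _ => ?_
  · split_ifs with hκ
    · exact hg_zero_nonneg zero_le_one _
    · exact hg_zero_nonneg (mul_pos ht (hρ _ hκ)).le _
  · split_ifs with hκ
    · have h1 := hg_zero_nonneg zero_le_one (x κ)
      have h2 : (1:ℝ) ≤ Real.exp Real.pi := Real.one_le_exp Real.pi_pos.le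
      have h3 : 1 ≤ 2 * Real.exp Real.pi * (1 + θ) := by nlinarith
      nlinarith
    · have e : x κ - J.mulVec (p + -(t • δ)) κ = (x κ - J.mulVec p κ) + t * J.mulVec δ κ := by
        rw [Matrix.mulVec_add, Matrix.mulVec_neg, Matrix.mulVec_smul]
        simp only [Pi.add_apply, Pi.neg_apply, Pi.smul_apply, smul_eq_mul]
        ring
      rw [e]
      have hw : |t * J.mulVec δ κ| ≤ θ * (t * ρ (ix κ)) := by
        rw [abs_mul, abs_of_pos ht]
        have := mul_le_mul_of_nonneg_left (hδ κ hκ) ht.le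
        linarith
      refine (hg_shift (mul_pos ht (hρ _ hκ)) hθ hw).trans (le_of_eq ?_)
      rw [hμ _ hκ]
      congr 2
      ring

/-- Removing a translation from the square form. -/
lemma Good.YY_shift_le (hΔ : 1 < Δ) (h : Good Δ J T Qt F M) {S : Finset (Fin m)}
    (hS : SymOn S J F) (K : ℤ) (N : ℕ) {l : Fin m} {ρ μ : Fin m → ℝ} {Λ lam v θ : ℝ}
    (hlam : 0 < lam) (hlamΛ : lam ≤ Λ) (hρS : ∀ k ∈ S, k ≠ l → 0 < ρ k)
    (hρΛ : ∀ k, k ∉ S → k ≠ l → ρ k = Λ) (hθ : θ = m * (Δ * (Δ * (m.factorial * Δ ^ m))) * |v|)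
    (hμl : μ l = lam) (hμ : ∀ k, k ≠ l → μ k = 2 * (1 + θ) * ρ k) :
    YY J T F K N l 0 ρ (fun t p a => hg 1 (t * lam)
        (a - J.mulVec p (lx l 0) + t * (-(lam * v)))) ≤
      ENNReal.ofReal ((2 * Real.exp Real.pi * (1 + θ)) ^ Fintype.card (Idx m)) *
        PY J T F K N l μ := by
  have hΔ0 : 0 < Δ := by linarith
  have hθ0 : 0 ≤ θ := by rw [hθ]; positivity
  obtain ⟨δ, hδl, hδS, hδb⟩ := h.exists_shift hΔ hS l (lam * v)
  have hρ : ∀ k, k ≠ l → 0 < ρ k := fun k hk => by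
    by_cases hkS : k ∈ S
    · exact hρS k hkS hk
    · rw [hρΛ k hkS hk]; linarith
  have hδ : ∀ κ, ix κ ≠ l → |J.mulVec δ κ| ≤ θ * ρ (ix κ) := fun κ hκ => by
    by_cases hkS : ix κ ∈ S
    · rw [hδS κ hκ hkS, abs_zero]; exact mul_nonneg hθ0 (hρ _ hκ).le
    · rw [hρΛ _ hkS hκ]
      refine (hδb κ).trans ?_
      rw [abs_mul, abs_of_pos hlam]
      have := mul_le_mul_of_nonneg_left hlamΛ hθ0
      refine le_trans (le_of_eq ?_) this
      rw [hθ]; ring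
  unfold PY
  have hm1 := measurable_hg_mulVec J 1 (lx l 0) lam (-(lam * v))
  have hm2 : Measurable fun z : (ℝ × (Fin m → ℝ)) × ℝ =>
      hg 1 (z.1.1 * μ l) (z.2 - J.mulVec z.1.2 (lx l 0)) := by
    simpa using measurable_hg_mulVec J 1 (lx l 0) (μ l) 0
  rw [h.YY_eq K N l 0 ρ (θ := fun t p a => hg 1 (t * lam)
        (a - J.mulVec p (lx l 0) + t * (-(lam * v)))) hm1,
    h.YY_eq K N l 0 μ (θ := fun t p a => hg 1 (t * μ l) (a - J.mulVec p (lx l 0))) hm2,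
    ← lintegral_const_mul' _ _ ENNReal.ofReal_ne_top]
  refine setLIntegral_mono' measurableSet_Ioc fun t ht => ?_
  have ht0 : 0 < t := lt_trans (by positivity) ht.1
  rw [← lintegral_const_mul' _ _ ENNReal.ofReal_ne_top, ← lintegral_add_right_eq_self _ (-(t • δ))]
  refine lintegral_mono fun p => ?_
  rw [← lintegral_const_mul' _ _ ENNReal.ofReal_ne_top]
  refine lintegral_mono fun x => ?_
  have e : (fun a => hg 1 (t * lam) (a - J.mulVec (p + -(t • δ)) (lx l 0) + t * (-(lam * v)))) =
      fun a => hg 1 (t * μ l) (a - J.mulVec p (lx l 0)) := by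
    funext a
    rw [hμl, Matrix.mulVec_add, Matrix.mulVec_neg, Matrix.mulVec_smul]
    simp only [Pi.add_apply, Pi.neg_apply, Pi.smul_apply, smul_eq_mul, hδl]
    congr 1
    ring
  simp only
  rw [e, ← mul_assoc]
  refine mul_le_mul_left ?_ _
  rw [← ENNReal.ofReal_mul (by positivity)]
  refine ENNReal.ofReal_le_ofReal ?_
  have := mul_le_mul_of_nonneg_left (wt_shift_le hρ hθ0 hδ ht0 hμ p x) (inv_nonneg.mpr ht0.le)
  refine this.trans (le_of_eq (by ring))

/-- Bounds for the half product as a function of one coordinate. -/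
lemma Good.exists_PP_bound (h : Good Δ J T Qt F M) : ∃ R : ℝ, 0 ≤ R ∧ ∀ (l : Fin m) (k : ℤ)
    (x : Idx m → ℝ) (a : ℝ), |PP J T F l 0 k (Function.update x (lx l 0) a)| ≤
      (Set.Icc (-R) R).indicator (fun _ => R) a := by
  obtain ⟨R, hR, hb⟩ := h.exists_bound
  have hRle : R ≤ R ^ (Fintype.card (Corner m)) := le_self_pow₀ hR Fintype.card_ne_zero
  refine ⟨R ^ (Fintype.card (Corner m)), by positivity, fun l k x a => ?_⟩
  have hbd : |PP J T F l 0 k (Function.update x (lx l 0) a)| ≤ R ^ (Fintype.card (Corner m)) := by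
    unfold PP
    rw [Finset.abs_prod]
    refine (Finset.prod_le_prod (g := fun _ => R) (fun _ _ => abs_nonneg _) fun j _ =>
      (abs_fk_le k j _).trans (hb j _).1).trans ?_
    rw [Finset.prod_const]
    exact pow_le_pow_right₀ hR (Finset.card_le_univ _)
  by_cases ha : a ∈ Set.Icc (-(R ^ (Fintype.card (Corner m)))) (R ^ (Fintype.card (Corner m)))
  · rwa [Set.indicator_of_mem ha]
  · rw [Set.indicator_of_notMem ha]
    by_contra hne
    apply ha
    have h0 : fk J T F k 0 (proj 0 (Function.update x (lx l 0) a)) ≠ 0 := by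
      intro h0
      apply hne
      unfold PP
      rw [Finset.prod_eq_zero (i := (0 : Corner m)) (by simp) h0, abs_zero]
    have := (hb 0 _).2 (fk_ne_zero h0) l
    have e : proj 0 (Function.update x (lx l 0) a) l = a := by
      unfold proj; rw [sel_eq]; exact Function.update_self ..
    rw [e] at this
    exact abs_le.mp (this.trans hRle)

lemma Good.enorm_Phi_le (h : Good Δ J T Qt F M) (n : ℕ) {r : ℝ} (hr : 0 < r) (l : Fin m)
    (t b s : ℝ) (x : Idx m → ℝ) :
    ‖Phi J T F l 0 (lev t) (fun a => hg (n + 1) (Real.sqrt 2 * r) (a - b + r * s)) x‖ₑ ≤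
      ∫⁻ v, ‖Real.sqrt 2 ^ (n + 1) * hgs n (v + s)‖ₑ *
        ‖Phi J T F l 0 (lev t) (fun a => hg 1 r (a - b - r * v)) x‖ₑ := by
  obtain ⟨R, hR, hPP⟩ := h.exists_PP_bound
  obtain ⟨C, hC, hCb⟩ := hgs_bdd 1
  set w : ℝ → ℝ := fun v => Real.sqrt 2 ^ (n + 1) * hgs n (v + s) with hw
  have hwi : Integrable w := ((integrable_hgs n).comp_add_right s).const_mul _
  have hPm : Measurable fun a => PP J T F l 0 (lev t) (Function.update x (lx l 0) a) := by
    have h1 : Measurable fun a : ℝ => (t, Function.update x (lx l 0) a) :=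
      measurable_const.prodMk (Measurable.comp
        (g := fun z : (Idx m → ℝ) × ℝ => Function.update z.1 (lx l 0) z.2) (measurable_upd _)
        (measurable_const.prodMk measurable_id))
    exact Measurable.comp (g := fun z : ℝ × (Idx m → ℝ) => PP J T F l 0 (lev z.1) z.2)
      (h.measurable_PP l 0) h1
  have hPi : Integrable fun a => PP J T F l 0 (lev t) (Function.update x (lx l 0) a) := by
    refine Integrable.mono' (g := (Set.Icc (-R) R).indicator fun _ => R) ?_
      hPm.aestronglyMeasurable (Filter.Eventually.of_forall fun a => hPP l _ x a)
    exact (integrable_indicator_iff measurableSet_Icc).mpr (integrableOn_const (by simp))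
  have hgm : Measurable fun z : ℝ × ℝ => hg 1 r (z.1 - b - r * z.2) := by
    refine (continuous_hg 1 r).measurable.comp ?_
    exact (measurable_fst.sub_const b).sub (measurable_snd.const_mul r)
  have hInteg : Integrable (fun z : ℝ × ℝ => PP J T F l 0 (lev t) (Function.update x (lx l 0) z.1) *
      (w z.2 * hg 1 r (z.1 - b - r * z.2))) (volume.prod volume) := by
    have := (hPi.mul_prod hwi).mul_bdd (c := r⁻¹ * C) hgm.aestronglyMeasurable
      (Filter.Eventually.of_forall fun z => by
        unfold hg
        rw [Real.norm_eq_abs, abs_mul, abs_of_pos (inv_pos.mpr hr)]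
        exact mul_le_mul_of_nonneg_left (hCb _) (inv_pos.mpr hr).le)
    refine this.congr (Filter.Eventually.of_forall fun z => ?_)
    simp only
    ring
  have e : Phi J T F l 0 (lev t) (fun a => hg (n + 1) (Real.sqrt 2 * r) (a - b + r * s)) x =
      ∫ v, w v * Phi J T F l 0 (lev t) (fun a => hg 1 r (a - b - r * v)) x := by
    unfold Phi
    simp only [hg_succ_shift_eq_conv n hr, ← integral_const_mul]
    rw [integral_integral_swap hInteg]
    refine integral_congr_ae (Filter.Eventually.of_forall fun v => ?_)
    simp only
    refine integral_congr_ae (Filter.Eventually.of_forall fun a => ?_)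
    simp only [hw]
    ring
  rw [e]
  refine (enorm_integral_le_lintegral_enorm _).trans (le_of_eq ?_)
  refine lintegral_congr fun v => ?_
  rw [enorm_mul]

end

lemma lintegral_hgs_moment (n : ℕ) (q : ℕ) : ∃ C : ℝ, 0 ≤ C ∧ ∀ s : ℝ,
    ∫⁻ v, ‖Real.sqrt 2 ^ (n + 1) * hgs n (v + s)‖ₑ * ENNReal.ofReal ((1 + |v|) ^ q) ≤
      ENNReal.ofReal (C * (1 + |s|) ^ q) := by
  have hi : Integrable fun v : ℝ => (1 + |v|) ^ q * |hgs n v| := by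
    have h1 := integrable_hgs_mul_pow n ((Polynomial.C 2 + Polynomial.X ^ 2) ^ q)
    refine h1.abs.mono' ?_ (Filter.Eventually.of_forall fun v => ?_)
    · refine Continuous.aestronglyMeasurable ?_
      exact ((continuous_const.add continuous_abs).pow q).mul (continuous_hgs n).abs
    · rw [Real.norm_eq_abs, abs_mul, abs_mul, abs_abs]
      refine mul_le_mul_of_nonneg_right ?_ (abs_nonneg _)
      rw [abs_of_nonneg (by positivity : 0 ≤ (1 + |v|) ^ q)]
      simp only [Polynomial.eval_pow, Polynomial.eval_add, Polynomial.eval_C, Polynomial.eval_X]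
      rw [abs_of_nonneg (by positivity : 0 ≤ (2 + v ^ 2) ^ q)]
      refine pow_le_pow_left₀ (by positivity) ?_ q
      nlinarith [sq_abs v, sq_nonneg (|v| - 1)]
  refine ⟨Real.sqrt 2 ^ (n + 1) * ∫ v, (1 + |v|) ^ q * |hgs n v|, by positivity, fun s => ?_⟩
  rw [← lintegral_add_right_eq_self _ (-s)]
  have hle : ∀ v : ℝ, ‖Real.sqrt 2 ^ (n + 1) * hgs n (v + -s + s)‖ₑ *
      ENNReal.ofReal ((1 + |v + -s|) ^ q) ≤
      ENNReal.ofReal (Real.sqrt 2 ^ (n + 1) * (1 + |s|) ^ q) *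
        ENNReal.ofReal ((1 + |v|) ^ q * |hgs n v|) := fun v => by
    rw [neg_add_cancel_right, Real.enorm_eq_ofReal_abs, ← ENNReal.ofReal_mul (abs_nonneg _),
      ← ENNReal.ofReal_mul (by positivity)]
    refine ENNReal.ofReal_le_ofReal ?_
    rw [abs_mul, abs_of_nonneg (by positivity : 0 ≤ Real.sqrt 2 ^ (n + 1))]
    have h1 : (1 + |v + -s|) ^ q ≤ ((1 + |s|) * (1 + |v|)) ^ q := by
      refine pow_le_pow_left₀ (by positivity) ?_ q
      have := abs_add_le v (-s)
      rw [abs_neg] at this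
      nlinarith [mul_nonneg (abs_nonneg s) (abs_nonneg v)]
    rw [mul_pow] at h1
    have := mul_le_mul_of_nonneg_left h1 (by positivity : 0 ≤ Real.sqrt 2 ^ (n + 1) * |hgs n v|)
    refine this.trans (le_of_eq (by ring))
  refine (lintegral_mono hle).trans (le_of_eq ?_)
  rw [lintegral_const_mul' _ _ ENNReal.ofReal_ne_top,
    ← ofReal_integral_eq_lintegral_ofReal hi (Filter.Eventually.of_forall fun v => by
      simp only [Pi.zero_apply]; positivity), ← ENNReal.ofReal_mul (by positivity)]
  congr 1
  ring

lemma card_Idx : Fintype.card (Idx m) = 2 * m := by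
  unfold Idx; rw [Fintype.card_sum, Fintype.card_fin]; ring

lemma YY_deriv_le {Δ : ℝ} (hΔ : 1 < Δ) {S : Finset (Fin m)} {l : Fin m} (hl : l ∈ S)
    (hPS : PS Δ S) {c₀ : ℝ} (hc : 0 < c₀) (n : ℕ) : ∃ C : ℝ, 0 ≤ C ∧
    ∀ (J : Matrix (Idx m) (Fin m) ℝ) (T : Set (ℤ × (Fin m → ℤ))) (Qt : ℤ × (Fin m → ℤ))
    (F : Corner m → (Fin m → ℝ) → ℝ) (M : Corner m → ℝ), Good Δ J T Qt F M → SymOn S J F →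
    ∀ (N : ℕ) (ρ : Fin m → ℝ) (Λ lam s : ℝ), (∀ k ∈ S, k ≠ l → c₀ ≤ ρ k ∧ ρ k ≤ Λ) →
    (∀ k, k ∉ S → k ≠ l → ρ k = Λ) → c₀ ≤ lam → lam ≤ Λ →
    YY J T F Qt.1 N l 0 ρ (fun t p a => hg (n + 1) (Real.sqrt 2 * (t * lam))
      (a - J.mulVec p (lx l 0) + t * lam * s)) ≤
      ENNReal.ofReal (C * (1 + |s|) ^ (2 * m) * Bd Qt M) := by
  obtain ⟨C₁, hC₁, hPSb⟩ := hPS c₀ hc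
  obtain ⟨C₂, hC₂, hm0⟩ := lintegral_hgs_moment n 0
  obtain ⟨C₃, hC₃, hm1⟩ := lintegral_hgs_moment n (2 * m)
  have hΔ0 : 0 < Δ := by linarith
  set D : ℝ := m * (Δ * (Δ * (m.factorial * Δ ^ m))) with hD
  have hD0 : 0 ≤ D := by positivity
  set E : ℝ := (2 * Real.exp Real.pi * (1 + D)) ^ (2 * m) with hE
  have hE0 : 0 ≤ E := by positivity
  refine ⟨C₂ * (E * C₁ * C₃), by positivity, ?_⟩
  intro J T Qt F M h hS N ρ Λ lam s hρ hρΛ hlam hlamΛ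
  have hB := h.Bd_nonneg
  have hlam0 : 0 < lam := by linarith
  set w : ℝ → ℝ≥0∞ := fun v => ‖Real.sqrt 2 ^ (n + 1) * hgs n (v + s)‖ₑ with hw
  have hwm : Measurable w := by
    refine Measurable.enorm (Measurable.const_mul ?_ _)
    exact (continuous_hgs n).measurable.comp (measurable_id.add_const s)
  have hW : ∫⁻ v, w v ≤ ENNReal.ofReal C₂ := by
    have := hm0 s
    simp only [pow_zero, ENNReal.ofReal_one, mul_one] at this
    exact this
  set Θ : ℝ → ℝ → (Fin m → ℝ) → ℝ → ℝ := fun v t p a =>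
    hg 1 (t * lam) (a - J.mulVec p (lx l 0) + t * (-(lam * v))) with hΘ
  set ψ : ℝ × (ℝ × (Fin m → ℝ) × (Idx m → ℝ)) → ℝ≥0∞ := fun y =>
    ‖Phi J T F l 0 (lev y.2.1) (Θ y.1 y.2.1 y.2.2.1) y.2.2.2‖ₑ with hψ
  have hψm : Measurable ψ := by
    refine Measurable.enorm ?_
    have g1 : Measurable fun z : (ℝ × (ℝ × (Fin m → ℝ) × (Idx m → ℝ))) × ℝ =>
        (z.1.2.1 * lam, z.2 - J.mulVec z.1.2.2.1 (lx l 0) + z.1.2.1 * (-(lam * z.1.1))) := by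
      have ht : Measurable fun z : (ℝ × (ℝ × (Fin m → ℝ) × (Idx m → ℝ))) × ℝ => z.1.2.1 :=
        measurable_fst.comp (measurable_snd.comp measurable_fst)
      have hp : Measurable fun z : (ℝ × (ℝ × (Fin m → ℝ) × (Idx m → ℝ))) × ℝ =>
          J.mulVec z.1.2.2.1 (lx l 0) :=
        (measurable_pi_apply _).comp ((continuous_mulVec' J).measurable.comp
          (measurable_fst.comp (measurable_snd.comp (measurable_snd.comp measurable_fst))))
      have hv : Measurable fun z : (ℝ × (ℝ × (Fin m → ℝ) × (Idx m → ℝ))) × ℝ => z.1.1 :=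
        measurable_fst.comp measurable_fst
      exact (ht.mul_const lam).prodMk ((measurable_snd.sub hp).add
        (ht.mul (hv.const_mul lam).neg))
    have g2 : Measurable fun z : (ℝ × (ℝ × (Fin m → ℝ) × (Idx m → ℝ))) × ℝ =>
        Θ z.1.1 z.1.2.1 z.1.2.2.1 z.2 :=
      Measurable.comp (g := fun z : ℝ × ℝ => hg 1 z.1 z.2) (measurable_hg 1) g1
    exact h.measurable_Phi l 0
      (t := fun y : ℝ × (ℝ × (Fin m → ℝ) × (Idx m → ℝ)) => y.2.1) (x := fun y => y.2.2.2)
      (θ := fun y => Θ y.1 y.2.1 y.2.2.1) (measurable_fst.comp measurable_snd)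
      (measurable_snd.comp (measurable_snd.comp measurable_snd)) g2
  set q : ℝ × (Fin m → ℝ) × (Idx m → ℝ) → ℝ≥0∞ := fun z =>
    ENNReal.ofReal (z.1⁻¹ * wt J l ρ z.1 z.2.1 z.2.2) with hq
  have hqm : Measurable q := (measurable_fst.inv.mul (measurable_wt J l ρ)).ennreal_ofReal
  have step1 : YY J T F Qt.1 N l 0 ρ (fun t p a => hg (n + 1) (Real.sqrt 2 * (t * lam))
      (a - J.mulVec p (lx l 0) + t * lam * s)) ≤
      ENNReal.ofReal C₂ * ∫⁻ z, (∫⁻ v, w v * (q z * ψ (v, z) ^ 2)) ∂(om m Qt.1 N) := by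
    unfold YY
    rw [← lintegral_const_mul' _ _ ENNReal.ofReal_ne_top]
    refine lintegral_mono_ae ?_
    have hae : ∀ᵐ z ∂(om m Qt.1 N), (0:ℝ) < z.1 := by
      have h0 : ∀ᵐ t ∂((volume : Measure ℝ).restrict
          (Set.Ioc ((2:ℝ) ^ (Qt.1 - N)) ((2:ℝ) ^ Qt.1))), 0 < t :=
        ae_scale fun t ht _ => lt_of_lt_of_le (by positivity) ht
      exact Measure.quasiMeasurePreserving_fst.ae h0
    filter_upwards [hae] with z hz
    have hPhi := h.enorm_Phi_le n (mul_pos hz hlam0) l z.1 (J.mulVec z.2.1 (lx l 0)) s z.2.2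
    have hψe : ∀ v, ‖Phi J T F l 0 (lev z.1) (fun a => hg 1 (z.1 * lam)
        (a - J.mulVec z.2.1 (lx l 0) - z.1 * lam * v)) z.2.2‖ₑ = ψ (v, z) := fun v => by
      simp only [hψ, hΘ]
      congr 3
      funext a
      congr 1
      ring
    simp only [hψe] at hPhi
    have hψz : Measurable fun v => ψ (v, z) := hψm.comp measurable_prodMk_right
    have hcs := lintegral_cs (volume : Measure ℝ) hwm (f := fun _ => 1) measurable_const hψz
    simp only [one_mul, one_pow, mul_one] at hcs
    have e : ∫⁻ v, w v * (q z * ψ (v, z) ^ 2) = q z * ∫⁻ v, w v * ψ (v, z) ^ 2 := by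
      rw [← lintegral_const_mul' _ _ ENNReal.ofReal_ne_top]
      refine lintegral_congr fun v => ?_
      rw [← mul_assoc, ← mul_assoc, mul_comm (w v)]
    rw [e]
    have hp := (pow_le_pow_left' hPhi 2).trans (hcs.trans (mul_le_mul_left hW _))
    exact (mul_le_mul_right hp (q z)).trans (le_of_eq (mul_left_comm _ _ _))
  have step2 : ∫⁻ z, (∫⁻ v, w v * (q z * ψ (v, z) ^ 2)) ∂(om m Qt.1 N) =
      ∫⁻ v, w v * YY J T F Qt.1 N l 0 ρ (Θ v) := by
    have : SFinite (om m Qt.1 N) := by unfold om; infer_instance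
    have hmm : Measurable fun y : (ℝ × (Fin m → ℝ) × (Idx m → ℝ)) × ℝ =>
        w y.2 * (q y.1 * ψ (y.2, y.1) ^ 2) :=
      (hwm.comp measurable_snd).mul ((hqm.comp measurable_fst).mul
        ((hψm.comp (measurable_snd.prodMk measurable_fst)).pow_const 2))
    rw [lintegral_lintegral_swap hmm.aemeasurable]
    refine lintegral_congr fun v => ?_
    rw [lintegral_const_mul' _ _ enorm_ne_top]
    rfl
  have step3 : ∀ v, YY J T F Qt.1 N l 0 ρ (Θ v) ≤
      ENNReal.ofReal (E * C₁ * Bd Qt M) * ENNReal.ofReal ((1 + |v|) ^ (2 * m)) := fun v => by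
    have hθ0 : 0 ≤ D * |v| := by positivity
    set μ : Fin m → ℝ := fun k => if k = l then lam else 2 * (1 + D * |v|) * ρ k with hμ
    have hle : ∀ r : ℝ, 0 ≤ r → r ≤ 2 * (1 + D * |v|) * r := fun r hr => by nlinarith
    have hΛ0 : 0 ≤ Λ := by linarith
    refine (h.YY_shift_le hΔ hS Qt.1 N (v := v) (θ := D * |v|) (μ := μ) hlam0 hlamΛ
      (fun k hk hkl => by linarith [(hρ k hk hkl).1]) hρΛ rfl (by simp [hμ])
      (fun k hk => by simp [hμ, hk])).trans ?_
    refine (mul_le_mul_right (hPSb J T Qt F M h hS N l hl μ (2 * (1 + D * |v|) * Λ) ?_ ?_ ?_)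
      _).trans ?_
    · intro k hk
      simp only [hμ]
      split_ifs with hkl
      · exact ⟨hlam, hlamΛ.trans (hle Λ hΛ0)⟩
      · have := hρ k hk hkl
        exact ⟨this.1.trans (hle _ (by linarith)), by gcongr; exact this.2⟩
    · intro k hk
      have hkl : k ≠ l := fun he => hk (he ▸ hl)
      simp only [hμ, if_neg hkl, hρΛ k hk hkl]
    · exact (hlam.trans hlamΛ).trans (hle Λ hΛ0)
    · rw [← ENNReal.ofReal_mul (by positivity), ← ENNReal.ofReal_mul (by positivity), card_Idx]
      refine ENNReal.ofReal_le_ofReal ?_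
      have h1 : (2 * Real.exp Real.pi * (1 + D * |v|)) ^ (2 * m) ≤ E * (1 + |v|) ^ (2 * m) := by
        rw [hE, ← mul_pow]
        refine pow_le_pow_left₀ (by positivity) ?_ _
        rw [mul_assoc (2 * Real.exp Real.pi)]
        refine mul_le_mul_of_nonneg_left ?_ (by positivity)
        nlinarith [abs_nonneg v]
      have := mul_le_mul_of_nonneg_right h1 (mul_nonneg hC₁ hB)
      refine this.trans (le_of_eq (by ring))
  refine step1.trans ?_
  rw [step2]
  have step4 : ∫⁻ v, w v * YY J T F Qt.1 N l 0 ρ (Θ v) ≤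
      ENNReal.ofReal (E * C₁ * Bd Qt M) * ENNReal.ofReal (C₃ * (1 + |s|) ^ (2 * m)) := by
    refine le_trans ?_ (mul_le_mul_right (hm1 s) _)
    rw [← lintegral_const_mul' _ _ ENNReal.ofReal_ne_top]
    refine lintegral_mono fun v => ?_
    rw [mul_left_comm]
    exact mul_le_mul_right (step3 v) _
  refine (mul_le_mul_right step4 _).trans (le_of_eq ?_)
  rw [← ENNReal.ofReal_mul (by positivity), ← ENNReal.ofReal_mul (by positivity)]
  congr 1
  ring

/-- Bound of a multilinear form having derivatives in both coordinates of index `l`. -/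
lemma form_le {Δ : ℝ} (hΔ : 1 < Δ) {S : Finset (Fin m)} {l : Fin m}
    (hPS : PS Δ (insert l S)) {c₀ : ℝ} (hc : 0 < c₀) (n : Fin 2 → ℕ) : ∃ C : ℝ, 0 ≤ C ∧
    ∀ (J : Matrix (Idx m) (Fin m) ℝ) (T : Set (ℤ × (Fin m → ℤ))) (Qt : ℤ × (Fin m → ℤ))
    (F : Corner m → (Fin m → ℝ) → ℝ) (M : Corner m → ℝ), Good Δ J T Qt F M → SymOn S J F →
    ∀ (N : ℕ) (ρ : Fin m → ℝ) (Λ lam : ℝ), (∀ k ∈ S, k ≠ l → c₀ ≤ ρ k ∧ ρ k ≤ Λ) →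
    (∀ k, k ∉ S → k ≠ l → ρ k = Λ) → c₀ ≤ lam → lam ≤ Λ →
    ∀ (B σ : ℝ) (s : Fin 2 → ℝ) (η : Idx m → ℝ → ℝ → ℝ), 1 ≤ B → (∀ ε, |s ε| ≤ σ) →
    (∀ ε, η (lx l ε) = fun t y => hg (n ε + 1) (Real.sqrt 2 * (t * lam)) (y + t * lam * s ε)) →
    (∀ κ, ix κ ≠ l → ∀ t, 0 < t → ∀ y, |η κ t y| ≤ B * hg 0 (t * ρ (ix κ)) y) →
    ∫⁻ t in Set.Ioc ((2:ℝ) ^ (Qt.1 - N)) ((2:ℝ) ^ Qt.1), ENNReal.ofReal t⁻¹ *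
      ‖∫ p, ∫ x, bb J T F t x * ∏ κ, η κ t (x κ - J.mulVec p κ)‖ₑ ≤
      ENNReal.ofReal (C * B ^ (2 * m) * (1 + σ) ^ (2 * m) * Bd Qt M) := by
  choose C hC hY using fun ε : Fin 2 =>
    YY_deriv_le hΔ (Finset.mem_insert_self l S) hPS hc (n ε)
  refine ⟨C 0 + C 1, add_nonneg (hC 0) (hC 1), ?_⟩
  intro J T Qt F M h hS N ρ Λ lam hρ hρΛ hlam hlamΛ B σ s η hB hs hηl hη
  have hBd := h.Bd_nonneg
  have hηm : ∀ ε, Measurable fun z : ℝ × ℝ => η (lx l ε) z.1 z.2 := fun ε => by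
    rw [hηl ε]
    have h2 : Measurable fun z : ℝ × ℝ => (Real.sqrt 2 * (z.1 * lam), z.2 + z.1 * lam * s ε) := by
      fun_prop
    exact Measurable.comp (g := fun z : ℝ × ℝ => hg (n ε + 1) z.1 z.2) (measurable_hg _) h2
  have hσ : 0 ≤ σ := (abs_nonneg _).trans (hs 0)
  have hYε : ∀ ε, YY J T F Qt.1 N l ε ρ (fun t p a => η (lx l ε) t (a - J.mulVec p (lx l ε))) ≤
      ENNReal.ofReal (((C 0 + C 1) * (1 + σ) ^ (2 * m)) * Bd Qt (symC M l ε)) := fun ε => by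
    have hg := (h.sym l ε)
    have e : (fun (t : ℝ) (p : Fin m → ℝ) (a : ℝ) => η (lx l ε) t (a - J.mulVec p (lx l ε))) =
        fun t p a => SBL.hg (n ε + 1) (Real.sqrt 2 * (t * lam))
          (a - (symJ J l ε).mulVec p (lx l 0) + t * lam * s ε) := by
      funext t p a
      rw [hηl ε, mulVec_row_congr (symJ_lx J l ε 0)]
    rw [YY_sym, e]
    refine (hY ε _ T Qt _ _ hg (hS.sym l ε) N ρ Λ lam (s ε) ?_ ?_ hlam hlamΛ).trans ?_
    · intro k hk hkl
      exact hρ k ((Finset.mem_insert.mp hk).resolve_left hkl) hkl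
    · intro k hk hkl
      exact hρΛ k (fun hkS => hk (Finset.mem_insert_of_mem hkS)) hkl
    · refine ENNReal.ofReal_le_ofReal (mul_le_mul_of_nonneg_right ?_ hg.Bd_nonneg)
      have hCε : C ε ≤ C 0 + C 1 := by
        fin_cases ε
        · simpa using hC 1
        · simpa using hC 0
      refine mul_le_mul hCε (pow_le_pow_left₀ (by positivity) (by linarith [hs ε]) _)
        (by positivity) (add_nonneg (hC 0) (hC 1))
  have key := h.form_sq_le Qt.1 N l (ρ := ρ) hB hηm hη
  rw [← ENNReal.pow_le_pow_left_iff two_ne_zero]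
  refine key.trans ((mul_le_mul_right (mul_le_mul' (hYε 0) (hYε 1)) _).trans (le_of_eq ?_))
  have hC01 : 0 ≤ C 0 + C 1 := add_nonneg (hC 0) (hC 1)
  have hB0 := (h.sym l 0).Bd_nonneg
  rw [← ENNReal.ofReal_pow (by positivity), ← ENNReal.ofReal_pow (by positivity),
    ← ENNReal.ofReal_mul (by positivity), ← ENNReal.ofReal_mul (by positivity), card_Idx]
  congr 1
  have hp := prod_symC_mul M l
  unfold Bd
  calc _ = (B ^ (2 * m)) ^ 2 * ((C 0 + C 1) * (1 + σ) ^ (2 * m)) ^ 2 * (((2:ℝ) ^ Qt.1) ^ m) ^ 2 *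
        ((∏ j, symC M l 0 j) * ∏ j, symC M l 1 j) := by ring
    _ = _ := by rw [hp]; ring

section
variable {Δ : ℝ} {J : Matrix (Idx m) (Fin m) ℝ} {T : Set (ℤ × (Fin m → ℤ))}
  {Qt : ℤ × (Fin m → ℤ)} {F : Corner m → (Fin m → ℝ) → ℝ} {M : Corner m → ℝ}

lemma GG_eq_hg (μ : Fin m → ℝ) (a : Idx m → ℕ) {t : ℝ} (ht : 0 < t)
    (p : Fin m → ℝ) (x : Idx m → ℝ) :
    GG J T F μ (∑ κ, a κ) a (t, p, x) = (∏ κ, μ (ix κ) ^ a κ)⁻¹ * (t⁻¹ *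
      (bb J T F t x * ∏ κ, hg (a κ) (t * μ (ix κ)) (x κ - J.mulVec p κ))) := by
  have e : Ker a (scl t μ) (x - J.mulVec p) = (t ^ (∑ κ, a κ))⁻¹ * (∏ κ, μ (ix κ) ^ a κ)⁻¹ *
      ∏ κ, hg (a κ) (t * μ (ix κ)) (x κ - J.mulVec p κ) := by
    unfold Ker gd scl
    rw [Finset.prod_mul_distrib, Finset.prod_inv_distrib]
    simp only [mul_pow, Finset.prod_mul_distrib, Finset.prod_pow_eq_pow_sum, mul_inv, Pi.sub_apply]
  have h1 : t ^ (∑ κ, a κ) ≠ 0 := (pow_pos ht _).ne'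
  simp only [GG, e]
  field_simp

lemma Good.LL_iter (h : Good Δ J T Qt F M) (K : ℤ) (N : ℕ) {μ : Fin m → ℝ} (hμ : ∀ k, 0 < μ k)
    (a : Idx m → ℕ) :
    LL J T F K N μ (∑ κ, a κ) a = (∏ κ, μ (ix κ) ^ a κ)⁻¹ *
      ∫ t in Set.Ioc ((2:ℝ) ^ (K - N)) ((2:ℝ) ^ K), t⁻¹ *
        ∫ p, ∫ x, bb J T F t x * ∏ κ, hg (a κ) (t * μ (ix κ)) (x κ - J.mulVec p κ) := by
  have hi := h.integrable_GG K N hμ (∑ κ, a κ) a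
  unfold LL
  unfold om at hi ⊢
  rw [integral_prod _ hi, ← integral_const_mul]
  refine integral_congr_ae ?_
  filter_upwards [hi.prod_right_ae, ae_restrict_mem measurableSet_Ioc] with t hti htm
  have ht : 0 < t := lt_trans (by positivity) htm.1
  refine (integral_prod _ hti).trans ?_
  rw [← integral_const_mul, ← integral_const_mul]
  refine integral_congr_ae (Filter.Eventually.of_forall fun p => ?_)
  simp only
  rw [← integral_const_mul, ← integral_const_mul]
  refine integral_congr_ae (Filter.Eventually.of_forall fun x => ?_)
  exact GG_eq_hg μ a ht p x

lemma Good.ofReal_LL_le (h : Good Δ J T Qt F M) (K : ℤ) (N : ℕ) {μ : Fin m → ℝ}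
    (hμ : ∀ k, 0 < μ k) (a : Idx m → ℕ) :
    ENNReal.ofReal ((∏ κ, μ (ix κ) ^ a κ) * |LL J T F K N μ (∑ κ, a κ) a|) ≤
      ∫⁻ t in Set.Ioc ((2:ℝ) ^ (K - N)) ((2:ℝ) ^ K), ENNReal.ofReal t⁻¹ *
        ‖∫ p, ∫ x, bb J T F t x * ∏ κ, hg (a κ) (t * μ (ix κ)) (x κ - J.mulVec p κ)‖ₑ := by
  have hp : 0 < ∏ κ, μ (ix κ) ^ a κ := Finset.prod_pos fun κ _ => pow_pos (hμ _) _
  rw [h.LL_iter K N hμ a, abs_mul, abs_of_pos (inv_pos.2 hp), mul_inv_cancel_left₀ hp.ne',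
    ← Real.enorm_eq_ofReal_abs]
  refine (enorm_integral_le_lintegral_enorm _).trans (le_of_eq ?_)
  refine setLIntegral_congr_fun measurableSet_Ioc fun t ht => ?_
  have ht0 : 0 < t := lt_trans (by positivity) ht.1
  simp only [enorm_mul]
  rw [Real.enorm_of_nonneg (inv_nonneg.2 ht0.le)]

end

/-- Monomials containing both coordinates of some index outside of `S`. -/
lemma mono_le {Δ : ℝ} (hΔ : 1 < Δ) {S : Finset (Fin m)} {l : Fin m} (hl : l ∉ S)
    (hPS : PS Δ (insert l S)) {c₀ : ℝ} (hc : 0 < c₀) {a : Idx m → ℕ}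
    (ha : ∀ ε, 1 ≤ a (lx l ε)) : ∃ C : ℝ, 0 ≤ C ∧
    ∀ (J : Matrix (Idx m) (Fin m) ℝ) (T : Set (ℤ × (Fin m → ℤ))) (Qt : ℤ × (Fin m → ℤ))
    (F : Corner m → (Fin m → ℝ) → ℝ) (M : Corner m → ℝ), Good Δ J T Qt F M → SymOn S J F →
    ∀ (N : ℕ) (μ : Fin m → ℝ) (Λ : ℝ), (∀ k ∈ S, c₀ ≤ μ k ∧ μ k ≤ Λ) → (∀ k ∉ S, μ k = Λ) →
      c₀ ≤ Λ → (∏ κ, μ (ix κ) ^ a κ) * |LL J T F Qt.1 N μ (∑ κ, a κ) a| ≤ C * Bd Qt M := by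
  choose B hB hBle using fun κ => hg_le (a κ)
  have h2 : 0 < Real.sqrt 2 := by positivity
  have h21 : 1 ≤ Real.sqrt 2 := Real.one_le_sqrt.2 (by norm_num)
  have hss : Real.sqrt 2 * Real.sqrt 2 = 2 := Real.mul_self_sqrt (by norm_num)
  obtain ⟨C, hC, hf⟩ := form_le hΔ hPS (div_pos hc h2) fun ε => a (lx l ε) - 1
  set B' : ℝ := 1 + ∑ κ, B κ with hB'
  have hsum : ∀ κ, B κ ≤ B' := fun κ => by
    have := Finset.single_le_sum (f := B) (fun κ _ => (hB κ).le) (Finset.mem_univ κ)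
    linarith
  have hB'1 : 1 ≤ B' := by
    have := Finset.sum_nonneg (s := Finset.univ) fun κ (_ : κ ∈ Finset.univ) => (hB κ).le
    linarith
  refine ⟨C * B' ^ (2 * m), by positivity, fun J T Qt F M h hS N μ Λ hμS hμn hΛ => ?_⟩
  have hμ0 : ∀ k, c₀ ≤ μ k := fun k => by
    by_cases hk : k ∈ S
    · exact (hμS k hk).1
    · rw [hμn k hk]; exact hΛ
  have hμ : ∀ k, 0 < μ k := fun k => hc.trans_le (hμ0 k)
  have hdiv : c₀ / Real.sqrt 2 ≤ c₀ := div_le_self hc.le h21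
  have key := hf J T Qt F M h hS N (fun k => 2 * μ k) (2 * Λ) (Λ / Real.sqrt 2)
    (fun k hk _ => ⟨by linarith [hμ0 k], by linarith [(hμS k hk).2]⟩)
    (fun k hk _ => by rw [hμn k hk]) (div_le_div_of_nonneg_right hΛ h2.le)
    ((div_le_self (hc.le.trans hΛ) h21).trans (by linarith))
    B' 0 (fun _ => 0) (fun κ t y => hg (a κ) (t * μ (ix κ)) y) hB'1 (fun ε => by simp)
    (fun ε => by
      funext t y
      have e1 : a (lx l ε) - 1 + 1 = a (lx l ε) := Nat.sub_add_cancel (ha ε)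
      have e2 : Real.sqrt 2 * (t * (Λ / Real.sqrt 2)) = t * Λ := by field_simp
      rw [e1, e2, ix_lx, hμn l hl]; simp)
    (fun κ _ t ht y => by
      refine (hBle κ (t * μ (ix κ)) (mul_pos ht (hμ _)) y).trans ?_
      rw [show 2 * (t * μ (ix κ)) = t * (2 * μ (ix κ)) by ring]
      exact mul_le_mul_of_nonneg_right (hsum κ) (hg_zero_nonneg
        (mul_nonneg ht.le (mul_nonneg zero_le_two (hμ _).le)) _))
  have := (h.ofReal_LL_le Qt.1 N hμ a).trans key
  rw [add_zero, one_pow, mul_one] at this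
  exact (ENNReal.ofReal_le_ofReal_iff (mul_nonneg (by positivity) h.Bd_nonneg)).1 this

lemma ofReal_integral_fiber {α β : Type*} [MeasurableSpace α] [MeasurableSpace β] {ν : Measure α}
    {ν' : Measure β} [SFinite ν] [SFinite ν'] {f : α × β → ℝ} (hf : Integrable f (ν.prod ν'))
    {g : α → ℝ≥0∞} {c : ℝ} (hc : 0 ≤ c)
    (h : ∀ᵐ a ∂ν, Integrable (fun b => f (a, b)) ν' →
      0 ≤ ∫ b, f (a, b) ∂ν' ∧ ENNReal.ofReal (c * ∫ b, f (a, b) ∂ν') = g a) :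
    0 ≤ ∫ z, f z ∂(ν.prod ν') ∧ ENNReal.ofReal (c * ∫ z, f z ∂(ν.prod ν')) = ∫⁻ a, g a ∂ν := by
  rw [integral_prod _ hf]
  have h' : ∀ᵐ a ∂ν, 0 ≤ ∫ b, f (a, b) ∂ν' ∧ ENNReal.ofReal (c * ∫ b, f (a, b) ∂ν') = g a := by
    filter_upwards [h, hf.prod_right_ae] with a ha hfa using ha hfa
  refine ⟨integral_nonneg_of_ae (h'.mono fun a ha => ha.1), ?_⟩
  rw [← integral_const_mul, ofReal_integral_eq_lintegral_ofReal (hf.integral_prod_left.const_mul c)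
    (h'.mono fun a ha => mul_nonneg hc ha.1)]
  exact lintegral_congr_ae (h'.mono fun a ha => ha.2)

section
variable {Δ : ℝ} {J : Matrix (Idx m) (Fin m) ℝ} {T : Set (ℤ × (Fin m → ℤ))}
  {Qt : ℤ × (Fin m → ℤ)} {F : Corner m → (Fin m → ℝ) → ℝ} {M : Corner m → ℝ}

lemma SymOn.symJ_eq {S : Finset (Fin m)} (hS : SymOn S J F) {k : Fin m} (hk : k ∈ S) (ε : Fin 2) :
    symJ J k ε = J := by
  funext κ q
  unfold symJ
  split_ifs with h
  · obtain ⟨ε', he⟩ := lx_surj κ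
    rw [he, h, hS.row k hk ε ε']
  · rfl

lemma SymOn.Phi_eq {S : Finset (Fin m)} (hS : SymOn S J F) {l : Fin m} (hl : l ∈ S) (k : ℤ)
    (θ : ℝ → ℝ) (x : Idx m → ℝ) : Phi J T F l 1 k θ x = Phi J T F l 0 k θ x := by
  rw [Phi_sym, hS.symJ_eq hl]
  congr 1
  funext j
  exact hS.fn l hl j 1

/-- In the symmetric case the mixed second order form is the positive form. -/
lemma Good.PY_eq (h : Good Δ J T Qt F M) {S : Finset (Fin m)} (hS : SymOn S J F) (K : ℤ) (N : ℕ)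
    {l : Fin m} (hl : l ∈ S) {μ : Fin m → ℝ} (hμ : ∀ k, 0 < μ k) :
    0 ≤ LL J T F K N μ 2 (Pi.single (lx l 0) 1 + Pi.single (lx l 1) 1) ∧
    ENNReal.ofReal (μ l ^ 2 * LL J T F K N μ 2 (Pi.single (lx l 0) 1 + Pi.single (lx l 1) 1)) =
      PY J T F K N l μ := by
  classical
  set a : Idx m → ℕ := Pi.single (lx l 0) 1 + Pi.single (lx l 1) 1 with ha
  have hne : lx l 0 ≠ lx l 1 := fun he => absurd (lx_inj he).2 (by decide)
  have ha0 : a (lx l 0) = 1 := by simp [ha]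
  have ha1 : a (lx l 1) = 1 := by simp [ha]
  have han : ∀ κ, ix κ ≠ l → a κ = 0 := fun κ hκ => by
    have : ∀ ε, κ ≠ lx l ε := fun ε he => hκ (by rw [he, ix_lx])
    rw [ha, Pi.add_apply, Pi.single_eq_of_ne (this 0), Pi.single_eq_of_ne (this 1), add_zero]
  have hsum : ∑ κ, a κ = 2 := by
    simp only [ha, Pi.add_apply, Finset.sum_add_distrib, Finset.sum_pi_single', Finset.mem_univ,
      if_true]
  have hprod : ∏ κ, μ (ix κ) ^ a κ = μ l ^ 2 := by
    simp only [ha, Pi.add_apply, pow_add, Finset.prod_mul_distrib]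
    have : ∀ ε, ∏ κ, μ (ix κ) ^ (Pi.single (lx l ε) 1 : Idx m → ℕ) κ = μ l := fun ε => by
      rw [Finset.prod_eq_single (lx l ε)]
      · simp
      · intro κ _ hκ; simp [hκ]
      · simp
    rw [this, this, sq]
  have hi := h.integrable_GG K N hμ 2 a
  have hθ : Measurable fun z : (ℝ × (Fin m → ℝ)) × ℝ =>
      hg 1 (z.1.1 * μ l) (z.2 - J.mulVec z.1.2 (lx l 0)) := by
    have := measurable_hg_mulVec J 1 (lx l 0) (μ l) 0
    simpa using this
  unfold PY
  rw [h.YY_eq K N l 0 μ hθ]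
  unfold LL
  unfold om at hi ⊢
  refine ofReal_integral_fiber hi (sq_nonneg _) ?_
  filter_upwards [ae_restrict_mem measurableSet_Ioc] with t htm hti
  have ht : 0 < t := lt_trans (by positivity) htm.1
  refine ofReal_integral_fiber hti (sq_nonneg _) (Filter.Eventually.of_forall fun p hpi => ?_)
  have hl2 : μ l ≠ 0 := (hμ l).ne'
  have e1 : ∀ x, GG J T F μ 2 a (t, p, x) = (μ l ^ 2)⁻¹ * t⁻¹ * (bk J T F (lev t) x *
      ∏ κ, hg (a κ) (t * μ (ix κ)) (x κ - J.mulVec p κ)) := fun x => by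
    have := GG_eq_hg (J := J) (T := T) (F := F) μ a ht p x
    rw [hsum, hprod] at this
    rw [this, mul_assoc]; rfl
  have hbi : Integrable fun x => bk J T F (lev t) x *
      ∏ κ, hg (a κ) (t * μ (ix κ)) (x κ - J.mulVec p κ) := by
    have := hpi.const_mul (μ l ^ 2 * t)
    refine this.congr (Filter.Eventually.of_forall fun x => ?_)
    simp only [e1]
    field_simp
  obtain ⟨hri, hre⟩ := integral_refresh_two (J := J) (T := T) (F := F) l (lev t)
    (fun κ y => hg (a κ) (t * μ (ix κ)) (y - J.mulVec p κ)) hbi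
  have e2 : ∀ x : Idx m → ℝ, (∏ κ, if ix κ = l then hg 0 1 (x κ) else
      hg (a κ) (t * μ (ix κ)) (x κ - J.mulVec p κ)) = wt J l μ t p x := fun x => by
    unfold wt
    refine Finset.prod_congr rfl fun κ _ => ?_
    split_ifs with hκ
    · rfl
    · rw [han κ hκ]
  have erow : J.mulVec p (lx l 1) = J.mulVec p (lx l 0) :=
    mulVec_row_congr (hS.row l hl 1 0) p
  simp only [e2, ha0, ha1, ix_lx, hS.Phi_eq hl, erow] at hri hre
  set Φ := fun x => Phi J T F l 0 (lev t) (fun y => hg 1 (t * μ l) (y - J.mulVec p (lx l 0))) x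
    with hΦ
  have hw : ∀ x, 0 ≤ wt J l μ t p x := wt_nonneg J l (fun k => (hμ k).le) ht.le p
  have hnn : ∀ x, 0 ≤ wt J l μ t p x * (Φ x * Φ x) := fun x =>
    mul_nonneg (hw x) (mul_self_nonneg _)
  have e3 : ∫ x, GG J T F μ 2 a (t, p, x) =
      (μ l ^ 2)⁻¹ * t⁻¹ * ∫ x, wt J l μ t p x * (Φ x * Φ x) := by
    simp only [e1]
    rw [integral_const_mul, hre]
  rw [e3]
  refine ⟨mul_nonneg (by positivity) (integral_nonneg hnn), ?_⟩
  rw [show μ l ^ 2 * ((μ l ^ 2)⁻¹ * t⁻¹ * ∫ x, wt J l μ t p x * (Φ x * Φ x)) =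
    ∫ x, t⁻¹ * (wt J l μ t p x * (Φ x * Φ x)) by rw [integral_const_mul]; field_simp,
    ofReal_integral_eq_lintegral_ofReal (hri.const_mul _)
      (Filter.Eventually.of_forall fun x => mul_nonneg (by positivity) (hnn x))]
  refine lintegral_congr fun x => ?_
  rw [← mul_assoc, ENNReal.ofReal_mul (mul_nonneg (inv_nonneg.2 ht.le) (hw x)), ← sq,
    ← Real.enorm_of_nonneg (sq_nonneg (Φ x)), enorm_pow]

end

lemma integral_hasLineDerivAt_eq_zero {f f' : (Fin m → ℝ) → ℝ} {v : Fin m → ℝ}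
    (hf : Integrable f) (hf' : Integrable f') (hd : ∀ x, HasLineDerivAt ℝ f (f' x) x v) :
    ∫ x, f' x = 0 := by
  have h := integral_bilinear_hasLineDerivAt_right_eq_neg_left_of_integrable
    (μ := (volume : Measure (Fin m → ℝ))) (f := fun _ => (1 : ℝ)) (f' := fun _ => (0 : ℝ))
    (g := f) (g' := f') (v := v) (B := ContinuousLinearMap.mul ℝ ℝ)
    (by simp) (by simpa using hf') (by simpa using hf)
    (fun x _ => hasDerivAt_const (0:ℝ) (1:ℝ))
    (fun x _ => hd x)
  simpa using h

section
variable {Δ : ℝ} {J : Matrix (Idx m) (Fin m) ℝ} {T : Set (ℤ × (Fin m → ℤ))}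
  {Qt : ℤ × (Fin m → ℤ)} {F : Corner m → (Fin m → ℝ) → ℝ} {M : Corner m → ℝ}

lemma hasLineDerivAt_GG (μ : Fin m → ℝ) (d : ℕ) (a : Idx m → ℕ) (q : Fin m) (t : ℝ)
    (x : Idx m → ℝ) (p : Fin m → ℝ) :
    HasLineDerivAt ℝ (fun p => GG J T F μ d a (t, p, x))
      (-∑ κ, J κ q * GG J T F μ d (a + Pi.single κ 1) (t, p, x)) p (Pi.single q 1) := by
  unfold HasLineDerivAt
  have hy : ∀ κ, HasDerivAt (fun s : ℝ => (x - J.mulVec (p + s • Pi.single q (1:ℝ))) κ)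
      (-J κ q) 0 := fun κ => by
    have e : (fun s : ℝ => (x - J.mulVec (p + s • Pi.single q (1:ℝ))) κ) =
        fun s => x κ - (J.mulVec p κ + s * J κ q) := by
      funext s
      simp [mulVec_add, mulVec_smul]
    rw [e]
    simpa using (((hasDerivAt_id (0:ℝ)).mul_const (J κ q)).const_add (J.mulVec p κ)).const_sub (x κ)
  have h := (hasDerivAt_Ker a (scl t μ) hy).const_mul (t ^ d * t⁻¹ * bb J T F t x)
  unfold GG
  refine h.congr_deriv ?_
  simp only [zero_smul, add_zero]
  rw [Finset.mul_sum, ← Finset.sum_neg_distrib]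
  exact Finset.sum_congr rfl fun κ _ => by ring

/-- Integration by parts in the variable `p`. -/
lemma Good.sum_LL_eq_zero (h : Good Δ J T Qt F M) (K : ℤ) (N : ℕ) {μ : Fin m → ℝ}
    (hμ : ∀ k, 0 < μ k) (d : ℕ) (a : Idx m → ℕ) (q : Fin m) :
    ∑ κ, J κ q * LL J T F K N μ d (a + Pi.single κ 1) = 0 := by
  have hi := fun κ => (h.integrable_GG K N hμ d (a + Pi.single κ 1)).const_mul (J κ q)
  have hi0 := h.integrable_GG K N hμ d a
  have hs := integrable_finsetSum Finset.univ fun κ _ => hi κ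
  have e : ∑ κ, J κ q * LL J T F K N μ d (a + Pi.single κ 1) =
      ∫ z, ∑ κ, J κ q * GG J T F μ d (a + Pi.single κ 1) z ∂(om m K N) := by
    rw [integral_finsetSum _ fun κ _ => hi κ]
    simp only [integral_const_mul, LL]
  rw [e]
  unfold om at hs hi0 ⊢
  rw [integral_prod _ hs]
  refine integral_eq_zero_of_ae ?_
  filter_upwards [hs.prod_right_ae, hi0.prod_right_ae] with t ht ht0
  refine (integral_prod_symm _ ht).trans (integral_eq_zero_of_ae ?_)
  filter_upwards [Integrable.prod_left_ae (μ := volume) (ν := volume) ht,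
    Integrable.prod_left_ae (μ := volume) (ν := volume) ht0] with x hx hx0
  have := integral_hasLineDerivAt_eq_zero hx0 hx.neg fun p => hasLineDerivAt_GG μ d a q t x p
  simp only [Pi.neg_apply, integral_neg, neg_eq_zero] at this
  exact this

/-- The linear functional on polynomials with values `LL` on monomials. -/
def Lf (J : Matrix (Idx m) (Fin m) ℝ) (T : Set (ℤ × (Fin m → ℤ)))
    (F : Corner m → (Fin m → ℝ) → ℝ) (K : ℤ) (N : ℕ) (μ : Fin m → ℝ) (d : ℕ) :
    MvPolynomial (Idx m) ℝ →ₗ[ℝ] ℝ :=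
  (MvPolynomial.basisMonomials (Idx m) ℝ).constr ℝ fun a => LL J T F K N μ d a

lemma Lf_monomial (K : ℤ) (N : ℕ) (μ : Fin m → ℝ) (d : ℕ) (a : Idx m →₀ ℕ) (c : ℝ) :
    Lf J T F K N μ d (MvPolynomial.monomial a c) = c * LL J T F K N μ d a := by
  have h := (MvPolynomial.basisMonomials (Idx m) ℝ).constr_basis ℝ
    (fun a : Idx m →₀ ℕ => LL J T F K N μ d a) a
  rw [MvPolynomial.coe_basisMonomials] at h
  have e : MvPolynomial.monomial a c = c • MvPolynomial.monomial a (1:ℝ) := by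
    rw [MvPolynomial.smul_monomial, smul_eq_mul, mul_one]
  rw [e, map_smul, smul_eq_mul]
  exact congrArg _ h

/-- Polynomials all of whose multiples are annihilated by `Lf`. -/
def Kid (J : Matrix (Idx m) (Fin m) ℝ) (T : Set (ℤ × (Fin m → ℤ)))
    (F : Corner m → (Fin m → ℝ) → ℝ) (K : ℤ) (N : ℕ) (μ : Fin m → ℝ) (d : ℕ) :
    Ideal (MvPolynomial (Idx m) ℝ) where
  carrier := {f | ∀ g, Lf J T F K N μ d (g * f) = 0}
  add_mem' := fun {f f'} hf hf' g => by rw [mul_add, map_add, hf g, hf' g, add_zero]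
  zero_mem' := fun g => by rw [mul_zero, map_zero]
  smul_mem' := fun c f hf g => by rw [smul_eq_mul, ← mul_assoc]; exact hf (g * c)

lemma mem_Kid {K : ℤ} {N : ℕ} {μ : Fin m → ℝ} {d : ℕ} {f : MvPolynomial (Idx m) ℝ} :
    f ∈ Kid J T F K N μ d ↔ ∀ g, Lf J T F K N μ d (g * f) = 0 := Iff.rfl

lemma Lf_eq_of_mk_eq {K : ℤ} {N : ℕ} {μ : Fin m → ℝ} {d : ℕ} {f g : MvPolynomial (Idx m) ℝ}
    (h : Ideal.Quotient.mk (Kid J T F K N μ d) f = Ideal.Quotient.mk (Kid J T F K N μ d) g) :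
    Lf J T F K N μ d f = Lf J T F K N μ d g := by
  have := (Ideal.Quotient.eq.1 h) 1
  rwa [one_mul, map_sub, sub_eq_zero] at this

lemma Good.row_mem (h : Good Δ J T Qt F M) (K : ℤ) (N : ℕ) {μ : Fin m → ℝ}
    (hμ : ∀ k, 0 < μ k) (d : ℕ) (q : Fin m) :
    ∑ κ, MvPolynomial.C (J κ q) * MvPolynomial.X κ ∈ Kid J T F K N μ d := by
  classical
  rw [mem_Kid]
  intro g
  induction g using MvPolynomial.induction_on' with
  | monomial a c =>
    have e : ∀ κ, MvPolynomial.monomial a c * (MvPolynomial.C (J κ q) * MvPolynomial.X κ) =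
        MvPolynomial.monomial (a + Finsupp.single κ 1) (c * J κ q) := fun κ => by
      rw [MvPolynomial.C_mul_X_eq_monomial, MvPolynomial.monomial_mul]
    rw [Finset.mul_sum, map_sum]
    simp only [e, Lf_monomial, Finsupp.coe_add, Finsupp.single_eq_pi_single, mul_assoc]
    rw [← Finset.mul_sum, h.sum_LL_eq_zero K N hμ d a q, mul_zero]
  | add f g hf hg => rw [add_mul, map_add, hf, hg, add_zero]

/-- Coefficients of the linear relations. -/
def cf (J : Matrix (Idx m) (Fin m) ℝ) (j : Corner m) : Matrix (Fin m) (Fin m) ℝ :=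
  Amat J j * (Amat J (cmp j))⁻¹

lemma Good.cf_le (hΔ : 1 < Δ) (h : Good Δ J T Qt F M) (j : Corner m) (k l : Fin m) :
    |cf J j k l| ≤ m * (Δ * (Δ * (m.factorial * Δ ^ m))) := by
  unfold cf
  rw [Matrix.mul_apply]
  refine (Finset.abs_sum_le_sum_abs _ _).trans ?_
  have : ∀ q ∈ (Finset.univ : Finset (Fin m)), |Amat J j k q * (Amat J (cmp j))⁻¹ q l| ≤
      Δ * (Δ * (m.factorial * Δ ^ m)) := fun q _ => by
    rw [abs_mul]
    exact mul_le_mul ((h.reg j).entry k q) ((h.reg (cmp j)).inv_entry hΔ q l) (abs_nonneg _)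
      (by linarith)
  refine (Finset.sum_le_sum this).trans (le_of_eq ?_)
  simp

lemma Good.cf_sym (h : Good Δ J T Qt F M) {S : Finset (Fin m)} (hS : SymOn S J F) (j : Corner m)
    {k : Fin m} (hk : k ∈ S) (l : Fin m) : cf J j k l = if k = l then 1 else 0 := by
  have e : (Amat J (cmp j) * (Amat J (cmp j))⁻¹) k l = if k = l then 1 else 0 := by
    rw [Matrix.mul_nonsing_inv _ (isUnit_iff_ne_zero.2 (h.det_ne (cmp j)))]
    simp [Matrix.one_apply]
  rw [← e]
  unfold cf
  rw [Matrix.mul_apply, Matrix.mul_apply]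
  refine Finset.sum_congr rfl fun q _ => ?_
  congr 1
  have hr : ∀ j : Corner m, Amat J j k q = J (lx k 0) q := fun j => by
    have : Amat J j k q = J (lx k (j k)) q := rfl
    rw [this, hS.row k hk (j k) 0]
  rw [hr, hr]

lemma Good.rel_mem (h : Good Δ J T Qt F M) (K : ℤ) (N : ℕ) {μ : Fin m → ℝ}
    (hμ : ∀ k, 0 < μ k) (d : ℕ) (j : Corner m) (l : Fin m) :
    MvPolynomial.X (sel (cmp j) l) + ∑ k, MvPolynomial.C (cf J j k l) * MvPolynomial.X (sel j k) ∈
      Kid J T F K N μ d := by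
  set B := (Amat J (cmp j))⁻¹ with hB
  have hmem : ∑ q, MvPolynomial.C (B q l) * ∑ κ, MvPolynomial.C (J κ q) * MvPolynomial.X κ ∈
      Kid J T F K N μ d :=
    Ideal.sum_mem _ fun q _ => Ideal.mul_mem_left _ _ (h.row_mem K N hμ d q)
  convert hmem using 1
  simp only [Finset.mul_sum]
  rw [Finset.sum_comm, sum_idx_split j, add_comm]
  have hcoef : ∀ (i : Corner m) (k : Fin m),
      ∑ q, MvPolynomial.C (B q l) * (MvPolynomial.C (J (sel i k) q) * MvPolynomial.X (sel i k)) =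
      MvPolynomial.C ((Amat J i * B) k l) * (MvPolynomial.X (sel i k) : MvPolynomial (Idx m) ℝ) := by
    intro i k
    rw [Matrix.mul_apply, map_sum, Finset.sum_mul]
    refine Finset.sum_congr rfl fun q _ => ?_
    rw [map_mul, ← mul_assoc, mul_comm (MvPolynomial.C (B q l))]
    rfl
  congr 1
  · exact Finset.sum_congr rfl fun k _ => by rw [hcoef]; rfl
  · simp only [hcoef]
    rw [hB, Matrix.mul_nonsing_inv _ (isUnit_iff_ne_zero.2 (h.det_ne (cmp j))),
      Finset.sum_eq_single l]
    · simp
    · intro k _ hk; simp [hk]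
    · simp

/-- Every variable off `S` is congruent to a combination of the variables selected by `j`. -/
lemma Good.exists_rel (hΔ : 1 < Δ) (h : Good Δ J T Qt F M) {S : Finset (Fin m)} (hS : SymOn S J F)
    (K : ℤ) (N : ℕ) {μ : Fin m → ℝ} (hμ : ∀ k, 0 < μ k) (d : ℕ) {κ : Idx m} (hκ : ix κ ∉ S)
    (j : Corner m) : ∃ c : Fin m → ℝ, (∀ k ∈ S, c k = 0) ∧
      (∀ k, |c k| ≤ 1 + m * (Δ * (Δ * (m.factorial * Δ ^ m)))) ∧
      Ideal.Quotient.mk (Kid J T F K N μ d) (MvPolynomial.X κ) = Ideal.Quotient.mk _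
        (∑ k, MvPolynomial.C (c k) * MvPolynomial.X (sel j k)) := by
  classical
  have hD : 0 ≤ m * (Δ * (Δ * (m.factorial * Δ ^ m))) := by
    have : 0 < Δ := by linarith
    positivity
  obtain ⟨ε, hε⟩ := lx_surj κ
  by_cases hj : ε = j (ix κ)
  · refine ⟨Pi.single (ix κ) 1, fun k hk => ?_, fun k => ?_, ?_⟩
    · exact Pi.single_eq_of_ne (fun he : k = ix κ => hκ (he ▸ hk)) _
    · by_cases hk : k = ix κ
      · subst hk; simpa using hD
      · rw [Pi.single_eq_of_ne hk, abs_zero]; linarith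
    · congr 1
      rw [Finset.sum_eq_single (ix κ)]
      · rw [Pi.single_eq_same, map_one, one_mul]
        congr 1
        rw [hε, hj]; simp [sel_eq]
      · intro k _ hk; rw [Pi.single_eq_of_ne hk]; simp
      · simp
  · refine ⟨fun k => -cf J j k (ix κ), fun k hk => ?_, fun k => ?_, ?_⟩
    · beta_reduce
      rw [h.cf_sym hS j hk, if_neg (fun he : k = ix κ => hκ (he ▸ hk)), neg_zero]
    · rw [abs_neg]; linarith [h.cf_le hΔ j k (ix κ)]
    · rw [Ideal.Quotient.eq]
      have hr := h.rel_mem K N hμ d j (ix κ)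
      have e : sel (cmp j) (ix κ) = κ := by
        have h1 : ε = cmp j (ix κ) := by
          unfold cmp
          exact fin2_eq_sub hj
        rw [sel_eq, ← h1, ← hε]
      rw [e] at hr
      simpa [sub_eq_add_neg] using hr

end

/-- Admissible scales: equal to the maximal value `Λ` off `S`. -/
structure Adm (S : Finset (Fin m)) (c₀ Λ : ℝ) (μ : Fin m → ℝ) : Prop where
  on : ∀ k ∈ S, c₀ ≤ μ k ∧ μ k ≤ Λ
  off : ∀ k ∉ S, μ k = Λ
  le : c₀ ≤ Λ

lemma Adm.lower {S : Finset (Fin m)} {c₀ Λ : ℝ} {μ : Fin m → ℝ} (h : Adm S c₀ Λ μ) (k : Fin m) :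
    c₀ ≤ μ k := by
  by_cases hk : k ∈ S
  · exact (h.on k hk).1
  · rw [h.off k hk]; exact h.le

lemma Adm.prod_eq {S : Finset (Fin m)} {c₀ Λ : ℝ} {μ : Fin m → ℝ} (h : Adm S c₀ Λ μ)
    {a : Idx m → ℕ} (ha : ∀ κ, ix κ ∈ S → a κ = 0) : ∏ κ, μ (ix κ) ^ a κ = Λ ^ ∑ κ, a κ := by
  rw [← Finset.prod_pow_eq_pow_sum]
  refine Finset.prod_congr rfl fun κ _ => ?_
  by_cases hκ : ix κ ∈ S
  · rw [ha κ hκ, pow_zero, pow_zero]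
  · rw [h.off _ hκ]

/-- Bound of the elementary forms of degree `d` with all derivatives off `S`. -/
def DD (Δ : ℝ) (S : Finset (Fin m)) (d : ℕ) : Prop :=
  ∀ c₀ : ℝ, 0 < c₀ → ∀ a : Idx m → ℕ, (∀ κ, ix κ ∈ S → a κ = 0) → ∑ κ, a κ = d →
    ∃ C : ℝ, 0 ≤ C ∧ ∀ (J : Matrix (Idx m) (Fin m) ℝ) (T : Set (ℤ × (Fin m → ℤ)))
    (Qt : ℤ × (Fin m → ℤ)) (F : Corner m → (Fin m → ℝ) → ℝ) (M : Corner m → ℝ),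
    Good Δ J T Qt F M → SymOn S J F → ∀ (N : ℕ) (μ : Fin m → ℝ) (Λ : ℝ), Adm S c₀ Λ μ →
      Λ ^ d * |LL J T F Qt.1 N μ d a| ≤ C * Bd Qt M

lemma exists_enum {ι : Type*} [Fintype ι] [DecidableEq ι] (d : ℕ) (a : ι → ℕ)
    (h : ∑ κ, a κ = d) : ∃ f : Fin d → ι, a = ∑ i, Pi.single (f i) 1 := by
  induction d generalizing a with
  | zero =>
    refine ⟨Fin.elim0, ?_⟩
    funext κ
    simpa using (Finset.sum_eq_zero_iff.1 h) κ (Finset.mem_univ κ)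
  | succ d ih =>
    obtain ⟨κ, -, hκ⟩ := Finset.exists_ne_zero_of_sum_ne_zero (h.trans_ne d.succ_ne_zero)
    have e : a = Pi.single κ 1 + (a - Pi.single κ 1) := by
      funext κ'
      by_cases he : κ' = κ
      · subst he
        simp only [Pi.add_apply, Pi.sub_apply, Pi.single_eq_same]
        omega
      · simp [he]
    have hs : ∑ κ', (a - Pi.single κ 1 : ι → ℕ) κ' = d := by
      have h' := h
      rw [e] at h'
      simp only [Pi.add_apply, Finset.sum_add_distrib, Finset.sum_pi_single', Finset.mem_univ,
        if_true] at h'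
      omega
    obtain ⟨f, hf⟩ := ih _ hs
    refine ⟨Fin.cons κ f, ?_⟩
    rw [Fin.sum_univ_succ, Fin.cons_zero]
    simp only [Fin.cons_succ]
    rw [← hf]
    exact e

lemma exists_enum_corner (a : Idx m → ℕ) (h : ∑ κ, a κ = 2 ^ m) :
    ∃ f : Corner m → Idx m, a = ∑ j, Pi.single (f j) 1 := by
  obtain ⟨f, hf⟩ := exists_enum _ a h
  have hc : Fintype.card (Corner m) = 2 ^ m := by simp [Corner]
  let e : Corner m ≃ Fin (2 ^ m) := Fintype.equivFinOfCardEq hc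
  refine ⟨f ∘ e, ?_⟩
  rw [hf]
  exact (e.sum_comp fun i => Pi.single (f i) 1).symm

/-- Any selection of one coordinate index per corner takes both values at some index. -/
lemma exists_collision (lam : Corner m → Fin m) :
    ∃ l, ∀ ε : Fin 2, ∃ j, lam j = l ∧ j l = ε := by
  classical
  by_contra hcon
  push Not at hcon
  set j : Corner m := fun l => if ∃ j, lam j = l ∧ j l = 0 then 1 else 0 with hj
  obtain ⟨ε, hε⟩ := hcon (lam j)
  by_cases h0 : ∃ j', lam j' = lam j ∧ j' (lam j) = 0
  · have h1 : j (lam j) = 1 := by rw [hj]; exact if_pos h0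
    obtain ⟨j', h2, h3⟩ := h0
    fin_cases ε
    · exact hε j' h2 h3
    · exact hε j rfl h1
  · have h1 : j (lam j) = 0 := by rw [hj]; exact if_neg h0
    exact h0 ⟨j, rfl, h1⟩

lemma prod_X_eq {ι : Type*} (s : Finset ι) (f : ι → Idx m) :
    ∏ i ∈ s, (MvPolynomial.X (f i) : MvPolynomial (Idx m) ℝ) =
      MvPolynomial.monomial (∑ i ∈ s, Finsupp.single (f i) 1) 1 := by
  rw [MvPolynomial.monomial_sum_one]
  rfl

lemma Lf_prod_X (J : Matrix (Idx m) (Fin m) ℝ) (T : Set (ℤ × (Fin m → ℤ)))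
    (F : Corner m → (Fin m → ℝ) → ℝ) (K : ℤ) (N : ℕ) (μ : Fin m → ℝ) (d : ℕ) {ι : Type*}
    (s : Finset ι) (f : ι → Idx m) :
    Lf J T F K N μ d (∏ i ∈ s, MvPolynomial.X (f i)) =
      LL J T F K N μ d (∑ i ∈ s, Pi.single (f i) 1) := by
  rw [prod_X_eq, Lf_monomial, one_mul]
  congr 1
  rw [Finsupp.coe_finsetSum]
  simp only [Finsupp.single_eq_pi_single]

/-- The estimate in the top degree. -/
lemma DD_top {Δ : ℝ} (hΔ : 1 < Δ) {S : Finset (Fin m)} (hPS : ∀ l ∉ S, PS Δ (insert l S)) :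
    DD Δ S (2 ^ m) := by
  classical
  intro c₀ hc a ha hsum
  obtain ⟨f, hf⟩ := exists_enum_corner a hsum
  have hfS : ∀ j, ix (f j) ∉ S := fun j hj => by
    have := ha _ hj
    rw [hf, Finset.sum_apply] at this
    have := (Finset.sum_eq_zero_iff.1 this) j (Finset.mem_univ j)
    simp at this
  set aL : (Corner m → Fin m) → Idx m → ℕ := fun lam => ∑ j, Pi.single (sel j (lam j)) 1 with haL
  have haLs : ∀ lam, ∑ κ, aL lam κ = 2 ^ m := fun lam => by
    simp only [haL, Finset.sum_apply]
    rw [Finset.sum_comm]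
    simp [Corner]
  have haLpos : ∀ lam j, 1 ≤ aL lam (sel j (lam j)) := fun lam j => by
    simp only [haL, Finset.sum_apply]
    have := Finset.single_le_sum (f := fun j' => (Pi.single (sel j' (lam j')) 1 : Idx m → ℕ)
      (sel j (lam j))) (fun _ _ => Nat.zero_le _) (Finset.mem_univ j)
    simpa using this
  have haLS : ∀ lam, (∀ j, lam j ∉ S) → ∀ κ, ix κ ∈ S → aL lam κ = 0 := fun lam hl κ hκ => by
    simp only [haL, Finset.sum_apply]
    refine Finset.sum_eq_zero fun j _ => Pi.single_eq_of_ne (fun he => hl j ?_) _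
    rw [he, ix_sel] at hκ
    exact hκ
  have hC : ∀ lam : Corner m → Fin m, ∃ C : ℝ, 0 ≤ C ∧ ((∀ j, lam j ∉ S) →
      ∀ (J : Matrix (Idx m) (Fin m) ℝ) (T : Set (ℤ × (Fin m → ℤ)))
      (Qt : ℤ × (Fin m → ℤ)) (F : Corner m → (Fin m → ℝ) → ℝ) (M : Corner m → ℝ),
      Good Δ J T Qt F M → SymOn S J F → ∀ (N : ℕ) (μ : Fin m → ℝ) (Λ : ℝ), Adm S c₀ Λ μ →
      Λ ^ (2 ^ m) * |LL J T F Qt.1 N μ (2 ^ m) (aL lam)| ≤ C * Bd Qt M) := fun lam => by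
    by_cases hl : ∀ j, lam j ∉ S
    · obtain ⟨l, hcol⟩ := exists_collision lam
      have hlS : l ∉ S := by
        obtain ⟨j, hj, -⟩ := hcol 0
        rw [← hj]; exact hl j
      obtain ⟨C, hC0, hC⟩ := mono_le hΔ hlS (hPS l hlS) hc (a := aL lam) (fun ε => by
        obtain ⟨j, hj, hjε⟩ := hcol ε
        have := haLpos lam j
        rwa [sel_eq, hj, hjε] at this)
      refine ⟨C, hC0, fun _ J T Qt F M h hS N μ Λ hA => ?_⟩
      have := hC J T Qt F M h hS N μ Λ hA.on hA.off hA.le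
      rwa [hA.prod_eq (haLS lam hl), haLs] at this
    · exact ⟨0, le_rfl, fun h => absurd h hl⟩
  choose C hC0 hC using hC
  set D : ℝ := 1 + m * (Δ * (Δ * (m.factorial * Δ ^ m))) with hD
  have hD0 : 0 ≤ D := by
    have : 0 < Δ := by linarith
    positivity
  refine ⟨∑ lam, D ^ (2 ^ m) * C lam, Finset.sum_nonneg fun lam _ =>
    mul_nonneg (by positivity) (hC0 lam), fun J T Qt F M h hS N μ Λ hA => ?_⟩
  have hμ : ∀ k, 0 < μ k := fun k => hc.trans_le (hA.lower k)
  have hΛ : 0 < Λ := hc.trans_le hA.le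
  choose c hcS hcD hcr using fun j : Corner m =>
    h.exists_rel hΔ hS Qt.1 N hμ (2 ^ m) (hfS j) j
  have e1 : LL J T F Qt.1 N μ (2 ^ m) a = Lf J T F Qt.1 N μ (2 ^ m)
      (∏ j, ∑ k, MvPolynomial.C (c j k) * MvPolynomial.X (sel j k)) := by
    rw [hf, ← Lf_prod_X]
    refine Lf_eq_of_mk_eq ?_
    rw [map_prod, map_prod]
    exact Finset.prod_congr rfl fun j _ => hcr j
  have e2 : LL J T F Qt.1 N μ (2 ^ m) a =
      ∑ lam : Corner m → Fin m, (∏ j, c j (lam j)) * LL J T F Qt.1 N μ (2 ^ m) (aL lam) := by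
    rw [e1, Finset.prod_univ_sum, map_sum, Fintype.piFinset_univ]
    refine Finset.sum_congr rfl fun lam _ => ?_
    rw [Finset.prod_mul_distrib, ← map_prod, ← MvPolynomial.smul_eq_C_mul, map_smul, Lf_prod_X,
      smul_eq_mul]
  rw [e2, Finset.sum_mul]
  calc Λ ^ (2 ^ m) * |∑ lam : Corner m → Fin m, (∏ j, c j (lam j)) *
        LL J T F Qt.1 N μ (2 ^ m) (aL lam)|
      ≤ Λ ^ (2 ^ m) * ∑ lam : Corner m → Fin m, |(∏ j, c j (lam j)) *
        LL J T F Qt.1 N μ (2 ^ m) (aL lam)| :=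
        mul_le_mul_of_nonneg_left (Finset.abs_sum_le_sum_abs _ _) (by positivity)
    _ ≤ ∑ lam, D ^ (2 ^ m) * C lam * Bd Qt M := by
        rw [Finset.mul_sum]
        refine Finset.sum_le_sum fun lam _ => ?_
        by_cases hl : ∀ j, lam j ∉ S
        · have h1 : |∏ j, c j (lam j)| ≤ D ^ (2 ^ m) := by
            rw [Finset.abs_prod]
            refine (Finset.prod_le_prod (fun _ _ => abs_nonneg _) fun j _ => hcD j (lam j)).trans
              (le_of_eq ?_)
            rw [Finset.prod_const, Finset.card_univ]
            simp [Corner, D]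
          have h2 := hC lam hl J T Qt F M h hS N μ Λ hA
          rw [abs_mul, mul_left_comm, mul_assoc]
          exact mul_le_mul h1 h2 (by positivity) (by positivity)
        · push Not at hl
          obtain ⟨j, hj⟩ := hl
          rw [Finset.prod_eq_zero (Finset.mem_univ j) (hcS j _ hj), zero_mul, abs_zero, mul_zero]
          exact mul_nonneg (mul_nonneg (by positivity) (hC0 lam)) h.Bd_nonneg

section
variable {Δ : ℝ} {J : Matrix (Idx m) (Fin m) ℝ} {T : Set (ℤ × (Fin m → ℤ))}
  {Qt : ℤ × (Fin m → ℤ)} {F : Corner m → (Fin m → ℝ) → ℝ} {M : Corner m → ℝ}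

lemma hg_zero_le_inv {r : ℝ} (hr : 0 < r) (y : ℝ) : hg 0 r y ≤ r⁻¹ := by
  unfold hg
  rw [hgs_zero]
  refine mul_le_of_le_one_right (inv_pos.2 hr).le (Real.exp_le_one_iff.2 ?_)
  nlinarith [Real.pi_pos, sq_nonneg (y / r)]

lemma exists_prod_hg_le (a : Idx m → ℕ) : ∃ C : ℝ, 0 < C ∧ ∀ (ρ : ℝ), 0 < ρ → ∀ r : Idx m → ℝ,
    (∀ κ, ρ ≤ r κ) → ∀ y : Idx m → ℝ,
      |∏ κ, hg (a κ) (r κ) (y κ)| ≤ C * (ρ⁻¹) ^ m * ∏ k, hg 0 (2 * r (sel 0 k)) (y (sel 0 k)) := by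
  choose C hC hCb using fun κ => hg_le (a κ)
  refine ⟨∏ κ, C κ, Finset.prod_pos fun κ _ => hC κ, fun ρ hρ r hr y => ?_⟩
  have hr0 : ∀ κ, 0 < r κ := fun κ => hρ.trans_le (hr κ)
  rw [Finset.abs_prod]
  refine (Finset.prod_le_prod (fun _ _ => abs_nonneg _)
    fun κ _ => hCb κ (r κ) (hr0 κ) (y κ)).trans ?_
  rw [Finset.prod_mul_distrib, mul_assoc]
  refine mul_le_mul_of_nonneg_left ?_ (Finset.prod_nonneg fun κ _ => (hC κ).le)
  rw [prod_idx_split 0, mul_comm]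
  have hnn : ∀ κ, 0 ≤ hg 0 (2 * r κ) (y κ) := fun κ =>
    hg_zero_nonneg (mul_pos two_pos (hr0 κ)).le _
  refine mul_le_mul_of_nonneg_right ?_ (Finset.prod_nonneg fun k _ => hnn _)
  refine (Finset.prod_le_prod (fun _ _ => hnn _) fun k _ => (hg_zero_le_inv
    (mul_pos two_pos (hr0 _)) _).trans ((inv_le_inv₀ (mul_pos two_pos (hr0 _)) hρ).2 ?_)).trans
    (le_of_eq ?_)
  · linarith [hr (sel (cmp 0) k)]
  · simp

lemma enorm_iter_le (hJ : (Amat J 0).det ≠ 0) {R C : ℝ} (hC : 0 ≤ C) {r : Fin m → ℝ}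
    (hr : ∀ k, 0 < r k) {f : (Fin m → ℝ) → (Idx m → ℝ) → ℝ}
    (hf : ∀ p x, |f p x| ≤ C * ((cub R).indicator (fun _ => 1) x *
      ∏ k, hg 0 (r k) (x (sel 0 k) - J.mulVec p (sel 0 k)))) :
    ‖∫ p, ∫ x, f p x‖ₑ ≤
      ENNReal.ofReal C * (volume (cub R : Set (Idx m → ℝ)) * ENNReal.ofReal |(Amat J 0).det|⁻¹) := by
  set g : (Fin m → ℝ) → (Idx m → ℝ) → ℝ≥0∞ := fun p x =>
    (cub R).indicator (fun _ => 1) x *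
      ENNReal.ofReal (∏ k, hg 0 (r k) (x (sel 0 k) - J.mulVec p (sel 0 k))) with hg'
  have hgm : Measurable (Function.uncurry g) := by
    refine ((measurable_const.indicator (measurableSet_cub R)).comp measurable_snd).mul
      (ENNReal.measurable_ofReal.comp (Finset.measurable_fun_prod _ fun k _ => ?_))
    exact (continuous_hg 0 (r k)).measurable.comp (((measurable_pi_apply _).comp
      measurable_snd).sub ((measurable_pi_apply _).comp
        ((continuous_mulVec' J).measurable.comp measurable_fst)))
  have h1 : ∀ p x, ‖f p x‖ₑ ≤ ENNReal.ofReal C * g p x := by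
    intro p x
    rw [Real.enorm_eq_ofReal_abs]
    refine (ENNReal.ofReal_le_ofReal (hf p x)).trans (le_of_eq ?_)
    rw [ENNReal.ofReal_mul hC]
    congr 1
    by_cases hx : x ∈ cub R
    · simp [hg', hx]
    · simp [hg', hx]
  calc ‖∫ p, ∫ x, f p x‖ₑ ≤ ∫⁻ p, (∫⁻ x, ENNReal.ofReal C * g p x) :=
        (enorm_integral_le_lintegral_enorm _).trans (lintegral_mono fun p =>
          (enorm_integral_le_lintegral_enorm _).trans (lintegral_mono fun x => h1 p x))
    _ = ∫⁻ x, (∫⁻ p, ENNReal.ofReal C * g p x) :=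
        lintegral_lintegral_swap (hgm.const_mul _).aemeasurable
    _ = ∫⁻ x, ENNReal.ofReal C * ((cub R).indicator (fun _ => 1) x *
          ENNReal.ofReal |(Amat J 0).det|⁻¹) := by
        refine lintegral_congr fun x => ?_
        have hgx : Measurable fun p => g p x := hgm.comp (measurable_id.prodMk measurable_const)
        have hgx' : Measurable fun p : Fin m → ℝ =>
            ENNReal.ofReal (∏ k, hg 0 (r k) (x (sel 0 k) - J.mulVec p (sel 0 k))) := by
          refine ENNReal.measurable_ofReal.comp (Finset.measurable_fun_prod _ fun k _ => ?_)
          exact (continuous_hg 0 (r k)).measurable.comp (measurable_const.sub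
            ((measurable_pi_apply _).comp (continuous_mulVec' J).measurable))
        rw [lintegral_const_mul _ hgx, hg']
        simp only
        rw [lintegral_const_mul _ hgx']
        congr 2
        have := lintegral_prod_sub_mulVec hJ (fun k => hg 0 (r k))
          (fun k => integrable_hg 0 (hr k)) (fun k => continuous_hg 0 (r k))
          (fun k y => hg_zero_nonneg (hr k).le y) (proj 0 x)
        simp only [integral_hg_zero (hr _), Finset.prod_const_one, ENNReal.ofReal_one,
          mul_one] at this
        exact this
    _ = _ := by
        have hi : Measurable ((cub R).indicator (fun _ => (1:ℝ≥0∞)) : (Idx m → ℝ) → ℝ≥0∞) :=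
          measurable_const.indicator (measurableSet_cub R)
        rw [lintegral_const_mul _ (hi.mul_const _), lintegral_mul_const _ hi,
          lintegral_indicator_const (measurableSet_cub R), one_mul]

/-- A qualitative bound of the elementary forms for large scales. -/
lemma Good.LL_crude (h : Good Δ J T Qt F M) (K : ℤ) (N : ℕ) {c₀ : ℝ} (hc : 0 < c₀)
    (a : Idx m → ℕ) : ∃ B : ℝ, 0 ≤ B ∧ ∀ μ : Fin m → ℝ, (∀ k, c₀ ≤ μ k) →
      (∏ κ, μ (ix κ) ^ a κ) * |LL J T F K N μ (∑ κ, a κ) a| ≤ B := by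
  obtain ⟨R, hR, hb⟩ := h.bb_le
  obtain ⟨C, hC, hCb⟩ := exists_prod_hg_le (m := m) a
  set ρ : ℝ := (2:ℝ) ^ (K - N) * c₀ with hρ
  have hρ0 : 0 < ρ := by positivity
  set D : ℝ := R * (C * (ρ⁻¹) ^ m) with hD
  have hD0 : 0 ≤ D := by positivity
  set E : ℝ≥0∞ := ENNReal.ofReal D *
    (volume (cub R : Set (Idx m → ℝ)) * ENNReal.ofReal |(Amat J 0).det|⁻¹) with hE
  have hEt : E ≠ ⊤ := by
    rw [hE]
    exact ENNReal.mul_ne_top ENNReal.ofReal_ne_top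
      (ENNReal.mul_ne_top (volume_cub_lt_top R).ne ENNReal.ofReal_ne_top)
  set W : ℝ≥0∞ := ∫⁻ t in Set.Ioc ((2:ℝ) ^ (K - N)) ((2:ℝ) ^ K),
    ENNReal.ofReal ((2:ℝ) ^ (K - N))⁻¹ * E with hW
  have hWt : W ≠ ⊤ := by
    rw [hW, setLIntegral_const]
    exact ENNReal.mul_ne_top (ENNReal.mul_ne_top ENNReal.ofReal_ne_top hEt) (by simp)
  refine ⟨W.toReal, ENNReal.toReal_nonneg, fun μ hμ => ?_⟩
  have hμ0 : ∀ k, 0 < μ k := fun k => hc.trans_le (hμ k)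
  rw [← ENNReal.ofReal_le_iff_le_toReal hWt]
  refine (h.ofReal_LL_le K N hμ0 a).trans ?_
  rw [hW]
  refine setLIntegral_mono measurable_const fun t ht => ?_
  have ht0 : 0 < t := lt_trans (by positivity) ht.1
  have hrκ : ∀ k, ρ ≤ t * μ k := fun k =>
    mul_le_mul ht.1.le (hμ k) hc.le ht0.le
  refine mul_le_mul' (ENNReal.ofReal_le_ofReal ((inv_le_inv₀ ht0 (by positivity)).2 ht.1.le)) ?_
  rw [hE]
  refine enorm_iter_le (h.det_ne 0) hD0 (r := fun k => 2 * (t * μ k))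
    (fun k => mul_pos two_pos (mul_pos ht0 (hμ0 k))) fun p x => ?_
  rw [abs_mul]
  have e2 := hCb ρ hρ0 (fun κ => t * μ (ix κ)) (fun κ => hrκ _) (fun κ => x κ - J.mulVec p κ)
  simp only [ix_sel] at e2
  refine (mul_le_mul (hb t x) e2 (abs_nonneg _) ((abs_nonneg _).trans (hb t x))).trans
    (le_of_eq ?_)
  rw [hD]; ring

end

/-- The scale vector equal to `μ` on `S` and to `s` off `S`. -/
def extS (S : Finset (Fin m)) (μ : Fin m → ℝ) (s : ℝ) : Fin m → ℝ :=
  fun k => if k ∈ S then μ k else s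

/-- Derivative of `extS` along a coordinate. -/
def offS (S : Finset (Fin m)) (κ : Idx m) : ℝ := if ix κ ∈ S then 0 else 1

lemma offS_nonneg (S : Finset (Fin m)) (κ : Idx m) : 0 ≤ offS S κ := by
  unfold offS; split_ifs <;> norm_num

lemma offS_le_one (S : Finset (Fin m)) (κ : Idx m) : offS S κ ≤ 1 := by
  unfold offS; split_ifs <;> norm_num

section
variable {Δ : ℝ} {J : Matrix (Idx m) (Fin m) ℝ} {T : Set (ℤ × (Fin m → ℤ))}
  {Qt : ℤ × (Fin m → ℤ)} {F : Corner m → (Fin m → ℝ) → ℝ} {M : Corner m → ℝ}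

lemma hasDerivAt_GG (S : Finset (Fin m)) {μ : Fin m → ℝ} (hμ : ∀ k, 0 < μ k) (d : ℕ)
    (a : Idx m → ℕ) {z : ℝ × (Fin m → ℝ) × (Idx m → ℝ)} (hz : 0 < z.1) {s : ℝ} (hs : 0 < s) :
    HasDerivAt (fun s => GG J T F (extS S μ s) d a z)
      (∑ κ, offS S κ * (s / (2 * Real.pi)) *
        GG J T F (extS S μ s) (d + 2) (a + Pi.single κ 2) z) s := by
  have hd : ∀ κ : Idx m, HasDerivAt (fun s => scl z.1 (extS S μ s) κ) (z.1 * offS S κ) s := by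
    intro κ
    unfold scl extS offS
    by_cases hκ : ix κ ∈ S
    · simp only [hκ, if_true, mul_zero]; exact hasDerivAt_const _ _
    · simp only [hκ, if_false]
      exact (hasDerivAt_id s).const_mul z.1
  have h0 : ∀ κ : Idx m, scl z.1 (extS S μ s) κ ≠ 0 := by
    intro κ
    unfold scl extS
    split_ifs
    · exact (mul_pos hz (hμ _)).ne'
    · exact (mul_pos hz hs).ne'
  have := (hasDerivAt_Ker_scale a (r := fun s => scl z.1 (extS S μ s)) (z.2.2 - J.mulVec z.2.1)
    hd h0).const_mul (z.1 ^ d * z.1⁻¹ * bb J T F z.1 z.2.2)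
  refine this.congr_deriv ?_
  rw [Finset.mul_sum]
  refine Finset.sum_congr rfl fun κ _ => ?_
  unfold GG offS
  by_cases hκ : ix κ ∈ S
  · simp [hκ]
  · have : scl z.1 (extS S μ s) κ = z.1 * s := by simp [scl, extS, hκ]
    rw [if_neg hκ, this]
    ring

lemma Good.hasDerivAt_LL (h : Good Δ J T Qt F M) (K : ℤ) (N : ℕ) (S : Finset (Fin m))
    {μ : Fin m → ℝ} (hμ : ∀ k, 0 < μ k) (d : ℕ) (a : Idx m → ℕ) {s : ℝ} (hs : 0 < s) :
    HasDerivAt (fun s => LL J T F K N (extS S μ s) d a)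
      (∑ κ, offS S κ * (s / (2 * Real.pi)) *
        LL J T F K N (extS S μ s) (d + 2) (a + Pi.single κ 2)) s := by
  obtain ⟨c₀, c₁, h0, h01, hc⟩ := exists_bounds μ hμ
  have hext : ∀ s' ∈ Set.Ioo (s / 2) (2 * s), ∀ k,
      min c₀ (s / 2) ≤ extS S μ s' k ∧ extS S μ s' k ≤ max c₁ (2 * s) := by
    intro s' hs' k
    unfold extS
    split_ifs
    · exact ⟨(min_le_left _ _).trans (hc k).1, (hc k).2.trans (le_max_left _ _)⟩
    · exact ⟨(min_le_right _ _).trans hs'.1.le, hs'.2.le.trans (le_max_right _ _)⟩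
  have hpos : ∀ s', 0 < s' → ∀ k, 0 < extS S μ s' k := by
    intro s' hs' k
    unfold extS
    split_ifs
    exacts [hμ k, hs']
  have hm0 : 0 < min c₀ (s / 2) := lt_min h0 (by positivity)
  have hmM : min c₀ (s / 2) ≤ max c₁ (2 * s) :=
    (min_le_left _ _).trans (h01.trans (le_max_left _ _))
  choose C R c hcp hC hdom using fun κ : Idx m => h.GG_dom (d + 2) (a + Pi.single κ 2) hm0 hmM
    (t₀ := (2:ℝ) ^ (K - N)) (t₁ := (2:ℝ) ^ K) (by positivity) (two_zpow_le K N)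
  set W : ℝ → ℝ × (Fin m → ℝ) × (Idx m → ℝ) → ℝ := fun s z =>
    ∑ κ, offS S κ * (s / (2 * Real.pi)) *
      GG J T F (extS S μ s) (d + 2) (a + Pi.single κ 2) z with hW
  set B : ℝ × (Fin m → ℝ) × (Idx m → ℝ) → ℝ := fun z =>
    ∑ κ, (2 * s / (2 * Real.pi)) * (C κ * dom J (c κ) (R κ) z.2) with hB
  have hae : ∀ᵐ z ∂(om m K N), (2:ℝ) ^ (K - N) ≤ z.1 ∧ z.1 ≤ (2:ℝ) ^ K :=
    Measure.quasiMeasurePreserving_fst.ae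
      (ae_scale (P := fun t => (2:ℝ) ^ (K - N) ≤ t ∧ t ≤ (2:ℝ) ^ K) fun t ht ht' => ⟨ht, ht'⟩)
  have hWm : Measurable (W s) :=
    Finset.measurable_sum _ fun κ _ => (h.measurable_GG _ _ _).const_mul _
  have hWb : ∀ᵐ z ∂(om m K N), ∀ s' ∈ Set.Ioo (s / 2) (2 * s), ‖W s' z‖ ≤ B z := by
    filter_upwards [hae] with z hz s' hs'
    have hs0 : 0 < s' := lt_trans (by positivity) hs'.1
    rw [hB, hW]
    refine (norm_sum_le _ _).trans (Finset.sum_le_sum fun κ _ => ?_)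
    rw [Real.norm_eq_abs, abs_mul, abs_of_nonneg (mul_nonneg (offS_nonneg S κ) (by positivity))]
    refine mul_le_mul ?_ (hdom κ _ (hext s' hs') z.1 hz.1 hz.2 z.2) (abs_nonneg _) (by positivity)
    refine (mul_le_of_le_one_left (by positivity) (offS_le_one S κ)).trans ?_
    gcongr
    exact hs'.2.le
  have hWd : ∀ᵐ z ∂(om m K N), ∀ s' ∈ Set.Ioo (s / 2) (2 * s),
      HasDerivAt (fun s => GG J T F (extS S μ s) d a z) (W s' z) s' := by
    filter_upwards [hae] with z hz s' hs'
    exact hasDerivAt_GG S hμ d a (lt_of_lt_of_le (by positivity) hz.1)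
      (lt_trans (by positivity) hs'.1)
  have hBi : Integrable B (om m K N) :=
    integrable_finsetSum _ fun κ _ =>
      (((integrable_dom (h.det_ne 0) (hcp κ) (R κ)).comp_snd _).const_mul _).const_mul _
  have hi0 : Integrable (GG J T F (extS S μ s) d a) (om m K N) :=
    h.integrable_GG K N (hpos s hs) d a
  have hnh : Set.Ioo (s / 2) (2 * s) ∈ nhds s := Ioo_mem_nhds (by linarith) (by linarith)
  have hm1 : ∀ᶠ s in nhds s, AEStronglyMeasurable (GG J T F (extS S μ s) d a) (om m K N) :=
    Filter.Eventually.of_forall fun s => (h.measurable_GG _ d a).aestronglyMeasurable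
  have hfin : ∫ z, W s z ∂(om m K N) = ∑ κ, offS S κ * (s / (2 * Real.pi)) *
        LL J T F K N (extS S μ s) (d + 2) (a + Pi.single κ 2) := by
    rw [hW]
    simp only
    rw [integral_finsetSum _ fun κ _ => (h.integrable_GG K N (hpos s hs) _ _).const_mul _]
    refine Finset.sum_congr rfl fun κ _ => ?_
    rw [integral_const_mul, LL]
  rw [← hfin]
  clear_value W B
  exact (hasDerivAt_integral_of_dominated_loc_of_deriv_le hnh hm1 hi0 hWm.aestronglyMeasurable
    hWb hBi hWd).2

end

lemma le_of_deriv_decay {φ φ' : ℝ → ℝ} {Λ C B : ℝ} {d : ℕ} (hd : 1 ≤ d) (hΛ : 0 < Λ)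
    (hφ : ∀ s, Λ ≤ s → HasDerivAt φ (φ' s) s)
    (hφ' : ∀ s, Λ ≤ s → s ^ (d + 2) * |φ' s| ≤ C * s) (hB : ∀ s, Λ ≤ s → s ^ d * |φ s| ≤ B) :
    Λ ^ d * φ Λ ≤ C / d := by
  have hd0 : (0:ℝ) < d := by exact_mod_cast hd
  set ψ : ℝ → ℝ := fun s => φ s - C / d * (s ^ d)⁻¹ with hψ
  have hmono : MonotoneOn ψ (Set.Ici Λ) := by
    have hder : ∀ s, Λ ≤ s → HasDerivAt ψ (φ' s - C / d * (-(d * s ^ (d - 1)) / (s ^ d) ^ 2)) s := by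
      intro s hs
      have hs0 : 0 < s := hΛ.trans_le hs
      exact (hφ s hs).sub (((hasDerivAt_pow d s).fun_inv (pow_pos hs0 d).ne').const_mul _)
    refine monotoneOn_of_deriv_nonneg (convex_Ici Λ)
      (fun s hs => (hder s hs).continuousAt.continuousWithinAt)
      (fun s hs => (hder s (interior_subset hs)).differentiableAt.differentiableWithinAt) ?_
    intro s hs
    have hs' : Λ ≤ s := interior_subset hs
    have hs0 : 0 < s := hΛ.trans_le hs'
    rw [(hder s hs').deriv]
    have e : C / d * (-(d * s ^ (d - 1)) / (s ^ d) ^ 2) = -(C * s / s ^ (d + 2)) := by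
      obtain ⟨e, rfl⟩ : ∃ e, d = e + 1 := ⟨d - 1, by omega⟩
      have : ((e + 1 : ℕ) : ℝ) ≠ 0 := hd0.ne'
      simp only [Nat.add_sub_cancel]
      field_simp
      ring
    have h2 : |φ' s| ≤ C * s / s ^ (d + 2) := by
      rw [le_div_iff₀ (by positivity), mul_comm]; exact hφ' s hs'
    rw [e]
    have := neg_abs_le (φ' s)
    linarith
  have hinv : Filter.Tendsto (fun s : ℝ => (s ^ d)⁻¹) Filter.atTop (nhds 0) :=
    (Filter.tendsto_pow_atTop (by omega)).inv_tendsto_atTop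
  have hφ0 : Filter.Tendsto φ Filter.atTop (nhds 0) := by
    refine squeeze_zero_norm' ?_ (by simpa using hinv.const_mul B)
    filter_upwards [Filter.eventually_ge_atTop Λ] with s hs
    have hs0 : 0 < s := hΛ.trans_le hs
    rw [Real.norm_eq_abs, ← div_eq_mul_inv, le_div_iff₀ (by positivity), mul_comm]
    exact hB s hs
  have hlim : Filter.Tendsto ψ Filter.atTop (nhds 0) := by
    simpa using hφ0.sub (hinv.const_mul (C / d))
  have hle : ψ Λ ≤ 0 := by
    refine ge_of_tendsto hlim ?_
    filter_upwards [Filter.eventually_ge_atTop Λ] with s hs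
    exact hmono Set.self_mem_Ici hs hs
  have hp : 0 < Λ ^ d := pow_pos hΛ d
  have h3 : Λ ^ d * ψ Λ ≤ 0 := mul_nonpos_of_nonneg_of_nonpos hp.le hle
  rw [hψ] at h3
  simp only at h3
  rw [mul_sub, mul_left_comm, mul_inv_cancel₀ hp.ne', mul_one] at h3
  linarith

lemma DD_descent {Δ : ℝ} {S : Finset (Fin m)} {d : ℕ} (hd : 1 ≤ d) (hD : DD Δ S (d + 2)) :
    DD Δ S d := by
  intro c₀ hc a ha hsum
  have key : ∀ κ : Idx m, ∃ C : ℝ, 0 ≤ C ∧ (ix κ ∉ S →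
      ∀ (J : Matrix (Idx m) (Fin m) ℝ) (T : Set (ℤ × (Fin m → ℤ)))
      (Qt : ℤ × (Fin m → ℤ)) (F : Corner m → (Fin m → ℝ) → ℝ) (M : Corner m → ℝ),
      Good Δ J T Qt F M → SymOn S J F → ∀ (N : ℕ) (μ : Fin m → ℝ) (Λ : ℝ), Adm S c₀ Λ μ →
      Λ ^ (d + 2) * |LL J T F Qt.1 N μ (d + 2) (a + Pi.single κ 2)| ≤ C * Bd Qt M) := by
    intro κ
    by_cases hκ : ix κ ∈ S
    · exact ⟨0, le_rfl, fun hn => absurd hκ hn⟩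
    · obtain ⟨C, hC, hb⟩ := hD c₀ hc (a + Pi.single κ 2) (fun κ' hκ' => by
        have : κ' ≠ κ := fun he => hκ (he ▸ hκ')
        simp [ha κ' hκ', this]) (by
        simp [Finset.sum_add_distrib, hsum])
      exact ⟨C, hC, fun _ => hb⟩
  choose C hC hb using key
  refine ⟨(∑ κ, C κ / (2 * Real.pi)) / d, by
    have : 0 ≤ ∑ κ, C κ / (2 * Real.pi) := Finset.sum_nonneg fun κ _ =>
      div_nonneg (hC κ) (by positivity)
    positivity, ?_⟩
  intro J T Qt F M h hS N μ Λ hA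
  have hΛ : 0 < Λ := hc.trans_le hA.le
  have hμ : ∀ k, 0 < μ k := fun k => hc.trans_le (hA.lower k)
  have hAs : ∀ s, Λ ≤ s → Adm S c₀ s (extS S μ s) := by
    intro s hs
    refine ⟨fun k hk => ?_, fun k hk => ?_, hA.le.trans hs⟩
    · simp only [extS, hk, if_true]
      exact ⟨(hA.on k hk).1, (hA.on k hk).2.trans hs⟩
    · simp [extS, hk]
  have hΛμ : extS S μ Λ = μ := by
    funext k
    unfold extS
    split_ifs with hk
    · rfl
    · exact (hA.off k hk).symm
  obtain ⟨B, hB0, hB⟩ := h.LL_crude Qt.1 N hc a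
  have hB' : ∀ s, Λ ≤ s → s ^ d * |LL J T F Qt.1 N (extS S μ s) d a| ≤ B := by
    intro s hs
    have := hB (extS S μ s) fun k => (hAs s hs).lower k
    rwa [(hAs s hs).prod_eq ha, hsum] at this
  set φ' : ℝ → ℝ := fun s => ∑ κ, offS S κ * (s / (2 * Real.pi)) *
        LL J T F Qt.1 N (extS S μ s) (d + 2) (a + Pi.single κ 2) with hφ'
  have hφb : ∀ s, Λ ≤ s → s ^ (d + 2) * |φ' s| ≤
      ((∑ κ, C κ / (2 * Real.pi)) * Bd Qt M) * s := by
    intro s hs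
    have hs0 : 0 < s := hΛ.trans_le hs
    rw [hφ', Finset.sum_mul, Finset.sum_mul]
    refine (mul_le_mul_of_nonneg_left (Finset.abs_sum_le_sum_abs _ _) (by positivity)).trans ?_
    rw [Finset.mul_sum]
    refine Finset.sum_le_sum fun κ _ => ?_
    by_cases hκ : ix κ ∈ S
    · have := h.Bd_nonneg
      have := hC κ
      simp only [offS, hκ, if_true, zero_mul, abs_zero, mul_zero]
      positivity
    · have h1 := hb κ hκ J T Qt F M h hS N _ s (hAs s hs)
      simp only [offS, hκ, if_false, one_mul]
      rw [abs_mul, abs_of_pos (by positivity)]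
      calc s ^ (d + 2) * (s / (2 * Real.pi) *
            |LL J T F Qt.1 N (extS S μ s) (d + 2) (a + Pi.single κ 2)|)
          = s / (2 * Real.pi) * (s ^ (d + 2) *
            |LL J T F Qt.1 N (extS S μ s) (d + 2) (a + Pi.single κ 2)|) := by ring
        _ ≤ s / (2 * Real.pi) * (C κ * Bd Qt M) :=
            mul_le_mul_of_nonneg_left h1 (by positivity)
        _ = _ := by ring
  have hder : ∀ s, Λ ≤ s → HasDerivAt (fun s => LL J T F Qt.1 N (extS S μ s) d a) (φ' s) s :=
    fun s hs => h.hasDerivAt_LL Qt.1 N S hμ d a (hΛ.trans_le hs)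
  have h1 := le_of_deriv_decay hd hΛ hder hφb hB'
  have h2 := le_of_deriv_decay hd hΛ (fun s hs => (hder s hs).fun_neg)
    (fun s hs => by rw [abs_neg]; exact hφb s hs) (fun s hs => by rw [abs_neg]; exact hB' s hs)
  simp only [hΛμ] at h1 h2
  rw [mul_comm, ← le_div_iff₀ (by positivity)]
  rw [mul_comm, ← le_div_iff₀ (by positivity)] at h1 h2
  rw [div_mul_eq_mul_div]
  exact abs_le'.2 ⟨h1, h2⟩

lemma DD_two {Δ : ℝ} (hΔ : 1 < Δ) (hm : 1 ≤ m) {S : Finset (Fin m)}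
    (hPS : ∀ l ∉ S, PS Δ (insert l S)) : DD Δ S 2 := by
  have h1 : ∀ i : ℕ, DD Δ S (2 + 2 * i) → DD Δ S 2 := by
    intro i
    induction i with
    | zero => exact id
    | succ i ih => exact fun h => ih (DD_descent (by omega) h)
  have h2 := DD_top hΔ hPS
  obtain ⟨n, rfl⟩ : ∃ n, m = n + 1 := ⟨m - 1, by omega⟩
  have h3 : 2 ^ (n + 1) = 2 + 2 * (2 ^ n - 1) := by
    have := Nat.one_le_two_pow (n := n)
    rw [pow_succ]; omega
  rw [h3] at h2
  exact h1 _ h2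

section
variable {Δ : ℝ} {J : Matrix (Idx m) (Fin m) ℝ} {T : Set (ℤ × (Fin m → ℤ))}
  {Qt : ℤ × (Fin m → ℤ)} {F : Corner m → (Fin m → ℝ) → ℝ} {M : Corner m → ℝ}

lemma Lf_X_mul_X (K : ℤ) (N : ℕ) (μ : Fin m → ℝ) (d : ℕ) (κ κ' : Idx m) :
    Lf J T F K N μ d (MvPolynomial.X κ * MvPolynomial.X κ') =
      LL J T F K N μ d (Pi.single κ 1 + Pi.single κ' 1) := by
  have := Lf_prod_X J T F K N μ d (Finset.univ : Finset (Fin 2)) ![κ, κ']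
  simpa [Fin.prod_univ_two, Fin.sum_univ_two] using this

/-- On a symmetric index the two squares cancel up to the mixed term and terms off `S`. -/
lemma Good.square_rel (h : Good Δ J T Qt F M) {S : Finset (Fin m)} (hS : SymOn S J F) (K : ℤ)
    (N : ℕ) {μ : Fin m → ℝ} (hμ : ∀ k, 0 < μ k) (d : ℕ) {k : Fin m} (hk : k ∈ S) :
    LL J T F K N μ d (Pi.single (lx k 0) 2) + LL J T F K N μ d (Pi.single (lx k 1) 2) +
      2 * LL J T F K N μ d (Pi.single (lx k 0) 1 + Pi.single (lx k 1) 1) =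
    ∑ q, ∑ q', (if q ∈ S then 0 else cf J 0 q k) * (if q' ∈ S then 0 else cf J 0 q' k) *
      LL J T F K N μ d (Pi.single (lx q 0) 1 + Pi.single (lx q' 0) 1) := by
  set c : Fin m → ℝ := fun q => if q ∈ S then 0 else cf J 0 q k with hc
  set Y : MvPolynomial (Idx m) ℝ := ∑ q, MvPolynomial.C (c q) * MvPolynomial.X (lx q 0) with hY
  have hrel := h.rel_mem K N hμ d 0 k
  have e1 : (MvPolynomial.X (sel (cmp 0) k) + ∑ q, MvPolynomial.C (cf J 0 q k) *
      MvPolynomial.X (sel 0 q) : MvPolynomial (Idx m) ℝ) =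
      MvPolynomial.X (lx k 1) + MvPolynomial.X (lx k 0) + Y := by
    rw [add_assoc]
    congr 1
    have : ∀ q, (MvPolynomial.C (cf J 0 q k) * MvPolynomial.X (sel 0 q) :
        MvPolynomial (Idx m) ℝ) = (if q = k then MvPolynomial.X (lx k 0) else 0) +
        MvPolynomial.C (c q) * MvPolynomial.X (lx q 0) := by
      intro q
      have hsq : sel 0 q = lx q 0 := rfl
      rw [hsq]
      by_cases hq : q ∈ S
      · rw [h.cf_sym hS 0 hq k]
        by_cases hqk : q = k
        · subst hqk; simp [hc, hk]
        · simp [hc, hq, hqk]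
      · have hqk : q ≠ k := fun he => hq (he ▸ hk)
        simp [hc, hq, hqk]
    rw [Finset.sum_congr rfl fun q _ => this q, Finset.sum_add_distrib]
    simp [hY]
  rw [e1] at hrel
  have hmk : Ideal.Quotient.mk (Kid J T F K N μ d)
      ((MvPolynomial.X (lx k 0) + MvPolynomial.X (lx k 1)) *
        (MvPolynomial.X (lx k 0) + MvPolynomial.X (lx k 1))) =
      Ideal.Quotient.mk (Kid J T F K N μ d) (Y * Y) := by
    rw [Ideal.Quotient.eq]
    have := Ideal.mul_mem_left _
      (MvPolynomial.X (lx k 1) + MvPolynomial.X (lx k 0) - Y) hrel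
    convert this using 1
    ring
  have hL := Lf_eq_of_mk_eq hmk
  have hl : Lf J T F K N μ d ((MvPolynomial.X (lx k 0) + MvPolynomial.X (lx k 1)) *
        (MvPolynomial.X (lx k 0) + MvPolynomial.X (lx k 1))) =
      LL J T F K N μ d (Pi.single (lx k 0) 2) + LL J T F K N μ d (Pi.single (lx k 1) 2) +
      2 * LL J T F K N μ d (Pi.single (lx k 0) 1 + Pi.single (lx k 1) 1) := by
    rw [add_mul, mul_add, mul_add, mul_comm (MvPolynomial.X (lx k 1)) (MvPolynomial.X (lx k 0)),
      map_add, map_add, map_add]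
    simp only [Lf_X_mul_X]
    rw [← Pi.single_add, ← Pi.single_add]
    ring
  have hr : Lf J T F K N μ d (Y * Y) = ∑ q, ∑ q', c q * c q' *
      LL J T F K N μ d (Pi.single (lx q 0) 1 + Pi.single (lx q' 0) 1) := by
    rw [hY, Finset.sum_mul_sum, map_sum]
    refine Finset.sum_congr rfl fun q _ => ?_
    rw [map_sum]
    refine Finset.sum_congr rfl fun q' _ => ?_
    have : (MvPolynomial.C (c q) * MvPolynomial.X (lx q 0) *
        (MvPolynomial.C (c q') * MvPolynomial.X (lx q' 0)) : MvPolynomial (Idx m) ℝ) =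
        (c q * c q') • (MvPolynomial.X (lx q 0) * MvPolynomial.X (lx q' 0)) := by
      rw [MvPolynomial.smul_eq_C_mul, map_mul]; ring
    rw [this, map_smul, Lf_X_mul_X, smul_eq_mul]
  rw [← hl, ← hr, hL]

end

lemma PS_step {Δ : ℝ} (hΔ : 1 < Δ) (hm : 1 ≤ m) {S : Finset (Fin m)}
    (hPS : ∀ l ∉ S, PS Δ (insert l S)) : PS Δ S := by
  have hDD := DD_two hΔ hm hPS
  intro c₀ hc
  obtain ⟨C₀, hC₀, htel⟩ := telescope_bound hm hΔ hc
  have key : ∀ κ κ' : Idx m, ∃ C : ℝ, 0 ≤ C ∧ (ix κ ∉ S → ix κ' ∉ S →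
      ∀ (J : Matrix (Idx m) (Fin m) ℝ) (T : Set (ℤ × (Fin m → ℤ)))
      (Qt : ℤ × (Fin m → ℤ)) (F : Corner m → (Fin m → ℝ) → ℝ) (M : Corner m → ℝ),
      Good Δ J T Qt F M → SymOn S J F → ∀ (N : ℕ) (μ : Fin m → ℝ) (Λ : ℝ), Adm S c₀ Λ μ →
      Λ ^ 2 * |LL J T F Qt.1 N μ 2 (Pi.single κ 1 + Pi.single κ' 1)| ≤ C * Bd Qt M) := by
    intro κ κ'
    by_cases hκ : ix κ ∉ S ∧ ix κ' ∉ S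
    · obtain ⟨C, hC, hb⟩ := hDD c₀ hc (Pi.single κ 1 + Pi.single κ' 1) (fun q hq => by
        have h1 : q ≠ κ := fun he => hκ.1 (he ▸ hq)
        have h2 : q ≠ κ' := fun he => hκ.2 (he ▸ hq)
        simp [h1, h2]) (by simp [Finset.sum_add_distrib])
      exact ⟨C, hC, fun _ _ => hb⟩
    · exact ⟨0, le_rfl, fun h1 h2 => absurd ⟨h1, h2⟩ hκ⟩
  choose C hC hb using key
  set D : ℝ := m * (Δ * (Δ * (m.factorial * Δ ^ m))) with hD
  have hD0 : 0 ≤ D := by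
    have : 0 < Δ := by linarith
    positivity
  set G₁ : ℝ := ∑ q : Fin m, ∑ q' : Fin m, D ^ 2 * C (lx q 0) (lx q' 0) with hG₁
  have hG₁0 : 0 ≤ G₁ := Finset.sum_nonneg fun q _ => Finset.sum_nonneg fun q' _ =>
    mul_nonneg (sq_nonneg _) (hC _ _)
  set G₂ : ℝ := ∑ κ : Idx m, C κ κ with hG₂
  have hG₂0 : 0 ≤ G₂ := Finset.sum_nonneg fun κ _ => hC _ _
  refine ⟨m * (G₁ + 2 * G₂) + 2 * Real.pi * C₀, by positivity, ?_⟩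
  intro J T Qt F M h hS N i hi μ Λ hon hoff hle
  have hA : Adm S c₀ Λ μ := ⟨hon, hoff, hle⟩
  have hΛ : 0 < Λ := hc.trans_le hle
  have hμ : ∀ k, 0 < μ k := fun k => hc.trans_le (hA.lower k)
  have hBd := h.Bd_nonneg
  rw [← (h.PY_eq hS Qt.1 N hi hμ).2]
  refine ENNReal.ofReal_le_ofReal ?_
  have htel' := htel J T Qt F M h N μ hA.lower
  set P : Fin m → ℝ := fun k =>
    μ k ^ 2 * LL J T F Qt.1 N μ 2 (Pi.single (lx k 0) 1 + Pi.single (lx k 1) 1) with hP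
  have hP0 : ∀ k ∈ S, 0 ≤ P k := fun k hk =>
    mul_nonneg (sq_nonneg _) (h.PY_eq hS Qt.1 N hk hμ).1
  set V : Fin m → ℝ := fun k => μ k ^ 2 * (LL J T F Qt.1 N μ 2 (Pi.single (lx k 0) 2) +
    LL J T F Qt.1 N μ 2 (Pi.single (lx k 1) 2)) with hV
  have hsum : ∑ κ, (μ (ix κ) ^ 2 / (2 * Real.pi)) * LL J T F Qt.1 N μ 2 (Pi.single κ 2) =
      (∑ k, V k) / (2 * Real.pi) := by
    rw [sum_idx_split 0, ← Finset.sum_add_distrib, Finset.sum_div]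
    refine Finset.sum_congr rfl fun k _ => ?_
    have e0 : sel 0 k = lx k 0 := rfl
    have e1 : sel (cmp 0) k = lx k 1 := rfl
    rw [e0, e1, ix_lx, ix_lx, hV]
    ring
  have hVk : ∀ k, V k ≤ (G₁ + 2 * G₂) * Bd Qt M - if k ∈ S then 2 * P k else 0 := by
    intro k
    by_cases hk : k ∈ S
    · rw [if_pos hk]
      have hsq := h.square_rel hS Qt.1 N hμ 2 hk
      set E : ℝ := ∑ q, ∑ q', (if q ∈ S then 0 else cf J 0 q k) *
        (if q' ∈ S then 0 else cf J 0 q' k) *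
        LL J T F Qt.1 N μ 2 (Pi.single (lx q 0) 1 + Pi.single (lx q' 0) 1) with hE
      have hVE : V k = μ k ^ 2 * E - 2 * P k := by
        rw [hV, hP, ← hsq]; ring
      have hEb : μ k ^ 2 * E ≤ G₁ * Bd Qt M := by
        have h1 : μ k ^ 2 * E ≤ Λ ^ 2 * |E| := by
          exact (mul_le_mul_of_nonneg_left (le_abs_self E) (sq_nonneg _)).trans
            (mul_le_mul_of_nonneg_right (pow_le_pow_left₀ (hμ k).le (hon k hk).2 2)
              (abs_nonneg E))
        refine h1.trans ?_
        rw [hG₁, Finset.sum_mul]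
        refine (mul_le_mul_of_nonneg_left (Finset.abs_sum_le_sum_abs _ _) (sq_nonneg _)).trans ?_
        rw [Finset.mul_sum]
        refine Finset.sum_le_sum fun q _ => ?_
        rw [Finset.sum_mul]
        refine (mul_le_mul_of_nonneg_left (Finset.abs_sum_le_sum_abs _ _) (sq_nonneg _)).trans ?_
        rw [Finset.mul_sum]
        refine Finset.sum_le_sum fun q' _ => ?_
        by_cases hqq : q ∉ S ∧ q' ∉ S
        · have h2 := hb (lx q 0) (lx q' 0) (by simpa using hqq.1) (by simpa using hqq.2)
            J T Qt F M h hS N μ Λ hA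
          rw [if_neg hqq.1, if_neg hqq.2, abs_mul, abs_mul]
          have h3 : |cf J 0 q k| * |cf J 0 q' k| ≤ D ^ 2 := by
            rw [sq]
            exact mul_le_mul (h.cf_le hΔ 0 q k) (h.cf_le hΔ 0 q' k) (abs_nonneg _) hD0
          calc Λ ^ 2 * (|cf J 0 q k| * |cf J 0 q' k| *
                |LL J T F Qt.1 N μ 2 (Pi.single (lx q 0) 1 + Pi.single (lx q' 0) 1)|)
              = (|cf J 0 q k| * |cf J 0 q' k|) * (Λ ^ 2 *
                |LL J T F Qt.1 N μ 2 (Pi.single (lx q 0) 1 + Pi.single (lx q' 0) 1)|) := by ring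
            _ ≤ D ^ 2 * (C (lx q 0) (lx q' 0) * Bd Qt M) :=
                mul_le_mul h3 h2 (by positivity) (sq_nonneg _)
            _ = _ := by ring
        · have : (if q ∈ S then 0 else cf J 0 q k) * (if q' ∈ S then 0 else cf J 0 q' k) = 0 := by
            by_cases hq : q ∈ S
            · rw [if_pos hq, zero_mul]
            · have : q' ∈ S := by
                by_contra hq'
                exact hqq ⟨hq, hq'⟩
              rw [if_pos this, mul_zero]
          rw [this, zero_mul, abs_zero, mul_zero]
          exact mul_nonneg (mul_nonneg (sq_nonneg _) (hC _ _)) hBd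
      have : 0 ≤ G₂ * Bd Qt M := mul_nonneg hG₂0 hBd
      rw [hVE]
      linarith
    · rw [if_neg hk, sub_zero]
      have hterm : ∀ ε, μ k ^ 2 * LL J T F Qt.1 N μ 2 (Pi.single (lx k ε) 2) ≤ G₂ * Bd Qt M := by
        intro ε
        have h2 := hb (lx k ε) (lx k ε) (by simpa using hk) (by simpa using hk)
            J T Qt F M h hS N μ Λ hA
        rw [← Pi.single_add] at h2
        rw [hoff k hk]
        refine (mul_le_mul_of_nonneg_left (le_abs_self _) (sq_nonneg _)).trans (h2.trans ?_)
        refine mul_le_mul_of_nonneg_right ?_ hBd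
        exact Finset.single_le_sum (f := fun κ => C κ κ) (fun κ _ => hC κ κ) (Finset.mem_univ _)
      have h0 := hterm 0
      have h1 := hterm 1
      have : 0 ≤ G₁ * Bd Qt M := mul_nonneg hG₁0 hBd
      rw [hV]
      linarith
  have hVs := Finset.sum_le_sum fun k (_ : k ∈ Finset.univ) => hVk k
  rw [Finset.sum_sub_distrib, Finset.sum_const, Finset.card_univ, Fintype.card_fin,
    nsmul_eq_mul] at hVs
  have hPi : 2 * P i ≤ ∑ k, if k ∈ S then 2 * P k else 0 := by
    have := Finset.single_le_sum (f := fun k => if k ∈ S then 2 * P k else 0) (fun k _ => by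
      by_cases hk : k ∈ S
      · simp only [hk, if_true]; linarith [hP0 k hk]
      · simp [hk]) (Finset.mem_univ i)
    simpa [hi] using this
  rw [hsum, abs_div, abs_of_pos Real.two_pi_pos, div_le_iff₀ Real.two_pi_pos] at htel'
  have h4 := neg_abs_le (∑ k, V k)
  have h5 := hP0 i hi
  have : P i ≤ (m * (G₁ + 2 * G₂) + 2 * Real.pi * C₀) * Bd Qt M := by nlinarith
  exact this

theorem PS_all {Δ : ℝ} (hΔ : 1 < Δ) (hm : 1 ≤ m) (S : Finset (Fin m)) : PS Δ S := by
  have key : ∀ n : ℕ, ∀ S : Finset (Fin m), Sᶜ.card = n → PS Δ S := by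
    intro n
    induction n using Nat.strong_induction_on with
    | _ n ih =>
      intro S hn
      refine PS_step hΔ hm fun l hl => ih (insert l S)ᶜ.card ?_ _ rfl
      rw [← hn]
      refine Finset.card_lt_card ?_
      rw [Finset.compl_ssubset_compl]
      exact Finset.ssubset_insert hl
  exact key _ S rfl

lemma ecc_nonneg {a b : Fin m → ℝ} (hab : ∀ i, a i < b i) : 0 ≤ ecc a b := by
  unfold ecc
  exact div_nonneg (Real.iInf_nonneg fun i => (sub_pos.2 (hab i)).le)
    (Real.iSup_nonneg fun i => (sub_pos.2 (hab i)).le)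

lemma ecc_le_one (hm : 1 ≤ m) {a b : Fin m → ℝ} (hab : ∀ i, a i < b i) : ecc a b ≤ 1 := by
  have : Nonempty (Fin m) := ⟨⟨0, hm⟩⟩
  unfold ecc
  refine div_le_one_of_le₀ ?_ (Real.iSup_nonneg fun i => (sub_pos.2 (hab i)).le)
  have i : Fin m := ⟨0, hm⟩
  exact (ciInf_le (Set.finite_range _).bddBelow i).trans (le_ciSup (f := fun i => b i - a i)
    (Set.finite_range _).bddAbove i)

lemma two_pow_mul_zpow (hm : 1 ≤ m) :
    (((2 ^ (m - 1) : ℕ) : ℕ) : ℝ) * (2:ℝ) ^ ((1:ℤ) - (m:ℤ)) = 1 := by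
  push_cast
  rw [← zpow_natCast, ← zpow_add₀ (by norm_num)]
  have : (((m - 1 : ℕ) : ℤ)) + (1 - (m:ℤ)) = 0 := by omega
  rw [this, zpow_zero]

lemma pow_rpow_cancel (hm : 1 ≤ m) {x : ℝ} (hx : 0 ≤ x) :
    (x ^ (2 ^ (m - 1) : ℕ)) ^ ((2:ℝ) ^ ((1:ℤ) - (m:ℤ))) = x := by
  rw [← Real.rpow_natCast, ← Real.rpow_mul hx, two_pow_mul_zpow hm, Real.rpow_one]

lemma rpow_pow_cancel (hm : 1 ≤ m) {x : ℝ} (hx : 0 ≤ x) :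
    (x ^ ((2:ℝ) ^ ((1:ℤ) - (m:ℤ)))) ^ (2 ^ (m - 1) : ℕ) = x := by
  rw [← Real.rpow_natCast, ← Real.rpow_mul hx, mul_comm, two_pow_mul_zpow hm, Real.rpow_one]

lemma volume_box_pos {a b : Fin m → ℝ} (hab : ∀ i, a i < b i) :
    0 < (volume (box a b)).toReal ∧ volume (box a b) ≠ ⊤ := by
  have e : volume (box a b) = ENNReal.ofReal (∏ i, (b i - a i)) := by
    unfold box
    rw [box_eq_pi, volume_pi, Measure.pi_pi, ENNReal.ofReal_prod_of_nonneg
      fun i _ => (sub_pos.2 (hab i)).le]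
    simp only [Real.volume_Icc]
  rw [e]
  have hp : 0 < ∏ i, (b i - a i) := Finset.prod_pos fun i _ => sub_pos.2 (hab i)
  exact ⟨by rwa [ENNReal.toReal_ofReal hp.le], ENNReal.ofReal_ne_top⟩

lemma avg_le (hm : 1 ≤ m) {f : (Fin m → ℝ) → ℝ} {B : ℝ} (hB : ∀ x, |f x| ≤ B)
    {a b : Fin m → ℝ} (hab : ∀ i, a i < b i) : avg (box a b) f ≤ B := by
  obtain ⟨hv, hvt⟩ := volume_box_pos hab
  have hB0 : 0 ≤ B := (abs_nonneg _).trans (hB 0)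
  have hi : ∫ x in box a b, |f x| ^ (2 ^ (m - 1) : ℕ) ≤
      B ^ (2 ^ (m - 1) : ℕ) * (volume (box a b)).toReal := by
    have := norm_setIntegral_le_of_norm_le_const (μ := volume) (s := box a b)
      (f := fun x => |f x| ^ (2 ^ (m - 1) : ℕ)) (C := B ^ (2 ^ (m - 1) : ℕ)) hvt.lt_top
      (fun x _ => by
        rw [Real.norm_eq_abs, abs_pow, abs_abs]
        exact pow_le_pow_left₀ (abs_nonneg _) (hB x) _)
    exact (le_abs_self _).trans this
  have hi0 : 0 ≤ ∫ x in box a b, |f x| ^ (2 ^ (m - 1) : ℕ) :=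
    integral_nonneg fun x => by positivity
  unfold avg
  rw [← pow_rpow_cancel hm hB0]
  refine Real.rpow_le_rpow (by positivity) ?_ (by positivity)
  rw [inv_mul_le_iff₀ hv, mul_comm]
  exact hi

lemma avg_nonneg (S : Set (Fin m → ℝ)) (f : (Fin m → ℝ) → ℝ) : 0 ≤ avg S f := by
  unfold avg
  have hi0 : 0 ≤ ∫ x in S, |f x| ^ (2 ^ (m - 1) : ℕ) := integral_nonneg fun x => by positivity
  exact Real.rpow_nonneg (by positivity) _

lemma MalTree_ne_top (hm : 1 ≤ m) {α : ℝ} (hα : 0 < α) {f : (Fin m → ℝ) → ℝ} {B : ℝ}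
    (hB : ∀ x, |f x| ≤ B) (A : Matrix (Fin m) (Fin m) ℝ) (T : Set (ℤ × (Fin m → ℤ))) :
    MalTree α f A T ≠ ⊤ := by
  refine ne_top_of_le_ne_top (ENNReal.ofReal_ne_top (r := B)) ?_
  unfold MalTree Mal
  refine iSup₂_le fun Q _ => iSup₂_le fun a b => iSup₂_le fun hab _ => ENNReal.ofReal_le_ofReal ?_
  have h0 := ecc_nonneg hab
  have h1 : (ecc a b ^ α) ^ ((2:ℝ) ^ ((1:ℤ) - (m:ℤ))) ≤ 1 :=
    Real.rpow_le_one (Real.rpow_nonneg h0 _) (Real.rpow_le_one h0 (ecc_le_one hm hab) hα.le)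
      (by positivity)
  exact (mul_le_of_le_one_left (avg_nonneg _ _) h1).trans (avg_le hm hB hab)

lemma ecc_cube (hm : 1 ≤ m) (y : Fin m → ℝ) {r : ℝ} (hr : 0 < r) :
    ecc (fun i => y i - r) (fun i => y i + r) = 1 := by
  have : Nonempty (Fin m) := ⟨⟨0, hm⟩⟩
  unfold ecc
  have : ∀ i, y i + r - (y i - r) = 2 * r := fun i => by ring
  simp only [this, ciInf_const, ciSup_const]
  exact div_self (by positivity)

lemma integral_box_le (hm : 1 ≤ m) {α : ℝ} {f : (Fin m → ℝ) → ℝ} {A : Matrix (Fin m) (Fin m) ℝ}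
    {T : Set (ℤ × (Fin m → ℤ))} (hfin : MalTree α f A T ≠ ⊤) {Q : ℤ × (Fin m → ℤ)} (hQ : Q ∈ T)
    (y : Fin m → ℝ) {r : ℝ} (hr : 0 < r)
    (hsub : A.mulVec '' dC Q ⊆ box (fun i => y i - r) (fun i => y i + r)) :
    ∫ x in box (fun i => y i - r) (fun i => y i + r), |f x| ^ (2 ^ (m - 1) : ℕ) ≤
      (2 * r) ^ m * (MalTree α f A T).toReal ^ (2 ^ (m - 1) : ℕ) := by
  have hab : ∀ i, (fun i => y i - r) i < (fun i => y i + r) i := fun i => by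
    simp only; linarith
  have h1 : ENNReal.ofReal (avg (box (fun i => y i - r) (fun i => y i + r)) f) ≤
      MalTree α f A T := by
    unfold MalTree Mal
    refine le_trans ?_ (le_iSup₂ (f := fun Q (_ : Q ∈ T) => _) Q hQ)
    refine le_trans ?_ (le_iSup₂ (fun i => y i - r) (fun i => y i + r))
    refine le_trans (le_of_eq ?_) (le_iSup₂ hab hsub)
    rw [ecc_cube hm y hr, Real.one_rpow, Real.one_rpow, one_mul]
  have h2 := (ENNReal.ofReal_le_iff_le_toReal hfin).1 h1
  have hvol : (volume (box (fun i => y i - r) (fun i => y i + r))).toReal = (2 * r) ^ m := by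
    rw [volume_box y hr.le, ENNReal.toReal_ofReal (by positivity)]
  have hi0 : 0 ≤ ∫ x in box (fun i => y i - r) (fun i => y i + r), |f x| ^ (2 ^ (m - 1) : ℕ) :=
    integral_nonneg fun x => by positivity
  have h3 := pow_le_pow_left₀ (avg_nonneg _ _) h2 (2 ^ (m - 1))
  unfold avg at h3
  rw [rpow_pow_cancel hm (by positivity), hvol, inv_mul_le_iff₀ (by positivity)] at h3
  exact h3

lemma exists_good (hm : 1 ≤ m) {α Δ : ℝ} (hα : 0 < α) {J : Matrix (Idx m) (Fin m) ℝ}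
    {T : Set (ℤ × (Fin m → ℤ))} {Qt : ℤ × (Fin m → ℤ)} {F : Corner m → (Fin m → ℝ) → ℝ}
    (hJ : ∀ j, IsReg Δ (Amat J j)) (hT : ConvexTree T Qt) (hF : ∀ j, Continuous (F j))
    (hF' : ∀ j, HasCompactSupport (F j)) :
    (∀ j, MalTree α (F j) (Amat J j) T ≠ ⊤) ∧
    Good Δ J T Qt F (fun j => (MalTree α (F j) (Amat J j) T).toReal) := by
  have hfin : ∀ j, MalTree α (F j) (Amat J j) T ≠ ⊤ := fun j => by
    obtain ⟨B, hB⟩ := (hF j).bounded_above_of_compact_support (hF' j)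
    exact MalTree_ne_top hm hα (B := B) hB _ _
  exact ⟨hfin, hJ, hT, hF, hF', fun j => ENNReal.toReal_nonneg, fun j Q hQ y r hr hsub =>
    integral_box_le hm (hfin j) hQ y hr hsub⟩

/-- Derivative orders of the kernel `∂^0_i ∂^1_i g`. -/
def dord (i : Fin m) (κ : Idx m) : ℕ := if ix κ = i then 1 else 0

lemma hgs_one (y : ℝ) : hgs 1 y = -(2 * Real.pi * y) * Real.exp (-Real.pi * y ^ 2) := by
  simp [hgs, hermP]

lemma hasFDerivAt_gss (y : Idx m → ℝ) : HasFDerivAt gss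
    (gss y • ((-Real.pi) • ∑ k, (2 * y k) • (ContinuousLinearMap.proj k : (Idx m → ℝ) →L[ℝ] ℝ))) y := by
  have h1 : HasFDerivAt (fun y : Idx m → ℝ => ∑ k, y k ^ 2)
      (∑ k, (2 * y k) • (ContinuousLinearMap.proj k : (Idx m → ℝ) →L[ℝ] ℝ)) y := by
    refine HasFDerivAt.fun_sum fun k _ => ?_
    have := (ContinuousLinearMap.proj (R := ℝ) (φ := fun _ : Idx m => ℝ) k).hasFDerivAt (x := y)
    simpa using this.pow 2
  exact (h1.const_mul (-Real.pi)).exp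

lemma fderiv_gss (y : Idx m → ℝ) (κ : Idx m) :
    fderiv ℝ gss y (Pi.single κ 1) = -(2 * Real.pi * y κ) * gss y := by
  rw [(hasFDerivAt_gss y).fderiv]
  simp [Pi.single_apply, -Fintype.sum_sum_type]
  ring

lemma ddg_eq (i : Fin m) (x : Idx m → ℝ) : ddg i x = ∏ κ, hgs (dord i κ) (x κ) := by
  have h1 : ddg i x = (2 * Real.pi * x (Sum.inl i)) * (2 * Real.pi * x (Sum.inr i)) * gss x := by
    unfold ddg
    simp only [fderiv_gss]
    have hl : HasFDerivAt (fun y : Idx m → ℝ => -(2 * Real.pi * y (Sum.inl i)))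
        (-((2 * Real.pi) • (ContinuousLinearMap.proj (Sum.inl i) : (Idx m → ℝ) →L[ℝ] ℝ))) x :=
      (((ContinuousLinearMap.proj (R := ℝ) (φ := fun _ : Idx m => ℝ)
        (Sum.inl i)).hasFDerivAt (x := x)).const_mul (2 * Real.pi)).neg
    rw [(hl.fun_mul (hasFDerivAt_gss x)).fderiv]
    simp [Pi.single_apply, -Fintype.sum_sum_type]
    ring
  have h2 : ∀ κ, hgs (dord i κ) (x κ) =
      (if ix κ = i then -(2 * Real.pi * x κ) else 1) * Real.exp (-Real.pi * x κ ^ 2) := by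
    intro κ
    unfold dord
    split_ifs
    · exact hgs_one _
    · rw [hgs_zero, one_mul]
  rw [h1, Finset.prod_congr rfl fun κ _ => h2 κ, Finset.prod_mul_distrib, ← Real.exp_sum,
    ← Finset.mul_sum, Fintype.prod_sum_type]
  have h3 : ∀ f : Fin m → ℝ, ∏ k, (if k = i then f k else 1) = f i := fun f => by
    rw [Finset.prod_eq_single i (fun b _ hb => if_neg hb)
      (fun h => absurd (Finset.mem_univ i) h), if_pos rfl]
  rw [show (∏ k, if ix (Sum.inl k : Idx m) = i then -(2 * Real.pi * x (Sum.inl k)) else 1) = _ from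
      h3 fun k => -(2 * Real.pi * x (Sum.inl k)),
    show (∏ k, if ix (Sum.inr k : Idx m) = i then -(2 * Real.pi * x (Sum.inr k)) else 1) = _ from
      h3 fun k => -(2 * Real.pi * x (Sum.inr k))]
  unfold gss
  ring

lemma dil_ddg (i : Fin m) {t : ℝ} (ht : 0 < t) (y u : Idx m → ℝ) :
    dil t (ddg i) (y + t • u) = ∏ κ, hg (dord i κ) t (y κ + t * u κ) := by
  unfold dil hg
  rw [ddg_eq, Finset.prod_mul_distrib, Finset.prod_const, Finset.card_univ]
  have : Fintype.card (Idx m) = 2 * m := card_Idx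
  rw [this, inv_pow]
  congr 1
  refine Finset.prod_congr rfl fun κ _ => ?_
  congr 1
  simp only [Pi.smul_apply, Pi.add_apply, smul_eq_mul]
  field_simp

/-- The form at a fixed scale `t`. -/
def scaleForm (J : Matrix (Idx m) (Fin m) ℝ) (T : Set (ℤ × (Fin m → ℤ)))
    (F : Corner m → (Fin m → ℝ) → ℝ) (i : Fin m) (u : Idx m → ℝ) (t : ℝ) : ℝ :=
  ∫ p, ∫ x, bb J T F t x * ∏ κ, hg (dord i κ) t (x κ - J.mulVec p κ + t * u κ)

lemma one_add_pow_le {U : ℝ} (hU : 0 ≤ U) (n : ℕ) : (1 + U) ^ n ≤ 2 ^ n * (1 + U ^ n) := by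
  have h1 : 1 + U ≤ 2 * max 1 U := by
    have := le_max_left 1 U
    have := le_max_right 1 U
    linarith
  refine (pow_le_pow_left₀ (by positivity) h1 n).trans ?_
  rw [mul_pow]
  refine mul_le_mul_of_nonneg_left ?_ (by positivity)
  have hUn : 0 ≤ U ^ n := by positivity
  rcases max_cases 1 U with ⟨h, _⟩ | ⟨h, _⟩ <;> rw [h]
  · rw [one_pow]; linarith
  · linarith

lemma const_pow_le {U : ℝ} (hU : 0 ≤ U) (m : ℕ) :
    (2 * Real.exp Real.pi * (1 + U)) ^ (2 * m) * (1 + Real.sqrt 2 * U) ^ (2 * m) ≤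
      (4 * Real.exp Real.pi) ^ (2 * m) * 2 ^ (4 * m) * (1 + U ^ (4 * m)) := by
  have h2 : Real.sqrt 2 ≤ 2 := by
    rw [Real.sqrt_le_left (by norm_num)]; norm_num
  have h1 : 1 + Real.sqrt 2 * U ≤ 2 * (1 + U) := by nlinarith
  calc _ ≤ (2 * Real.exp Real.pi * (1 + U)) ^ (2 * m) * (2 * (1 + U)) ^ (2 * m) :=
        mul_le_mul_of_nonneg_left (pow_le_pow_left₀ (by positivity) h1 _) (by positivity)
    _ = (4 * Real.exp Real.pi) ^ (2 * m) * (1 + U) ^ (4 * m) := by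
        rw [← mul_pow, show 4 * m = 2 * (2 * m) by ring, pow_mul (1 + U) 2 (2 * m), ← mul_pow]
        congr 1; ring
    _ ≤ (4 * Real.exp Real.pi) ^ (2 * m) * (2 ^ (4 * m) * (1 + U ^ (4 * m))) :=
        mul_le_mul_of_nonneg_left (one_add_pow_le hU _) (by positivity)
    _ = _ := by ring

lemma lintegral_scaleForm_le {Δ : ℝ} (hΔ : 1 < Δ) (hm : 1 ≤ m) (i : Fin m) : ∃ C : ℝ, 0 ≤ C ∧
    ∀ (J : Matrix (Idx m) (Fin m) ℝ) (T : Set (ℤ × (Fin m → ℤ))) (Qt : ℤ × (Fin m → ℤ))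
    (F : Corner m → (Fin m → ℝ) → ℝ) (M : Corner m → ℝ), Good Δ J T Qt F M →
    ∀ (N : ℕ) (u : Idx m → ℝ),
    ∫⁻ t in Set.Ioc ((2:ℝ) ^ (Qt.1 - N)) ((2:ℝ) ^ Qt.1),
      ENNReal.ofReal t⁻¹ * ‖scaleForm J T F i u t‖ₑ ≤
      ENNReal.ofReal (C * (1 + en u ^ (4 * m)) * Bd Qt M) := by
  have hs2 : 0 < Real.sqrt 2 := by positivity
  have hs1 : 1 ≤ Real.sqrt 2 := by rw [Real.one_le_sqrt]; norm_num
  obtain ⟨C, hC, hf⟩ := form_le hΔ (S := ∅) (l := i) (PS_all hΔ hm _) (inv_pos.2 hs2) (fun _ => 0)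
  refine ⟨C * ((4 * Real.exp Real.pi) ^ (2 * m) * 2 ^ (4 * m)), by positivity, ?_⟩
  intro J T Qt F M h N u
  have hS : SymOn ∅ J F := ⟨fun k hk => absurd hk (Finset.notMem_empty k),
    fun k hk => absurd hk (Finset.notMem_empty k)⟩
  have hU : 0 ≤ en u := Real.sqrt_nonneg _
  have hBd := h.Bd_nonneg
  have hinv : (Real.sqrt 2)⁻¹ ≤ 1 := inv_le_one_of_one_le₀ hs1
  have hexp : 1 ≤ Real.exp Real.pi := Real.one_le_exp Real.pi_pos.le
  have key := hf J T Qt F M h hS N (fun _ => 2 * (1 + en u)) (2 * (1 + en u)) (Real.sqrt 2)⁻¹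
    (fun k hk => absurd hk (Finset.notMem_empty k)) (fun _ _ _ => rfl) le_rfl (by linarith)
    (2 * Real.exp Real.pi * (1 + en u)) (Real.sqrt 2 * en u) (fun ε => Real.sqrt 2 * u (lx i ε))
    (fun κ t y => hg (dord i κ) t (y + t * u κ)) (by nlinarith)
    (fun ε => by
      rw [abs_mul, abs_of_pos hs2]
      exact mul_le_mul_of_nonneg_left (abs_le_en u _) hs2.le)
    (fun ε => by
      funext t y
      have e1 : Real.sqrt 2 * (t * (Real.sqrt 2)⁻¹) = t := by field_simp
      have e2 : t * (Real.sqrt 2)⁻¹ * (Real.sqrt 2 * u (lx i ε)) = t * u (lx i ε) := by field_simp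
      have e3 : dord i (lx i ε) = 0 + 1 := by
        unfold dord; rw [ix_lx, if_pos rfl]
      rw [e1, e2, e3])
    (fun κ hκ t ht y => by
      have e3 : dord i κ = 0 := if_neg hκ
      rw [e3, abs_of_nonneg (hg_zero_nonneg ht.le _), mul_comm t (2 * (1 + en u))]
      refine hg_shift ht hU ?_
      rw [abs_mul, abs_of_pos ht, mul_comm]
      exact mul_le_mul_of_nonneg_right (abs_le_en u κ) ht.le)
  refine le_trans (le_of_eq rfl) (key.trans (ENNReal.ofReal_le_ofReal ?_))
  have := mul_le_mul_of_nonneg_right (mul_le_mul_of_nonneg_left (const_pow_le hU m) hC) hBd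
  refine le_trans (le_of_eq (by ring)) (this.trans (le_of_eq (by ring)))

lemma ConvexTree.Tkset_eq_empty (hm : 1 ≤ m) {T : Set (ℤ × (Fin m → ℤ))} {Qt : ℤ × (Fin m → ℤ)}
    (h : ConvexTree T Qt) {k : ℤ} (hk : Qt.1 < k) : Tkset T k = ∅ := by
  refine Set.eq_empty_iff_forall_notMem.2 fun x hx => ?_
  obtain ⟨Q, hQ, hQk, -⟩ := mem_Tkset.mp hx
  have h1 := measure_mono (μ := volume) (h.2.1 Q hQ)
  rw [volume_dC, volume_dC, ENNReal.ofReal_le_ofReal_iff (by positivity), hQk] at h1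
  have h2 : ((2:ℝ) ^ Qt.1) ^ m < ((2:ℝ) ^ k) ^ m :=
    pow_lt_pow_left₀ (zpow_lt_zpow_right₀ (by norm_num) hk) (by positivity) (by omega)
  linarith

lemma scaleForm_eq {J : Matrix (Idx m) (Fin m) ℝ} {T : Set (ℤ × (Fin m → ℤ))}
    {F : Corner m → (Fin m → ℝ) → ℝ} {i : Fin m} {u : Idx m → ℝ} {k : ℤ} {t : ℝ}
    (ht : t ∈ Set.Ioc ((2:ℝ) ^ (k - 1)) ((2:ℝ) ^ k)) :
    ∫ p : Fin m → ℝ, ∫ x : Idx m → ℝ,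
      (∏ j, Set.indicator ((Amat J j).mulVec '' Tkset T k) (F j) (proj j x)) *
        dil t (ddg i) (x - J.mulVec p + t • u) = scaleForm J T F i u t := by
  have ht0 : 0 < t := lt_trans (by positivity) ht.1
  unfold scaleForm bb fk
  rw [lev_eq ht]
  simp only [dil_ddg i ht0, Pi.sub_apply]

lemma scaleForm_eq_zero (hm : 1 ≤ m) {J : Matrix (Idx m) (Fin m) ℝ} {T : Set (ℤ × (Fin m → ℤ))}
    {Qt : ℤ × (Fin m → ℤ)} (h : ConvexTree T Qt) {F : Corner m → (Fin m → ℝ) → ℝ} {i : Fin m}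
    {u : Idx m → ℝ} {k : ℤ} (hk : Qt.1 < k) {t : ℝ}
    (ht : t ∈ Set.Ioc ((2:ℝ) ^ (k - 1)) ((2:ℝ) ^ k)) : scaleForm J T F i u t = 0 := by
  unfold scaleForm bb fk
  rw [lev_eq ht, h.Tkset_eq_empty hm hk]
  simp [Finset.prod_const]

lemma tsum_lintegral_Ioc_le {f : ℝ → ℝ≥0∞} {K : ℤ} {B : ℝ≥0∞}
    (hf : ∀ N : ℕ, ∫⁻ t in Set.Ioc ((2:ℝ) ^ (K - N)) ((2:ℝ) ^ K), f t ≤ B)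
    (h0 : ∀ k, K < k → ∀ t ∈ Set.Ioc ((2:ℝ) ^ (k - 1)) ((2:ℝ) ^ k), f t = 0) :
    ∑' k : ℤ, ∫⁻ t in Set.Ioc ((2:ℝ) ^ (k - 1)) ((2:ℝ) ^ k), f t ≤ B := by
  have mono : ∀ {a b : ℤ}, a ≤ b → (2:ℝ) ^ a ≤ (2:ℝ) ^ b := fun hab =>
    zpow_le_zpow_right₀ one_le_two hab
  rw [ENNReal.tsum_eq_iSup_sum]
  refine iSup_le fun s => ?_
  have e : ∑ k ∈ s, ∫⁻ t in Set.Ioc ((2:ℝ) ^ (k - 1)) ((2:ℝ) ^ k), f t =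
      ∑ k ∈ s with k ≤ K, ∫⁻ t in Set.Ioc ((2:ℝ) ^ (k - 1)) ((2:ℝ) ^ k), f t := by
    refine (Finset.sum_filter_of_ne fun k _ hk => ?_).symm
    by_contra hkK
    exact hk (setLIntegral_eq_zero measurableSet_Ioc (h0 k (not_le.1 hkK)))
  have hdis : ((s.filter (· ≤ K) : Finset ℤ) : Set ℤ).PairwiseDisjoint
      fun k : ℤ => Set.Ioc ((2:ℝ) ^ (k - 1)) ((2:ℝ) ^ k) := by
    intro a _ b _ hab
    refine Set.disjoint_left.2 fun t ha hb => hab ?_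
    rw [← lev_eq ha, ← lev_eq hb]
  rw [e, ← lintegral_biUnion_finset hdis (fun _ _ => measurableSet_Ioc)]
  refine le_trans (lintegral_mono_set ?_) (hf (∑ k ∈ s, (K - k + 1).toNat))
  refine Set.iUnion₂_subset fun k hk t ht => ?_
  obtain ⟨hks, hkK⟩ := Finset.mem_filter.1 hk
  refine ⟨lt_of_le_of_lt (mono ?_) ht.1, ht.2.trans (mono hkK)⟩
  have := Finset.single_le_sum (f := fun k : ℤ => (K - k + 1).toNat) (fun _ _ => Nat.zero_le _) hks
  omega

lemma enorm_LambdaTilde_le {J : Matrix (Idx m) (Fin m) ℝ} {T : Set (ℤ × (Fin m → ℤ))}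
    {F : Corner m → (Fin m → ℝ) → ℝ} {i : Fin m} {u : Idx m → ℝ} {c : ℝ → ℂ}
    (hc : ∀ᵐ t ∂(volume.restrict (Set.Ioi (0:ℝ))), ‖c t‖ ≤ 1) :
    ‖LambdaTilde J T c u i F‖ₑ ≤ ENNReal.ofReal (1 + en u ^ (4 * m))⁻¹ *
      ∑' k : ℤ, ∫⁻ t in Set.Ioc ((2:ℝ) ^ (k - 1)) ((2:ℝ) ^ k),
        ENNReal.ofReal t⁻¹ * ‖scaleForm J T F i u t‖ₑ := by
  have hU : 0 ≤ en u := Real.sqrt_nonneg _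
  unfold LambdaTilde
  refine enorm_tsum_le_tsum_enorm.trans ?_
  rw [← ENNReal.tsum_mul_left]
  refine ENNReal.tsum_le_tsum fun k => ?_
  refine (enorm_integral_le_lintegral_enorm _).trans ?_
  rw [← lintegral_const_mul' _ _ ENNReal.ofReal_ne_top]
  have hsub : Set.Ioc ((2:ℝ) ^ (k - 1)) ((2:ℝ) ^ k) ⊆ Set.Ioi 0 := fun t ht =>
    lt_trans (by positivity) ht.1
  refine lintegral_mono_ae ?_
  filter_upwards [ae_restrict_of_ae_restrict_of_subset hsub hc,
    ae_restrict_mem measurableSet_Ioc] with t hct ht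
  have ht0 : 0 < t := hsub ht
  rw [scaleForm_eq ht, enorm_mul]
  have h1 : ‖c t‖ₑ ≤ 1 := by
    rw [← ofReal_norm, ← ENNReal.ofReal_one]
    exact ENNReal.ofReal_le_ofReal hct
  refine (mul_le_mul' h1 le_rfl).trans (le_of_eq ?_)
  rw [one_mul, ← ofReal_norm, Complex.norm_real, ofReal_norm, enorm_mul,
    enorm_mul, Real.enorm_of_nonneg (by positivity), Real.enorm_of_nonneg (by positivity), mul_assoc]

end

/-- Theorem 4 (local bound for the `x`-localized form `Λ̃_𝒯`). -/
theorem statement3 (m : ℕ) (hm : 2 ≤ m) (Δ α : ℝ) (hΔ : 1 < Δ)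
    (hα0 : 0 < α) (hα : α < 1 / m) :
    ∃ C : ℝ≥0, ∀ J : Matrix (Idx m) (Fin m) ℝ, IsUnit (Jb1 J).det →
      (∀ j : Corner m, IsReg Δ (Amat J j)) →
      ∀ (T : Set (ℤ × (Fin m → ℤ))) (Qt : ℤ × (Fin m → ℤ)), ConvexTree T Qt →
      ∀ c : ℝ → ℂ, Measurable c →
        (∀ᵐ t ∂(volume.restrict (Set.Ioi (0:ℝ))), ‖c t‖ ≤ 1) →
      ∀ u : Idx m → ℝ, ∀ i : Fin m,
      ∀ F : Corner m → (Fin m → ℝ) → ℝ,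
        (∀ j, ContDiff ℝ (⊤ : ℕ∞) (F j) ∧ HasCompactSupport (F j)) →
        ENNReal.ofReal ‖LambdaTilde J T c u i F‖ ≤
          C * volume (dC Qt) * ∏ j : Corner m, MalTree α (F j) (Amat J j) T := by
  have hm1 : 1 ≤ m := by omega
  choose C hC hf using lintegral_scaleForm_le (m := m) hΔ hm1
  refine ⟨Real.toNNReal (∑ i, C i), ?_⟩
  intro J _ hJ T Qt hT c _ hc u i F hF
  obtain ⟨hfin, hgood⟩ := exists_good hm1 hα0 hJ hT (fun j => (hF j).1.continuous)
    (fun j => (hF j).2)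
  set M : Corner m → ℝ := fun j => (MalTree α (F j) (Amat J j) T).toReal with hM
  have hU : 0 ≤ en u := Real.sqrt_nonneg _
  have hBd := hgood.Bd_nonneg
  have h1 := tsum_lintegral_Ioc_le (fun N => hf i J T Qt F M hgood N u) fun k hk t ht => by
    rw [scaleForm_eq_zero hm1 hT hk ht, enorm_zero, mul_zero]
  rw [ofReal_norm]
  refine (enorm_LambdaTilde_le hc).trans ((mul_le_mul' le_rfl h1).trans ?_)
  rw [← ENNReal.ofReal_mul (by positivity)]
  have e1 : (1 + en u ^ (4 * m))⁻¹ * (C i * (1 + en u ^ (4 * m)) * Bd Qt M) = C i * Bd Qt M := by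
    have : (1 + en u ^ (4 * m)) ≠ 0 := by positivity
    field_simp
  have e2 : ∏ j : Corner m, MalTree α (F j) (Amat J j) T = ENNReal.ofReal (∏ j, M j) := by
    rw [ENNReal.ofReal_prod_of_nonneg fun j _ => hgood.nn j]
    exact Finset.prod_congr rfl fun j _ => (ENNReal.ofReal_toReal (hfin j)).symm
  have hsum : 0 ≤ ∑ i, C i := Finset.sum_nonneg fun i _ => hC i
  have e3 : ((Real.toNNReal (∑ i, C i) : ℝ≥0) : ℝ≥0∞) = ENNReal.ofReal (∑ i, C i) := rfl
  rw [e1, e2, e3, volume_dC, ← ENNReal.ofReal_mul hsum, ← ENNReal.ofReal_mul (by positivity),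
    mul_assoc]
  exact ENNReal.ofReal_le_ofReal (mul_le_mul_of_nonneg_right
    (Finset.single_le_sum (fun i _ => hC i) (Finset.mem_univ i)) hBd)

end SBL
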